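/- Let T be a complete simple first-order L-theory (no L-formula has the tree property with respect to T) and suppose T_aut has a model completion T^mc_aut. Then every completion T* of T^mc_aut is simple, i.e., no L⁺-formula has the tree property with respect to T*. -/

import Mathlib

namespace FirstOrder

open Language Structure

universe u v w

namespace ShelahE34

/-- The index type for the function symbols of the language consisting of a single
unary function symbol `σ`. -/
inductive SigmaFunc : ℕ → Type
  | sigma : SigmaFunc 1

/-- The language consisting of a single unary function symbol `σ`. -/
def sigmaLang : Language.{0, 0} :=
  ⟨SigmaFunc, fun _ => Empty⟩

/-- `L⁺`: the language `L` expanded by one new unary function symbol `σ`. -/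
abbrev LPlus (L : Language.{u, v}) : Language :=
  L.sum sigmaLang

/-- The new unary function symbol `σ` of `L⁺`. -/
def sigmaSymb (L : Language.{u, v}) : (LPlus L).Functions 1 :=
  Sum.inr SigmaFunc.sigma

/-- Application of the symbol `σ` to a term of `L⁺`. -/
def sigmaTerm {L : Language.{u, v}} {α : Type w} (t : (LPlus L).Term α) : (LPlus L).Term α :=
  Functions.apply₁ (sigmaSymb L) t

/-- The interpretation of the symbol `σ` in an `L⁺`-structure, as a function. -/
def sigmaMap (L : Language.{u, v}) (N : Type w) [(LPlus L).Structure N] : N → N :=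
  fun x => funMap (sigmaSymb L) ![x]

/-- The sentence `(∀x)(∀y)(σ(x) = σ(y) → x = y)`. -/
def sigmaInj (L : Language.{u, v}) : (LPlus L).Sentence :=
  ∀' ∀' ((sigmaTerm (&0) =' sigmaTerm (&1)) ⟹ ((&0) =' (&1)))

/-- The sentence `(∀y)(∃x)(σ(x) = y)`. -/
def sigmaSurj (L : Language.{u, v}) : (LPlus L).Sentence :=
  ∀' ∃' (sigmaTerm (&1) =' (&0))

/-- The sentence `(∀x̄)(F(σ(x̄)) = σ(F(x̄)))` for a function symbol `F` of `L`. -/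
def funCommSentence (L : Language.{u, v}) {n : ℕ} (F : L.Functions n) : (LPlus L).Sentence :=
  BoundedFormula.alls
    (sigmaTerm (Term.func (Sum.inl F : (LPlus L).Functions n) fun i => Term.var (Sum.inr i)) ='
      Term.func (Sum.inl F : (LPlus L).Functions n) fun i => sigmaTerm (Term.var (Sum.inr i)))

/-- The sentence `(∀x̄)(R(x̄) ↔ R(σ(x̄)))` for a relation symbol `R` of `L`. -/
def relPresSentence (L : Language.{u, v}) {n : ℕ} (R : L.Relations n) : (LPlus L).Sentence :=
  BoundedFormula.alls
    ((Relations.boundedFormula (Sum.inl R : (LPlus L).Relations n)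
        fun i => Term.var (Sum.inr i)) ⇔
      Relations.boundedFormula (Sum.inl R : (LPlus L).Relations n)
        fun i => sigmaTerm (Term.var (Sum.inr i)))

/-- `T_aut`: the `L⁺`-theory consisting of `T` together with the sentences asserting that `σ`
is an automorphism. -/
def Taut {L : Language.{u, v}} (T : L.Theory) : (LPlus L).Theory :=
  (LHom.sumInl : L →ᴸ LPlus L).onTheory T ∪ {sigmaInj L, sigmaSurj L} ∪
    {φ | ∃ (n : ℕ) (F : L.Functions n), φ = funCommSentence L F} ∪
    {φ | ∃ (n : ℕ) (R : L.Relations n), φ = relPresSentence L R}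

/-- A theory is complete and consistent if it is satisfiable and semantically decides every
sentence. -/
def SemComplete {L' : Language.{u, v}} (U : L'.Theory) : Prop :=
  U.IsSatisfiable ∧ ∀ φ : L'.Sentence, U ⊨ᵇ φ ∨ U ⊨ᵇ ∼φ

/-- A completion of a theory `S`: a complete consistent theory in the same language
containing `S`. -/
def IsCompletionOf {L' : Language.{u, v}} (S U : L'.Theory) : Prop :=
  S ⊆ U ∧ SemComplete U

/-- The atomic diagram of a structure `M`: all atomic and negated atomic sentences with
constants from `M` that hold in `M`. -/
def atomicDiagram (L' : Language.{u, v}) (M : Type w) [L'.Structure M] : (L'[[M]]).Theory :=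
  {φ | (φ.IsAtomic ∨ ∃ ψ : (L'[[M]]).Sentence, ψ.IsAtomic ∧ φ = ∼ψ) ∧ M ⊨ φ}

/-- `Tstar` is a model completion of `S`: it contains `S`, every model of `S` embeds into a
model of `Tstar`, and for every model `M` of `S`, `Tstar` together with the atomic diagram of
`M` is a complete consistent theory. -/
def IsModelCompletion.{u', v', w'} {L' : Language.{u', v'}} (S Tstar : L'.Theory) : Prop :=
  S ⊆ Tstar ∧
    (∀ M : Theory.ModelType.{u', v', w'} S, ∃ N : Theory.ModelType.{u', v', w'} Tstar,
      Nonempty (M ↪[L'] N)) ∧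
    ∀ M : Theory.ModelType.{u', v', w'} S,
      SemComplete ((L'.lhomWithConstants M).onTheory Tstar ∪ atomicDiagram L' M)

/-- A formula has the tree property with respect to a theory `S` (witnessed by some `k ≥ 2`):
there is a model `N` of `S` and a tree of parameter tuples `(ā_η)` indexed by finite sequences
of natural numbers such that every branch is consistent (every finite initial segment is
simultaneously realizable in some elementary extension of `N`) while for each node `η`, no `k`
of the formulas `φ(x̄, ā_{η⌢⟨i⟩})` (with distinct `i`) are simultaneously realizable in any
elementary extension of `N`. -/
def HasTreeProperty.{u', v', w'} {L' : Language.{u', v'}} (S : L'.Theory) : Prop :=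
  ∃ (nx ny : ℕ) (φ : L'.Formula (Fin nx ⊕ Fin ny)) (k : ℕ), 2 ≤ k ∧
    ∃ (N : Theory.ModelType.{u', v', w'} S) (a : List ℕ → Fin ny → N),
      (∀ (ρ : ℕ → ℕ) (n : ℕ),
        ∃ (N' : Type w') (_ : L'.Structure N') (g : N ↪ₑ[L'] N') (c : Fin nx → N'),
          ∀ m : ℕ, m ≤ n → φ.Realize (Sum.elim c fun i => g (a ((List.range m).map ρ) i))) ∧
      ∀ (η : List ℕ) (N' : Type w') (_ : L'.Structure N') (g : N ↪ₑ[L'] N')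
        (c : Fin nx → N') (s : Finset ℕ), s.card = k →
          ¬ ∀ i ∈ s, φ.Realize (Sum.elim c fun j => g (a (η ++ [i]) j))

/-- A theory is simple if no formula has the tree property with respect to it. -/
def IsSimpleTheory.{u', v', w'} {L' : Language.{u', v'}} (S : L'.Theory) : Prop :=
  ¬ HasTreeProperty.{u', v', w'} S

end ShelahE34

end FirstOrder

namespace FirstOrder
open Language Structure
set_option linter.all false
universe u v w u' v' w'
namespace ShelahE34

section Elem
variable {L : Language.{u, v}}

/-- Elementary maps, as a predicate on raw functions. -/
def IsElem (L : Language.{u, v}) {M : Type w} {N : Type w'} [L.Structure M] [L.Structure N]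
    (f : M → N) : Prop :=
  ∀ ⦃n : ℕ⦄ (φ : L.Formula (Fin n)) (x : Fin n → M), φ.Realize (f ∘ x) ↔ φ.Realize x

variable {M : Type*} {N : Type*} {P : Type*} [L.Structure M] [L.Structure N] [L.Structure P]

/-- Bundle an elementary map. -/
def IsElem.toEmb {f : M → N} (h : IsElem L f) : M ↪ₑ[L] N := ⟨f, h⟩

theorem IsElem.of_emb (f : M ↪ₑ[L] N) : IsElem L f := fun _ φ x => f.map_formula φ x

theorem IsElem.formula {f : M → N} (h : IsElem L f) {α : Type*} (φ : L.Formula α) (x : α → M) :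
    φ.Realize (f ∘ x) ↔ φ.Realize x := h.toEmb.map_formula φ x

theorem IsElem.formula' {f : M → N} (h : IsElem L f) {α : Type*} (φ : L.Formula α) (x : α → M) :
    φ.Realize (fun a => f (x a)) ↔ φ.Realize x := h.toEmb.map_formula φ x

theorem IsElem.inj {f : M → N} (h : IsElem L f) : Function.Injective f := h.toEmb.injective

theorem IsElem.ident : IsElem L (id : M → M) := fun _ _ _ => Iff.rfl

theorem IsElem.comp {g : N → P} {f : M → N} (hg : IsElem L g) (hf : IsElem L f) :
    IsElem L (g ∘ f) := fun _ φ x => (hg φ (f ∘ x)).trans (hf φ x)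

theorem IsElem.sentence {f : M → N} (h : IsElem L f) (φ : L.Sentence) : M ⊨ φ ↔ N ⊨ φ :=
  h.toEmb.map_sentence φ

theorem IsElem.model {f : M → N} (h : IsElem L f) (T : L.Theory) : M ⊨ T ↔ N ⊨ T :=
  h.toEmb.theory_model_iff T

theorem IsElem.of_equiv (f : M ≃[L] N) : IsElem L f := IsElem.of_emb f.toElementaryEmbedding

/-- If `g ∘ f` and `g` are elementary so is `f`. -/
theorem IsElem.of_comp {g : N → P} {f : M → N} (hg : IsElem L g) (hf : IsElem L (g ∘ f)) :
    IsElem L f := fun _ φ x => (hg φ (f ∘ x)).symm.trans (hf φ x)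

theorem IsElem.of_all {f : M → N} (h : ∀ (φ : L.Formula M), φ.Realize id → φ.Realize f) :
    IsElem L f := by
  intro n φ x
  constructor
  · intro h1
    by_contra h2
    have := h ((φ.relabel x).not) (by
      rw [Formula.realize_not, Formula.realize_relabel]; exact h2)
    rw [Formula.realize_not, Formula.realize_relabel] at this
    exact this h1
  · intro h1
    have := h (φ.relabel x) (by rw [Formula.realize_relabel]; exact h1)
    rwa [Formula.realize_relabel] at this

theorem IsElem.funMap {f : M → N} (h : IsElem L f) {n : ℕ} (F : L.Functions n) (x : Fin n → M) :
    f (funMap F x) = Structure.funMap F (f ∘ x) := h.toEmb.map_fun F x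

theorem IsElem.relMap {f : M → N} (h : IsElem L f) {n : ℕ} (F : L.Relations n) (x : Fin n → M) :
    RelMap F (f ∘ x) ↔ RelMap F x := h.toEmb.map_rel F x

/-- If all formulas are preserved from `p` to `q` then they are equivalent -/
theorem iff_of_imp {Ξ : Type*} {p : Ξ → M} {q : Ξ → N}
    (h : ∀ φ : L.Formula Ξ, φ.Realize p → φ.Realize q) (φ : L.Formula Ξ) :
    φ.Realize p ↔ φ.Realize q := by
  refine ⟨h φ, fun h1 => ?_⟩
  by_contra h2
  exact h φ.not h2 h1

end Elem

section Ultra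

/-- ultrapower -/
abbrev UP {I : Type u'} (U : Ultrafilter I) (M : Type w) : Type (max u' w) :=
  (U : Filter I).Product (fun _ : I => M)

/-- class of a sequence in the ultrapower -/
def UP.mk {I : Type u'} (U : Ultrafilter I) {M : Type w} (x : I → M) : UP U M :=
  (Quotient.mk _ x : (U : Filter I).Product (fun _ : I => M))

/-- representative -/
noncomputable def UP.out {I : Type u'} {U : Ultrafilter I} {M : Type w} (x : UP U M) : I → M :=
  Quotient.out x

theorem UP.mk_out {I : Type u'} {U : Ultrafilter I} {M : Type w} (x : UP U M) :
    UP.mk U x.out = x := Quotient.out_eq x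

theorem UP.mk_eq {I : Type u'} {U : Ultrafilter I} {M : Type w} (x y : I → M) :
    UP.mk U x = UP.mk U y ↔ ∀ᶠ i in U, x i = y i := Quotient.eq''

theorem UP.surj {I : Type u'} {U : Ultrafilter I} {M : Type w} (x : UP U M) :
    ∃ y, UP.mk U y = x := ⟨_, UP.mk_out x⟩

/-- diagonal -/
def UP.diag {I : Type u'} (U : Ultrafilter I) {M : Type w} (x : M) : UP U M := UP.mk U fun _ => x

variable {L : Language.{u, v}} {I : Type u'} {U : Ultrafilter I} {M : Type w} [L.Structure M]
  [Nonempty M]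

theorem UP.los {α : Type*} (φ : L.Formula α) (x : α → I → M) :
    φ.Realize (fun a => UP.mk U (x a)) ↔ ∀ᶠ i in U, φ.Realize (fun a => x a i) :=
  Ultraproduct.realize_formula_cast φ x

theorem UP.los' {α : Type*} (φ : L.Formula α) (x : α → UP U M) :
    φ.Realize x ↔ ∀ᶠ i in U, φ.Realize (fun a => (x a).out i) := by
  rw [← UP.los]
  simp only [UP.mk_out]

theorem UP.diag_elem : IsElem L (UP.diag U : M → UP U M) := by
  intro n φ x
  have := UP.los (U := U) φ (fun a _ => x a)
  refine Iff.trans this ?_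
  simp

theorem UP.funMap {n : ℕ} (F : L.Functions n) (x : Fin n → I → M) :
    Structure.funMap F (fun a => UP.mk U (x a)) = UP.mk U fun i => funMap F (fun a => x a i) :=
  Ultraproduct.funMap_cast (u := U) (M := fun _ => M) F x

theorem UP.relMap {n : ℕ} (F : L.Relations n) (x : Fin n → I → M) :
    RelMap F (fun a => UP.mk U (x a)) ↔ ∀ᶠ i in U, RelMap F (fun a => x a i) := by
  have := UP.los (U := U) (F.formula (α := Fin n) (fun i => Term.var i)) x
  simpa [Formula.realize_rel] using this

end Ultra

section UF

theorem exists_uf {I : Type*} (S : Set (Set I)) (hne : S.Nonempty)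
    (hd : ∀ A ∈ S, ∀ B ∈ S, ∃ C ∈ S, C ⊆ A ∩ B) (h : ∀ A ∈ S, A.Nonempty) :
    ∃ U : Ultrafilter I, ∀ A ∈ S, A ∈ U := by
  have : ∃ U : Ultrafilter I, S ⊆ (U : Filter I).sets := by
    apply Ultrafilter.exists_ultrafilter_of_finite_inter_nonempty
    intro t ht
    have : ∃ C ∈ S, C ⊆ ⋂₀ (t : Set (Set I)) := by
      classical
      induction t using Finset.induction_on with
      | empty => obtain ⟨A, hA⟩ := hne; exact ⟨A, hA, by simp⟩
      | insert a t _ ih =>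
        simp only [Finset.coe_insert, Set.insert_subset_iff] at ht
        obtain ⟨C, hC, h1⟩ := ih ht.2
        obtain ⟨E, hE, h2⟩ := hd _ ht.1 _ hC
        refine ⟨E, hE, ?_⟩
        rw [Finset.coe_insert, Set.sInter_insert]
        exact Set.subset_inter (h2.trans Set.inter_subset_left)
          ((h2.trans Set.inter_subset_right).trans h1)
    obtain ⟨C, hC, h1⟩ := this
    exact (h C hC).mono h1
  obtain ⟨U, hU⟩ := this
  exact ⟨U, fun A hA => hU hA⟩

/-- ultrafilter from formulas -/
theorem exists_uf_formula {L : Language.{u, v}} {α : Type*} {E : Type*} [L.Structure E]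
    (x : α → E) {I : Type*} (Pr : I → L.Formula α → Prop)
    (hinf : ∀ i φ ψ, Pr i (φ ⊓ ψ) → Pr i φ ∧ Pr i ψ)
    (h : ∀ φ : L.Formula α, φ.Realize x → ∃ i, Pr i φ) :
    ∃ U : Ultrafilter I, ∀ φ : L.Formula α, φ.Realize x → ∀ᶠ i in U, Pr i φ := by
  obtain ⟨U, hU⟩ := exists_uf {A : Set I | ∃ φ : L.Formula α, φ.Realize x ∧ A = {i | Pr i φ}}
    ⟨_, ⊤, by simp [Formula.Realize], rfl⟩ (by
      rintro _ ⟨φ, h1, rfl⟩ _ ⟨ψ, h2, rfl⟩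
      refine ⟨_, ⟨φ ⊓ ψ, ?_, rfl⟩, fun i hi => hinf i φ ψ hi⟩
      exact Formula.realize_inf.2 ⟨h1, h2⟩) (by
      rintro _ ⟨φ, h1, rfl⟩
      exact h φ h1)
  exact ⟨U, fun φ hφ => hU _ ⟨φ, hφ, rfl⟩⟩

end UF

end ShelahE34
end FirstOrder

namespace FirstOrder
set_option linter.all false
open Language Structure
universe u v w u' v' w'
namespace ShelahE34

variable {L : Language.{u, v}}

theorem finvar {X : Type*} (φ : L.Formula X) : ∃ (p : ℕ) (f : Fin p → X) (ψ : L.Formula (Fin p)),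
    Function.Injective f ∧
    ∀ (M : Type w) [L.Structure M] (x : X → M), φ.Realize x ↔ ψ.Realize (x ∘ f) := by
  classical
  let e := Fintype.equivFin φ.freeVarFinset
  refine ⟨Fintype.card φ.freeVarFinset, fun i => (e.symm i).1, φ.restrictFreeVar (fun a => e a), ?_, ?_⟩
  · exact Subtype.val_injective.comp e.symm.injective
  · intro M _ x
    symm
    refine BoundedFormula.realize_restrictFreeVar x ?_
    intro a
    simp

theorem finvars {X Y : Type*} (φ : L.Formula (X ⊕ Y)) : ∃ (p q : ℕ) (f : Fin p → X) (g : Fin q → Y)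
    (ψ : L.Formula (Fin p ⊕ Fin q)), Function.Injective f ∧ Function.Injective g ∧
    ∀ (M : Type w) [L.Structure M] (x : X → M) (y : Y → M),
      φ.Realize (Sum.elim x y) ↔ ψ.Realize (Sum.elim (x ∘ f) (y ∘ g)) := by
  classical
  obtain ⟨r, h, ψ, hinj, hψ⟩ := finvar.{u,v,w} φ
  -- indices of left and right type
  let A := {i : Fin r // (h i).isLeft}
  let B := {i : Fin r // ¬ (h i).isLeft}
  let eA := Fintype.equivFin A
  let eB := Fintype.equivFin B
  refine ⟨Fintype.card A, Fintype.card B, fun i => (h (eA.symm i).1).getLeft (eA.symm i).2,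
    fun i => (h (eB.symm i).1).getRight (by simpa using (eB.symm i).2),
    ψ.relabel (fun i => if hi : (h i).isLeft then Sum.inl (eA ⟨i, hi⟩) else Sum.inr (eB ⟨i, hi⟩)), ?_, ?_, ?_⟩
  · intro i j hij
    apply eA.symm.injective
    apply Subtype.ext
    apply hinj
    have h1 := Sum.inl_getLeft _ (eA.symm i).2
    have h2 := Sum.inl_getLeft _ (eA.symm j).2
    rw [← h1, ← h2]
    exact congrArg Sum.inl hij
  · intro i j hij
    apply eB.symm.injective
    apply Subtype.ext
    apply hinj
    have h1 := Sum.inr_getRight (h (eB.symm i).1) (by simpa using (eB.symm i).2)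
    have h2 := Sum.inr_getRight (h (eB.symm j).1) (by simpa using (eB.symm j).2)
    rw [← h1, ← h2]
    exact congrArg Sum.inr hij
  intro M _ x y
  rw [hψ, Formula.realize_relabel]
  apply iff_of_eq
  congr 1
  funext i
  by_cases hi : (h i).isLeft
  · simp only [Function.comp, hi, dif_pos, Sum.elim_inl, Equiv.symm_apply_apply]
    obtain ⟨a, ha⟩ := Sum.isLeft_iff.1 hi
    simp [ha]
  · simp only [Function.comp, hi, Sum.elim_inr, Equiv.symm_apply_apply]
    simp at hi
    obtain ⟨a, ha⟩ := Sum.isRight_iff.1 hi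
    simp [ha]

section Chain

theorem leRec_compat {Ξ : ℕ → Type*} (κ : ∀ n, Ξ n → Ξ (n+1)) {M : Type*} (x : ∀ n, Ξ n → M)
    (hx : ∀ n ξ, x (n+1) (κ n ξ) = x n ξ) {m n : ℕ} (h : m ≤ n) (ξ : Ξ m) :
    x n (Nat.leRecOn h (@fun k => κ k) ξ) = x m ξ := by
  induction n, h using Nat.le_induction with
  | base => rw [Nat.leRecOn_self]
  | succ n hmn ih => rw [Nat.leRecOn_succ hmn, hx, ih]

theorem chain_formula {Ξ : ℕ → Type*} (κ : ∀ n, Ξ n → Ξ (n+1)) (φ : L.Formula (Σ n, Ξ n)) :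
    ∃ (n : ℕ) (ψ : L.Formula (Ξ n)), ∀ (M : Type w) [L.Structure M] (x : ∀ n, Ξ n → M)
      (_ : ∀ n ξ, x (n+1) (κ n ξ) = x n ξ),
      φ.Realize (fun s => x s.1 s.2) ↔ ψ.Realize (x n) := by
  obtain ⟨r, h, ψ, -, hψ⟩ := finvar.{u,v,w} φ
  have hle : ∀ i, (h i).1 ≤ Finset.univ.sup (fun i => (h i).1) := fun i =>
    Finset.le_sup (f := fun i => (h i).1) (Finset.mem_univ i)
  refine ⟨Finset.univ.sup (fun i => (h i).1),
    ψ.relabel (fun i => Nat.leRecOn (hle i) (@fun k => κ k) (h i).2), ?_⟩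
  intro M _ x hx
  rw [hψ, Formula.realize_relabel]
  apply iff_of_eq
  congr 1
  funext i
  exact (leRec_compat κ x hx (hle i) _).symm

theorem IsElem.leRec {G : ℕ → Type w} [∀ n, L.Structure (G n)] (f : ∀ n, G n → G (n+1))
    (hf : ∀ n, IsElem L (f n)) {m n : ℕ} (h : m ≤ n) :
    IsElem L (Nat.leRecOn h (@fun k => f k) : G m → G n) := by
  induction n, h using Nat.le_induction with
  | base => convert IsElem.ident using 1; funext x; rw [Nat.leRecOn_self]; rfl
  | succ n hmn ih =>
    convert (hf n).comp ih using 1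
    funext x; rw [Nat.leRecOn_succ hmn]; rfl

/-- limit maps are elementary -/
theorem chain_elem {G : ℕ → Type w} [∀ n, L.Structure (G n)] (f : ∀ n, G n → G (n+1))
    (hf : ∀ n, IsElem L (f n)) {E : Type w'} [L.Structure E] (j : ∀ n, G n ↪[L] E)
    (hj : ∀ n x, j (n+1) (f n x) = j n x) (hsurj : ∀ e, ∃ n x, j n x = e) (n : ℕ) :
    IsElem L (j n) := by
  have key : ∀ (α : Type) (l : ℕ) (φ : L.BoundedFormula α l) (n : ℕ) (x : α → G n) (xs : Fin l → G n),
      φ.Realize (j n ∘ x) (j n ∘ xs) ↔ φ.Realize x xs := by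
    intro α l φ
    induction φ with
    | falsum => intros; rfl
    | equal t1 t2 =>
      intro n x xs
      simp only [BoundedFormula.Realize, ← Sum.comp_elim, HomClass.realize_term]
      exact (j n).injective.eq_iff
    | rel R ts =>
      intro n x xs
      simp only [BoundedFormula.Realize, ← Sum.comp_elim, HomClass.realize_term]
      exact (j n).map_rel R _
    | imp f1 f2 h1 h2 =>
      intro n x xs
      simp only [BoundedFormula.realize_imp, h1, h2]
    | all φ ih =>
      intro n x xs
      simp only [BoundedFormula.realize_all]
      constructor
      · intro h a
        rw [← ih]
        have := h (j n a)
        rwa [← Fin.comp_snoc] at this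
      · intro h e
        obtain ⟨m, a, rfl⟩ := hsurj e
        let N := max m n
        have hm := leRec_compat f (fun n => (j n : G n → E)) hj (le_max_left m n)
        have hn := leRec_compat f (fun n => (j n : G n → E)) hj (le_max_right m n)
        have el := IsElem.leRec f hf (le_max_right m n)
        rw [← hm]
        have e1 : j n ∘ x = j (max m n) ∘ (Nat.leRecOn (le_max_right m n) (@fun k => f k) ∘ x) := by
          funext i; exact (hn _).symm
        have e2 : j n ∘ xs = j (max m n) ∘ (Nat.leRecOn (le_max_right m n) (@fun k => f k) ∘ xs) := by
          funext i; exact (hn _).symm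
        rw [e1, e2, ← Fin.comp_snoc, ih]
        have := (el.toEmb.map_boundedFormula (φ.all) x xs).2 h
        exact this _
  intro m φ x
  have := key _ _ φ n x default
  unfold Formula.Realize
  rw [← this]
  apply iff_of_eq; congr 1; exact Subsingleton.elim _ _

theorem exists_colim {G : ℕ → Type w} [∀ n, L.Structure (G n)] (f : ∀ n, G n → G (n+1))
    (hf : ∀ n, IsElem L (f n)) : ∃ (E : Type w) (_ : L.Structure E) (j : ∀ n, G n → E),
      (∀ n, IsElem L (j n)) ∧ (∀ n x, j (n+1) (f n x) = j n x) ∧ ∀ e, ∃ n x, j n x = e := by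
  let f' : ∀ n, G n ↪[L] G (n+1) := fun n => (hf n).toEmb.toEmbedding
  have hj : ∀ n x, DirectLimit.of L ℕ G (fun i j h => DirectedSystem.natLERec f' i j h) (n+1) (f n x)
      = DirectLimit.of L ℕ G (fun i j h => DirectedSystem.natLERec f' i j h) n x := by
    intro n x
    rw [← DirectLimit.of_f (hij := Nat.le_succ n) (x := x)]
    congr 1
    simp only [DirectedSystem.coe_natLERec]
    rw [Nat.leRecOn_succ le_rfl, Nat.leRecOn_self]; rfl
  have hs : ∀ e, ∃ n x, DirectLimit.of L ℕ G (fun i j h => DirectedSystem.natLERec f' i j h) n x = e :=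
    fun e => DirectLimit.exists_of e
  exact ⟨Language.DirectLimit G (fun i j h => DirectedSystem.natLERec f' i j h), inferInstance,
    fun n => DirectLimit.of L ℕ G _ n, fun n => chain_elem f hf _ hj hs n, hj, hs⟩

end Chain

/-- An automorphism from an enumeration -/
theorem exists_equiv_of_surj {E : Type w} {E' : Type w'} [L.Structure E] [L.Structure E']
    {Ξ : Type*} (p : Ξ → E) (q : Ξ → E')
    (hp : Function.Surjective p) (hq : Function.Surjective q)
    (h : ∀ φ : L.Formula Ξ, φ.Realize p ↔ φ.Realize q) :
    ∃ s : E ≃[L] E', ∀ ξ, s (p ξ) = q ξ := by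
  have heq : ∀ ξ η, p ξ = p η ↔ q ξ = q η := by
    intro ξ η
    have := h (Term.equal (Term.var ξ) (Term.var η))
    simpa [Formula.realize_equal] using this
  choose ip hip using hp
  choose iq hiq using hq
  have hs : ∀ ξ, q (ip (p ξ)) = q ξ := fun ξ => (heq _ _).1 (hip _)
  have el : IsElem L (fun e => q (ip e)) := by
    intro n φ x
    have := h (φ.relabel (fun i => ip (x i)))
    rw [Formula.realize_relabel, Formula.realize_relabel] at this
    rw [show φ.Realize x ↔ φ.Realize (p ∘ fun i => ip (x i)) by
      apply iff_of_eq; congr 1; funext i; exact (hip _).symm]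
    exact this.symm
  refine ⟨⟨⟨fun e => q (ip e), fun e => p (iq e), ?_, ?_⟩, ?_, ?_⟩, hs⟩
  · intro e
    change p (iq (q (ip e))) = e
    conv_rhs => rw [← hip e]
    rw [heq, hiq]
  · intro e
    change q (ip (p (iq e))) = e
    rw [hs, hiq]
  · intro n F x; exact el.funMap F x
  · intro n F x; exact el.relMap F x

end ShelahE34
end FirstOrder

namespace FirstOrder
set_option linter.all false
open Language Structure
universe u v w u' v' w'
namespace ShelahE34

variable {L : Language.{u, v}}

theorem transfer {X Y : Type*} {M M' : Type w} [L.Structure M] [L.Structure M'] [Nonempty M']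
    {y : Y → M} {y' : Y → M'} (h : ∀ ψ : L.Formula Y, ψ.Realize y → ψ.Realize y')
    (φ : L.Formula (X ⊕ Y)) (x : X → M) (hφ : φ.Realize (Sum.elim x y)) :
    ∃ x' : X → M', φ.Realize (Sum.elim x' y') := by
  obtain ⟨p, q, f, g, ψ, hf, hg, hψ⟩ := finvars.{u,v,w} φ
  rw [hψ] at hφ
  let θ : L.Formula (Fin q) := Formula.iExs (Fin p) (ψ.relabel Sum.swap)
  have h1 : (θ.relabel g).Realize y := by
    rw [Formula.realize_relabel, Formula.realize_iExs]
    refine ⟨x ∘ f, ?_⟩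
    rw [Formula.realize_relabel]
    convert hφ using 1
    funext i; cases i <;> rfl
  have h2 := h _ h1
  rw [Formula.realize_relabel, Formula.realize_iExs] at h2
  obtain ⟨e, he⟩ := h2
  rw [Formula.realize_relabel] at he
  refine ⟨Function.extend f e (fun _ => Classical.arbitrary _), ?_⟩
  rw [hψ]
  have : (Function.extend f e (fun _ => Classical.arbitrary M')) ∘ f = e := by
    funext i; exact hf.extend_apply _ _ _
  rw [this]
  convert he using 1
  funext i; cases i <;> rfl

theorem realize_type {X : Type w} {Y : Type w'} {M M' : Type w} [L.Structure M] [L.Structure M']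
    [Nonempty M'] (x : X → M)
    {y : Y → M} {y' : Y → M'} (h : ∀ ψ : L.Formula Y, ψ.Realize y → ψ.Realize y') :
    ∃ (E : Type w) (_ : L.Structure E) (i : M' → E) (x' : X → E), IsElem L i ∧
      ∀ φ : L.Formula (X ⊕ Y), φ.Realize (Sum.elim x y) ↔ φ.Realize (Sum.elim x' (i ∘ y')) := by
  obtain ⟨U, hU⟩ := exists_uf_formula (L := L) (Sum.elim x y) (I := X → M')
    (fun g φ => φ.Realize (Sum.elim g y')) (by
      intro i φ ψ h; exact Formula.realize_inf.1 h) (fun φ hφ => transfer h φ x hφ)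
  refine ⟨UP U M', inferInstance, UP.diag U, fun a => UP.mk U (fun g => g a), UP.diag_elem, ?_⟩
  apply iff_of_imp
  intro φ hφ
  have := hU φ hφ
  have h2 := (UP.los (U := U) φ (fun a g => Sum.elim g y' a)).2 this
  convert h2 using 1
  funext a; cases a <;> rfl

theorem realize_eq_of_vars {Ξ : Type*} {E : Type*} [L.Structure E] (p : Ξ → E) (a b : Ξ) :
    (Term.equal (Term.var a) (Term.var b) : L.Formula Ξ).Realize p ↔ p a = p b := by
  simp [Formula.realize_equal]

theorem aut_forward {E : Type w} [L.Structure E] [Nonempty E] {Ξ : Type w} (p q : Ξ → E)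
    (h : ∀ φ : L.Formula Ξ, φ.Realize p → φ.Realize q) :
    ∃ (E' : Type w) (_ : L.Structure E') (i k : E → E'), IsElem L i ∧ IsElem L k ∧
      ∀ ξ, k (p ξ) = i (q ξ) := by
  obtain ⟨E', s, i, k, hi, hk⟩ := realize_type (L := L) (fun e : E => e) h
  refine ⟨E', s, i, k, hi, ?_, ?_⟩
  · apply IsElem.of_all
    intro φ hφ
    have := (hk (φ.relabel Sum.inl)).1 (by rw [Formula.realize_relabel]; exact hφ)
    rw [Formula.realize_relabel] at this
    exact this
  · intro ξ
    have := (hk (Term.equal (Term.var (Sum.inl (p ξ))) (Term.var (Sum.inr ξ)))).1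
      ((realize_eq_of_vars _ _ _).2 rfl)
    exact (realize_eq_of_vars _ _ _).1 this

/-- states for the automorphism lemma -/
structure AutSt (L : Language.{u, v}) where
  E : Type w
  str : L.Structure E
  ne : Nonempty E
  Ξ : Type w
  p : Ξ → E
  q : Ξ → E
  h : ∀ φ : L.Formula Ξ, φ.Realize p ↔ φ.Realize q

attribute [instance] AutSt.str AutSt.ne

theorem AutSt.step (s : AutSt.{u, v, w} L) : ∃ (s' : AutSt.{u, v, w} L) (i : s.E → s'.E)
    (κ : s.Ξ → s'.Ξ), IsElem L i ∧ (∀ ξ, s'.p (κ ξ) = i (s.p ξ)) ∧ (∀ ξ, s'.q (κ ξ) = i (s.q ξ)) ∧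
    (∀ e, ∃ ξ, s'.p ξ = i e) ∧ (∀ e, ∃ ξ, s'.q ξ = i e) := by
  obtain ⟨E', _, i, h, hi, hh, h1⟩ := aut_forward s.p s.q (fun φ => (s.h φ).1)
  haveI : Nonempty E' := s.ne.map i
  obtain ⟨E'', _, i', k, hi', hk, h2⟩ := aut_forward h i (L := L)
    (fun φ hφ => (hi.formula' φ (fun e => e)).2 ((hh.formula' φ (fun e => e)).1 hφ))
  refine ⟨⟨E'', inferInstance, Nonempty.map i' this, E', k, i', fun φ =>
    (hk.formula' φ (fun e => e)).trans (hi'.formula' φ (fun e => e)).symm⟩, i' ∘ i,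
    fun ξ => h (s.p ξ), hi'.comp hi, ?_, ?_, ?_, ?_⟩
  · intro ξ; exact h2 _
  · intro ξ; exact congrArg i' (h1 ξ)
  · intro e; exact ⟨h e, h2 e⟩
  · intro e; exact ⟨i e, rfl⟩

theorem aut_lemma {E : Type w} [L.Structure E] [Nonempty E] {Ξ : Type w} (p q : Ξ → E)
    (h : ∀ φ : L.Formula Ξ, φ.Realize p → φ.Realize q) :
    ∃ (E' : Type w) (_ : L.Structure E') (i : E → E') (s : E' ≃[L] E'), IsElem L i ∧
      ∀ ξ, s (i (p ξ)) = i (q ξ) := by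
  choose next i κ hi hp hq hps hqs using fun s : AutSt.{u, v, w} L => s.step
  let S : ℕ → AutSt.{u, v, w} L := fun n => next^[n] ⟨E, inferInstance, inferInstance, Ξ, p, q, iff_of_imp h⟩
  have hS : ∀ n, S (n+1) = next (S n) := fun n => Function.iterate_succ_apply' _ _ _
  have key : ∀ n, ∃ (i : (S n).E → (S (n+1)).E) (κ : (S n).Ξ → (S (n+1)).Ξ),
    IsElem L i ∧ (∀ ξ, (S (n+1)).p (κ ξ) = i ((S n).p ξ)) ∧ (∀ ξ, (S (n+1)).q (κ ξ) = i ((S n).q ξ)) ∧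
    (∀ e, ∃ ξ, (S (n+1)).p ξ = i e) ∧ (∀ e, ∃ ξ, (S (n+1)).q ξ = i e) := by
    intro n
    rw [hS]
    exact ⟨i _, κ _, hi _, hp _, hq _, hps _, hqs _⟩
  clear hi hp hq hps hqs hS
  choose I K hi hp hq hps hqs using key
  obtain ⟨E', _, j, hj, hjc, hjs⟩ := exists_colim (L := L) (G := fun n => (S n).E) I hi
  obtain ⟨s, hs⟩ := exists_equiv_of_surj (L := L) (E := E') (E' := E') (Ξ := Σ n, (S n).Ξ)
    (fun s => j s.1 ((S s.1).p s.2)) (fun s => j s.1 ((S s.1).q s.2)) (by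
      intro e
      obtain ⟨n, x, rfl⟩ := hjs e
      obtain ⟨ξ, hξ⟩ := hps n x
      exact ⟨⟨n+1, ξ⟩, by simp only [hξ, hjc]⟩) (by
      intro e
      obtain ⟨n, x, rfl⟩ := hjs e
      obtain ⟨ξ, hξ⟩ := hqs n x
      exact ⟨⟨n+1, ξ⟩, by simp only [hξ, hjc]⟩) (by
      intro φ
      obtain ⟨n, ψ, hψ⟩ := chain_formula (L := L) K φ
      rw [hψ E' (fun n ξ => j n ((S n).p ξ)) (by intro n ξ; simp only [hp, hjc]),
        hψ E' (fun n ξ => j n ((S n).q ξ)) (by intro n ξ; simp only [hq, hjc])]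
      rw [(hj n).formula', (hj n).formula']
      exact (S n).h ψ)
  exact ⟨E', inferInstance, j 0, s, hj 0, fun ξ => hs ⟨0, ξ⟩⟩

end ShelahE34
end FirstOrder

namespace FirstOrder
set_option linter.all false
open Language Structure
universe u v w u' v' w'
namespace ShelahE34

variable {L : Language.{u, v}}

/-- A Tarski--Vaught set is the range of an elementary map. -/
theorem exists_elem_sub {D : Type w} [L.Structure D] (S : Set D)
    (tv : ∀ (n : ℕ) (φ : L.Formula (Fin n ⊕ Unit)) (x : Fin n → D) (d : D), (∀ i, x i ∈ S) →
      φ.Realize (Sum.elim x fun _ => d) → ∃ s ∈ S, φ.Realize (Sum.elim x fun _ => s)) :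
    ∃ (C : Type w) (_ : L.Structure C) (ι : C → D), IsElem L ι ∧ Set.range ι = S := by
  let S' : L.Substructure D := ⟨S, by
    intro n F x hx
    obtain ⟨s, hs, h1⟩ := tv n (Term.equal (Term.func F fun i => Term.var (Sum.inl i))
      (Term.var (Sum.inr ()))) x (funMap F x) hx (by simp [Formula.realize_equal])
    have : funMap F x = s := by simpa [Formula.realize_equal] using h1
    rw [this]; exact hs⟩
  have el : S'.IsElementary := by
    apply Substructure.isElementary_of_exists
    intro n φ x a h
    let ψ : L.Formula (Fin n ⊕ Unit) := φ.toFormula.relabel (fun i : Empty ⊕ Fin (n+1) =>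
      Sum.elim (fun e => e.elim) (Fin.snoc (α := fun _ => Fin n ⊕ Unit) Sum.inl (Sum.inr ())) i)
    have hψ : ∀ b : D, ψ.Realize (Sum.elim (fun i => (x i : D)) fun _ => b) ↔
        φ.Realize default (Fin.snoc ((↑) ∘ x) b : _ → D) := by
      intro b
      rw [Formula.realize_relabel, BoundedFormula.realize_toFormula]
      apply iff_of_eq; congr 1
      · exact Subsingleton.elim _ _
      · funext i
        refine Fin.lastCases ?_ (fun i => ?_) i
        · simp
        · simp
    obtain ⟨s, hs, h1⟩ := tv n ψ (fun i => (x i : D)) a (fun i => (x i).2) ((hψ a).2 h)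
    exact ⟨⟨s, hs⟩, (hψ s).1 h1⟩
  refine ⟨S', inferInstance, Subtype.val, ?_, Subtype.range_coe⟩
  intro n φ x
  exact el φ x

/-- Models of `T` with an automorphism. -/
structure AM (T : L.Theory) where
  carrier : Type w
  str : L.Structure carrier
  ne : Nonempty carrier
  mod : carrier ⊨ T
  σ : carrier ≃[L] carrier

instance (T : L.Theory) : CoeSort (AM.{u, v, w} T) (Type w) := ⟨AM.carrier⟩

attribute [instance] AM.str AM.ne AM.mod

variable {T : L.Theory}

/-- constructor -/
def AM.of (M : Type w) [hs : L.Structure M] [hn : Nonempty M] (hM : M ⊨ T) (s : M ≃[L] M) :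
    AM.{u, v, w} T := ⟨M, hs, hn, hM, s⟩

/-- The structure for `σ` -/
@[reducible] def sigmaStr {M : Type w} (s : M → M) : sigmaLang.Structure M where
  funMap := fun {_} F => match F with
    | SigmaFunc.sigma => fun x => s (x 0)
  RelMap := fun R => Empty.elim R

instance AM.sigmaStructure (A : AM.{u, v, w} T) : sigmaLang.Structure A := sigmaStr A.σ

theorem AM.funMap_sigma (A : AM.{u, v, w} T) (x : Fin 1 → A) : funMap (sigmaSymb L) x = A.σ (x 0) :=
  rfl

theorem AM.funMap_inl (A : AM.{u, v, w} T) {n} (F : L.Functions n) (x : Fin n → A) :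
    funMap (L := LPlus L) (Sum.inl F : (LPlus L).Functions n) x = funMap F x := rfl

theorem AM.relMap_inl (A : AM.{u, v, w} T) {n} (F : L.Relations n) (x : Fin n → A) :
    RelMap (L := LPlus L) (Sum.inl F : (LPlus L).Relations n) x ↔ RelMap F x := Iff.rfl

theorem AM.realize_sigmaTerm (A : AM.{u, v, w} T) {α : Type*} (t : (LPlus L).Term α) (x : α → A) :
    (sigmaTerm t).realize x = A.σ (t.realize x) := by
  simp [sigmaTerm, Term.realize_functions_apply₁, A.funMap_sigma]

theorem AM.taut (A : AM.{u, v, w} T) : A ⊨ Taut T := by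
  rw [Theory.model_iff]
  intro φ hφ
  rcases hφ with ((h | h | h) | ⟨n, F, rfl⟩) | ⟨n, R, rfl⟩
  · have := ((LHom.sumInl : L →ᴸ LPlus L).onTheory_model (M := A) T).2 A.mod
    exact this.realize_of_mem _ h
  · subst h
    simp only [sigmaInj, Sentence.Realize, Formula.Realize, BoundedFormula.realize_all,
      BoundedFormula.realize_imp, BoundedFormula.realize_bdEqual, A.realize_sigmaTerm]
    intro a b h
    exact A.σ.injective h
  · subst h
    simp only [sigmaSurj, Sentence.Realize, Formula.Realize, BoundedFormula.realize_all,
      BoundedFormula.realize_ex, BoundedFormula.realize_bdEqual, A.realize_sigmaTerm]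
    intro a 
    exact ⟨A.σ.symm a, by simp [Fin.snoc]⟩
  · simp only [funCommSentence, Sentence.Realize, BoundedFormula.realize_alls,
      BoundedFormula.realize_bdEqual, A.realize_sigmaTerm, Term.realize, A.funMap_inl]
    intro x
    exact A.σ.map_fun F _
  · simp only [relPresSentence, Sentence.Realize, BoundedFormula.realize_alls,
      BoundedFormula.realize_iff, BoundedFormula.realize_rel, A.realize_sigmaTerm, Term.realize,
      A.relMap_inl]
    intro x
    exact (A.σ.map_rel R _).symm

theorem AM.equivOf (A : AM.{u, v, w} T) (M : Type w) [(LPlus L).Structure M] (e : A ≃ M)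
    (h1 : ∀ {n} (F : L.Functions n) (x : Fin n → A), e (funMap F x) =
      funMap (L := LPlus L) (Sum.inl F : (LPlus L).Functions n) (e ∘ x))
    (h2 : ∀ {n} (F : L.Relations n) (x : Fin n → A),
      RelMap (L := LPlus L) (Sum.inl F : (LPlus L).Relations n) (e ∘ x) ↔ RelMap F x)
    (h3 : ∀ x, e (A.σ x) = sigmaMap L M (e x)) : Nonempty (A ≃[LPlus L] M) := by
  refine ⟨⟨e, ?_, ?_⟩⟩
  · intro n F x
    rcases F with F | F
    · exact h1 F x
    · cases F
      refine (h3 (x 0)).trans ?_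
      change funMap (sigmaSymb L) ![e (x 0)] = funMap (sigmaSymb L) (e ∘ x)
      congr 1; funext i; fin_cases i; rfl
  · intro n F x
    rcases F with F | F
    · exact h2 F x
    · exact Empty.elim F

theorem AM.of_model (M : Type w) [(LPlus L).Structure M] [Nonempty M] (h : M ⊨ Taut T) :
    ∃ (A : AM.{u, v, w} T) (e : A ≃[LPlus L] M), True := by
  letI : L.Structure M := (LHom.sumInl : L →ᴸ LPlus L).reduct M
  haveI : (LHom.sumInl : L →ᴸ LPlus L).IsExpansionOn M := LHom.isExpansionOn_reduct _ _
  have hs : ∀ φ ∈ Taut T, M ⊨ φ := fun φ hφ => h.realize_of_mem φ hφ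
  have h1 : M ⊨ T := ((LHom.sumInl : L →ᴸ LPlus L).onTheory_model (M := M) T).1 (by
    rw [Theory.model_iff]; intro φ hφ; exact hs φ (Or.inl (Or.inl (Or.inl hφ))))
  have rs : ∀ {α : Type} (t : (LPlus L).Term α) (x : α → M),
    (sigmaTerm t).realize x = sigmaMap L M (t.realize x) := by
    intro α t x
    simp [sigmaTerm, Term.realize_functions_apply₁, sigmaMap]
  have hinj : Function.Injective (sigmaMap L M) := by
    have := hs (sigmaInj L) (Or.inl (Or.inl (Or.inr (Or.inl rfl))))
    simp only [sigmaInj, Sentence.Realize, Formula.Realize, BoundedFormula.realize_all,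
      BoundedFormula.realize_imp, BoundedFormula.realize_bdEqual, rs] at this
    intro a b h
    exact this a b h
  have hsurj : Function.Surjective (sigmaMap L M) := by
    have := hs (sigmaSurj L) (Or.inl (Or.inl (Or.inr (Or.inr rfl))))
    simp only [sigmaSurj, Sentence.Realize, Formula.Realize, BoundedFormula.realize_all,
      BoundedFormula.realize_ex, BoundedFormula.realize_bdEqual, rs] at this
    intro a
    obtain ⟨b, hb⟩ := this a
    exact ⟨b, by simpa [Fin.snoc] using hb⟩
  have hfun : ∀ {n} (F : L.Functions n) (x : Fin n → M), sigmaMap L M (funMap F x) =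
      funMap F (sigmaMap L M ∘ x) := by
    intro n F
    have := hs (funCommSentence L F) (Or.inl (Or.inr ⟨n, F, rfl⟩))
    simp only [funCommSentence, Sentence.Realize, BoundedFormula.realize_alls,
      BoundedFormula.realize_bdEqual, rs, Term.realize] at this
    intro x
    exact this x
  have hrel : ∀ {n} (F : L.Relations n) (x : Fin n → M), 
      RelMap F (sigmaMap L M ∘ x) ↔ RelMap F x := by
    intro n F
    have := hs (relPresSentence L F) (Or.inr ⟨n, F, rfl⟩)
    simp only [relPresSentence, Sentence.Realize, BoundedFormula.realize_alls,
      BoundedFormula.realize_iff, BoundedFormula.realize_rel, rs, Term.realize] at this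
    intro x
    refine Iff.trans ?_ ((this x).symm.trans Iff.rfl)
    change _ ↔ RelMap (L := LPlus L) (Sum.inl F : (LPlus L).Relations n)
      (fun i => (sigmaTerm (Term.var (Sum.inr i))).realize (Sum.elim (default : Empty → M) x))
    simp only [rs]
    rfl
  obtain ⟨e⟩ := AM.equivOf (T := T) ⟨M, inferInstance, inferInstance, h1, ⟨Equiv.ofBijective _ ⟨hinj, hsurj⟩, hfun, hrel⟩⟩
    M (Equiv.refl M) (fun F x => rfl) (fun F x => Iff.rfl) (fun x => rfl)
  exact ⟨_, e, trivial⟩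

/-- embeddings in `L⁺` from embeddings in `L` -/
def AM.mkEmb {A B : AM.{u, v, w} T} (f : A ↪[L] B) (hf : ∀ x, f (A.σ x) = B.σ (f x)) :
    A ↪[LPlus L] B where
  toFun := f
  inj' := f.injective
  map_fun' := by
    intro n F x
    rcases F with F | F
    · exact f.map_fun F x
    · cases F
      exact hf _
  map_rel' := by
    intro n F x
    rcases F with F | F
    · exact f.map_rel F x
    · exact Empty.elim F

/-- the underlying `L`-embedding -/
def AM.redEmb {A B : AM.{u, v, w} T} (f : A ↪[LPlus L] B) : A ↪[L] B where
  toFun := f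
  inj' := f.injective
  map_fun' := fun F x => f.map_fun (Sum.inl F : (LPlus L).Functions _) x
  map_rel' := fun F x => f.map_rel (Sum.inl F : (LPlus L).Relations _) x

theorem AM.emb_comm {A B : AM.{u, v, w} T} (f : A ↪[LPlus L] B) (x : A) : f (A.σ x) = B.σ (f x) :=
  f.map_fun (sigmaSymb L) ![x]

theorem AM.elem_red {A B : AM.{u, v, w} T} {f : A → B} (hf : IsElem (LPlus L) f) : IsElem L f := by
  intro n φ x
  have := hf ((LHom.sumInl : L →ᴸ LPlus L).onFormula φ) x
  rwa [LHom.realize_onFormula, LHom.realize_onFormula] at this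

theorem AM.elem_comm {A B : AM.{u, v, w} T} {f : A → B} (hf : IsElem (LPlus L) f) (x : A) :
    f (A.σ x) = B.σ (f x) := 
  AM.emb_comm hf.toEmb.toEmbedding x

/-- ultrapower of an `AM` -/
def AM.up (A : AM.{u, v, w} T) {I : Type w} (U : Ultrafilter I) : AM.{u, v, w} T where
  carrier := UP U A
  str := inferInstance
  ne := inferInstance
  mod := (UP.diag_elem (U := U).model T).1 A.mod
  σ := {
    toFun := Quotient.map' (fun x i => A.σ (x i)) (by
      intro x y h
      change ∀ᶠ i in U, A.σ (x i) = A.σ (y i)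
      filter_upwards [h] with i hi
      rw [hi])
    invFun := Quotient.map' (fun x i => A.σ.symm (x i)) (by
      intro x y h
      change ∀ᶠ i in U, A.σ.symm (x i) = A.σ.symm (y i)
      filter_upwards [h] with i hi
      rw [hi])
    left_inv := by
      intro x
      obtain ⟨x, rfl⟩ := UP.surj x
      change UP.mk U _ = UP.mk U x
      congr 1; funext i; simp
    right_inv := by
      intro x
      obtain ⟨x, rfl⟩ := UP.surj x
      change UP.mk U _ = UP.mk U x
      congr 1; funext i; simp
    map_fun' := by
      intro n F x
      obtain ⟨x, rfl⟩ : ∃ y : Fin n → I → A, x = fun a => UP.mk U (y a) :=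
        ⟨fun a => (x a).out, by funext a; rw [UP.mk_out]⟩
      rw [UP.funMap]
      change UP.mk U _ = Structure.funMap F fun a => UP.mk U fun i => A.σ (x a i)
      rw [UP.funMap]
      congr 1; funext i
      exact A.σ.map_fun F _
    map_rel' := by
      intro n F x
      obtain ⟨x, rfl⟩ : ∃ y : Fin n → I → A, x = fun a => UP.mk U (y a) :=
        ⟨fun a => (x a).out, by funext a; rw [UP.mk_out]⟩
      rw [UP.relMap]
      change (RelMap F fun a => UP.mk U fun i => A.σ (x a i)) ↔ _
      rw [UP.relMap]
      apply iff_of_eq; congr 1; funext i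
      exact propext (A.σ.map_rel F _) }

/-- class of a sequence -/
def AM.mk' (A : AM.{u, v, w} T) {I : Type w} (U : Ultrafilter I) (x : I → A) : A.up U := UP.mk U x

theorem AM.up_sigma (A : AM.{u, v, w} T) {I : Type w} (U : Ultrafilter I) (x : I → A) :
    (A.up U).σ (A.mk' U x) = A.mk' U fun i => A.σ (x i) := rfl

theorem AM.up_surj (A : AM.{u, v, w} T) {I : Type w} (U : Ultrafilter I) (x : A.up U) :
    ∃ y, A.mk' U y = x := UP.surj x

theorem AM.mk'_eq (A : AM.{u, v, w} T) {I : Type w} (U : Ultrafilter I) (x y : I → A) :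
    A.mk' U x = A.mk' U y ↔ ∀ᶠ i in U, x i = y i := UP.mk_eq x y

theorem AM.los (A : AM.{u, v, w} T) {I : Type w} (U : Ultrafilter I) {α : Type*} (φ : L.Formula α)
    (x : α → I → A) :
    φ.Realize (fun a => A.mk' U (x a)) ↔ ∀ᶠ i in U, φ.Realize (fun a => x a i) := UP.los φ x

theorem AM.los_plus (A : AM.{u, v, w} T) {I : Type w} (U : Ultrafilter I) {α : Type*}
    (φ : (LPlus L).Formula α)
    (x : α → I → A) :
    φ.Realize (fun a => A.mk' U (x a)) ↔ ∀ᶠ i in U, φ.Realize (fun a => x a i) := by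
  have e : @Eq ((LPlus L).Structure (UP U A)) (L.sumStructure sigmaLang (A.up U))
      Ultraproduct.structure := by
    apply Structure.ext
    · funext n F x
      obtain ⟨x, rfl⟩ : ∃ y : Fin n → I → A, x = fun a => A.mk' U (y a) :=
        ⟨fun a => UP.out (x a), by funext a; exact (UP.mk_out _).symm⟩
      refine Eq.trans ?_ (UP.funMap (U := U) F x).symm
      rcases F with F | F
      · exact UP.funMap F x
      · cases F; rfl
    · funext n F x
      obtain ⟨x, rfl⟩ : ∃ y : Fin n → I → A, x = fun a => A.mk' U (y a) :=
        ⟨fun a => UP.out (x a), by funext a; exact (UP.mk_out _).symm⟩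
      refine Eq.trans ?_ (propext (UP.relMap (U := U) F x).symm)
      rcases F with F | F
      · exact propext (UP.relMap F x)
      · exact Empty.elim F
  have := UP.los (U := U) φ x
  refine Iff.trans ?_ this
  change (@Formula.Realize _ (UP U A) (L.sumStructure sigmaLang (A.up U)) _ φ fun a => UP.mk U (x a)) ↔ _
  rw [e]

/-- diagonal -/
def AM.diag (A : AM.{u, v, w} T) {I : Type w} (U : Ultrafilter I) (a : A) : A.up U := A.mk' U fun _ => a

theorem AM.diag_elem (A : AM.{u, v, w} T) {I : Type w} (U : Ultrafilter I) :
    IsElem (LPlus L) (A.diag U) := by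
  intro n φ x
  refine (A.los_plus U φ (fun a _ => x a)).trans ?_
  simp

end ShelahE34
end FirstOrder

namespace FirstOrder
set_option linter.all false
open Language Structure
universe u v w u' v' w'
namespace ShelahE34

variable {L : Language.{u, v}} {T : L.Theory} {Tmc : (LPlus L).Theory}

/-- consequences of the hypotheses -/
structure MC (T : L.Theory) (Tmc : (LPlus L).Theory) : Prop where
  h1 : ∀ A : AM.{u, v, w} T, ∃ (K : AM.{u, v, w} T), K ⊨ Tmc ∧ Nonempty (A ↪[LPlus L] K)
  h2 : ∀ (A K1 K2 : AM.{u, v, w} T) (f1 : A ↪[LPlus L] K1) (f2 : A ↪[LPlus L] K2),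
    K1 ⊨ Tmc → K2 ⊨ Tmc → ∀ φ : (LPlus L).Formula A, φ.Realize f1 ↔ φ.Realize f2
  eqv : ∀ (M N : Type w) [L.Structure M] [L.Structure N] [Nonempty M] [Nonempty N],
    M ⊨ T → N ⊨ T → ∀ φ : L.Sentence, M ⊨ φ ↔ N ⊨ φ
  ex : ∃ K : AM.{u, v, w} T, K ⊨ Tmc

theorem diag_emb {L' : Language.{u, v}} {A K : Type w} [L'.Structure A] [L'.Structure K]
    (f : A ↪[L'] K) (φ : (L'[[A]]).Sentence) (hφ : φ ∈ atomicDiagram L' A) :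
    @Sentence.Realize _ K (@Language.withConstantsStructure L' K _ A (constantsOn.structure f)) φ := by
  letI := constantsOn.structure f
  let f' : A ↪[L'[[A]]] K := ⟨f.toEmbedding, by
    intro n F x
    rcases F with F | F
    · exact f.map_fun F x
    · cases n with
      | zero => rfl
      | succ n => cases n <;> exact isEmptyElim F, by
    intro n R x
    rcases R with R | R
    · exact f.map_rel R x
    · exact isEmptyElim R⟩
  have key : ∀ ψ : (L'[[A]]).Sentence, ψ.IsAtomic → (K ⊨ ψ ↔ A ⊨ ψ) := by
    intro ψ hψ
    have := (BoundedFormula.IsQF.of_isAtomic hψ).realize_embedding f' (v := default) (xs := default)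
    unfold Sentence.Realize Formula.Realize
    rw [← this]
    apply iff_of_eq; congr 1 <;> exact Subsingleton.elim _ _
  obtain ⟨h1 | ⟨ψ, h1, rfl⟩, h2⟩ := hφ
  · exact (key φ h1).2 h2
  · change ¬ (K ⊨ ψ)
    rw [key ψ h1]
    exact h2

theorem MC.of_hyp (hT : SemComplete T) (hmc : IsModelCompletion.{u, v, w} (Taut T) Tmc)
    (N0 : Type w) [(LPlus L).Structure N0] [Nonempty N0] (hN0 : N0 ⊨ Tmc) : MC.{u, v, w} T Tmc := by
  obtain ⟨hs, hm1, hm2⟩ := hmc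
  have toAM : ∀ (M : Type w) [(LPlus L).Structure M] [Nonempty M], M ⊨ Tmc →
      ∃ (A : AM.{u, v, w} T) (e : A ≃[LPlus L] M), A ⊨ Tmc := by
    intro M _ _ hM
    obtain ⟨A, e, -⟩ := AM.of_model (T := T) M (Theory.Model.mono hM hs)
    exact ⟨A, e, ((IsElem.of_equiv e).model Tmc).2 hM⟩
  refine ⟨?_, ?_, ?_, ?_⟩
  · intro A
    haveI := A.taut
    obtain ⟨N, ⟨f⟩⟩ := hm1 (Theory.ModelType.of (Taut T) A)
    obtain ⟨K, e, hK⟩ := toAM N N.is_model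
    exact ⟨K, hK, ⟨e.symm.toEmbedding.comp f⟩⟩
  · intro A K1 K2 f1 f2 hK1 hK2 φ
    haveI := A.taut
    have hd : ∀ ψ : ((LPlus L)[[A]]).Sentence,
        (((LPlus L).lhomWithConstants A).onTheory Tmc ∪ atomicDiagram (LPlus L) A) ⊨ᵇ ψ ∨
        (((LPlus L).lhomWithConstants A).onTheory Tmc ∪ atomicDiagram (LPlus L) A) ⊨ᵇ ∼ψ :=
      (hm2 (Theory.ModelType.of (Taut T) A)).2
    have mod : ∀ (K : AM.{u, v, w} T) (f : A ↪[LPlus L] K), K ⊨ Tmc →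
      letI := constantsOn.structure f
      K ⊨ ((LPlus L).lhomWithConstants A).onTheory Tmc ∪ atomicDiagram (LPlus L) A := by
      intro K f hK
      letI := constantsOn.structure f
      rw [Theory.model_union_iff]
      refine ⟨(LHom.onTheory_model _ _).2 hK, ?_⟩
      rw [Theory.model_iff]
      intro ψ hψ
      exact diag_emb f ψ hψ
    have rz : ∀ (K : AM.{u, v, w} T) (f : A ↪[LPlus L] K), φ.Realize f ↔
      @Sentence.Realize _ K (@Language.withConstantsStructure (LPlus L) K _ A (constantsOn.structure f))
        (Formula.equivSentence φ) := by
      intro K f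
      have := Formula.realize_equivSentence_symm (M := K) (Formula.equivSentence φ) f
      rwa [_root_.Equiv.symm_apply_apply] at this
    have dec : ∀ (K K' : AM.{u, v, w} T) (f : A ↪[LPlus L] K) (f' : A ↪[LPlus L] K'), K ⊨ Tmc → K' ⊨ Tmc →
      φ.Realize f → φ.Realize f' := by
      intro K K' f f' hK hK' h
      rcases hd (Formula.equivSentence φ) with h1 | h1
      · letI := constantsOn.structure f'
        haveI := mod K' f' hK'
        rw [rz]
        exact h1.realize_sentence K'
      · exfalso
        letI := constantsOn.structure f
        haveI := mod K f hK
        rw [rz] at h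
        exact h1.realize_sentence K h
    exact ⟨dec K1 K2 f1 f2 hK1 hK2, dec K2 K1 f2 f1 hK2 hK1⟩
  · intro M N _ _ _ _ hM hN φ
    rcases hT.2 φ with h | h
    · exact ⟨fun _ => h.realize_sentence N, fun _ => h.realize_sentence M⟩
    · have h1 : ¬ (M ⊨ φ) := h.realize_sentence M
      have h2 : ¬ (N ⊨ φ) := h.realize_sentence N
      exact ⟨fun h => absurd h h1, fun h => absurd h h2⟩
  · obtain ⟨A, _, hA⟩ := toAM N0 hN0
    exact ⟨A, hA⟩

/-- realize an `L`-type in an `AM`. -/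
theorem AM.realize_type {X : Type w} {Y : Type w'} {M : Type w} [L.Structure M]
    (A : AM.{u, v, w} T) (x : X → M)
    {y : Y → M} {y' : Y → A} (h : ∀ ψ : L.Formula Y, ψ.Realize y → ψ.Realize y') :
    ∃ (B : AM.{u, v, w} T) (i : A → B) (x' : X → B), IsElem (LPlus L) i ∧
      ∀ φ : L.Formula (X ⊕ Y), φ.Realize (Sum.elim x y) ↔ φ.Realize (Sum.elim x' (i ∘ y')) := by
  obtain ⟨U, hU⟩ := exists_uf_formula (L := L) (Sum.elim x y) (I := X → A)
    (fun g φ => φ.Realize (Sum.elim g y')) (by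
      intro i φ ψ h; exact Formula.realize_inf.1 h) (fun φ hφ => transfer h φ x hφ)
  refine ⟨A.up U, A.diag U, fun a => A.mk' U (fun g => g a), A.diag_elem U, ?_⟩
  apply iff_of_imp
  intro φ hφ
  have := hU φ hφ
  have h2 := (A.los U φ (fun a g => Sum.elim g y' a)).2 this
  convert h2 using 1
  funext a; cases a <;> rfl

/-- realize an `L⁺`-type in an `AM`. -/
theorem AM.realize_type_plus {X : Type w} {Y : Type w'} {M : AM.{u, v, w} T}
    (A : AM.{u, v, w} T) (x : X → M)
    {y : Y → M} {y' : Y → A} (h : ∀ ψ : (LPlus L).Formula Y, ψ.Realize y → ψ.Realize y') :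
    ∃ (B : AM.{u, v, w} T) (i : A → B) (x' : X → B), IsElem (LPlus L) i ∧
      ∀ φ : (LPlus L).Formula (X ⊕ Y), φ.Realize (Sum.elim x y) ↔ φ.Realize (Sum.elim x' (i ∘ y')) := by
  obtain ⟨U, hU⟩ := exists_uf_formula (L := LPlus L) (Sum.elim x y) (I := X → A)
    (fun g φ => φ.Realize (Sum.elim g y')) (by
      intro i φ ψ h; exact Formula.realize_inf.1 h) (fun φ hφ => transfer h φ x hφ)
  refine ⟨A.up U, A.diag U, fun a => A.mk' U (fun g => g a), A.diag_elem U, ?_⟩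
  apply iff_of_imp
  intro φ hφ
  have := hU φ hφ
  have h2 := (A.los_plus U φ (fun a g => Sum.elim g y' a)).2 this
  convert h2 using 1
  funext a; cases a <;> rfl

theorem elem_of_type {M E : Type*} [L.Structure M] [L.Structure E] {Y : Type*} {k : M → E} {y : Y → M}
    {y' : Y → E} 
    (h : ∀ φ : L.Formula (M ⊕ Y), φ.Realize (Sum.elim id y) ↔ φ.Realize (Sum.elim k y')) :
    IsElem L k ∧ ∀ a, k (y a) = y' a := by
  constructor
  · apply IsElem.of_all
    intro φ hφ
    have := (h (φ.relabel Sum.inl)).1 (by rw [Formula.realize_relabel]; exact hφ)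
    rw [Formula.realize_relabel] at this
    exact this
  · intro ξ
    have := (h (Term.equal (Term.var (Sum.inl (y ξ))) (Term.var (Sum.inr ξ)))).1
      ((realize_eq_of_vars _ _ _).2 rfl)
    exact (realize_eq_of_vars _ _ _).1 this

theorem red_realize {A : AM.{u, v, w} T} {α : Type*} (φ : L.Formula α) (x : α → A) :
    ((LHom.sumInl : L →ᴸ LPlus L).onFormula φ).Realize x ↔ φ.Realize x := by
  rw [LHom.realize_onFormula]

theorem MC.step (h : MC.{u, v, w} T Tmc) {M N : Type w} [L.Structure M] [L.Structure N]
    [hMn : Nonempty M] [hNn : Nonempty N] (hM : M ⊨ T) (hN : N ⊨ T) (f : M ↪[L] N) :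
    ∃ (K : AM.{u, v, w} T) (g : N ↪[L] K), IsElem L (g ∘ f) := by
  obtain ⟨N0, hN0⟩ := h.ex
  obtain ⟨M1, i0, j, hi0, hj⟩ := N0.realize_type (L := L) (T := T) (fun m : M => m)
    (y := (fun e : Empty => e.elim)) (y' := fun e : Empty => e.elim) (by
      intro ψ hψ
      have := (h.eqv M N0 hM N0.mod ψ).1 (by
        unfold Sentence.Realize; convert hψ)
      unfold Sentence.Realize at this; convert this)
  have hM1 : M1 ⊨ Tmc := (hi0.model Tmc).1 hN0
  have hjel : IsElem L j := (elem_of_type hj).1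
  let Mi : AM.{u, v, w} T := AM.of M hM (Language.Equiv.refl L M)
  let Ni : AM.{u, v, w} T := AM.of N hN (Language.Equiv.refl L N)
  let M1i : AM.{u, v, w} T := AM.of M1 M1.mod (Language.Equiv.refl L M1)
  let f' : Mi ↪[LPlus L] Ni := AM.mkEmb (A := Mi) (B := Ni) f (fun x => rfl)
  let j' : Mi ↪[LPlus L] M1i := AM.mkEmb (A := Mi) (B := M1i) hjel.toEmb.toEmbedding (fun x => rfl)
  obtain ⟨K, hK, ⟨a⟩⟩ := h.h1 Ni
  obtain ⟨K', hK', ⟨b⟩⟩ := h.h1 M1i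
  obtain ⟨K3, i3, k, hi3, hk⟩ := K.realize_type_plus (M := K') (fun x => x) (y := b.comp j') (y' := a.comp f')
    (fun ψ hψ => (h.h2 Mi _ _ _ _ hK' hK ψ).1 hψ)
  have hK3 : K3 ⊨ Tmc := (hi3.model Tmc).1 hK
  obtain ⟨hkel, hk2⟩ := elem_of_type hk
  let ι : M1i ↪[LPlus L] K3 := hkel.toEmb.toEmbedding.comp b
  let n : Ni ↪[LPlus L] K3 := hi3.toEmb.toEmbedding.comp a
  have hcomm : ∀ m : M, ι (j m) = n (f m) := fun m => hk2 m
  let s1 : M1i ↪[LPlus L] M1i := AM.mkEmb (A := M1i) (B := M1i) M1.σ.toEmbedding (fun x => rfl)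
  have hp : ∀ φ : L.Formula M1, φ.Realize (fun m => ι m) → φ.Realize (fun m => ι (M1.σ m)) := by
    intro φ hφ
    have := (h.h2 M1i K3 K3 ι (ι.comp s1) hK3 hK3 ((LHom.sumInl : L →ᴸ LPlus L).onFormula φ)).1
      ((red_realize (A := K3) φ _).2 hφ)
    exact (red_realize (A := K3) φ _).1 this
  obtain ⟨E, _, i, s, hi, hs⟩ := aut_lemma (L := L) (E := K3) _ _ hp
  haveI : Nonempty E := K3.ne.map i
  let E' : AM.{u, v, w} T := AM.of E ((hi.model T).1 K3.mod) s
  let iι : M1 ↪[LPlus L] E' := AM.mkEmb (A := M1) (B := E')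
    (hi.toEmb.toEmbedding.comp (AM.redEmb ι : M1i ↪[L] K3)) (fun x => (hs x).symm)
  obtain ⟨K2, hK2, ⟨e⟩⟩ := h.h1 E'
  have hel : IsElem L (e.comp iι) := by
    apply IsElem.of_all
    intro φ hφ
    have := (h.h2 M1 M1 K2 (Embedding.refl _ _) (e.comp iι) hM1 hK2 ((LHom.sumInl : L →ᴸ LPlus L).onFormula φ)).1
      (by rw [red_realize]; exact hφ)
    rw [red_realize] at this
    exact this
  refine ⟨K2, ((AM.redEmb e : E' ↪[L] K2).comp hi.toEmb.toEmbedding).comp (AM.redEmb n : Ni ↪[L] K3), ?_⟩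
  have := hel.comp hjel
  convert this using 1
  funext m
  change e (i (n (f m))) = e (i (ι (j m)))
  rw [hcomm]

/-- `T` is model complete -/
theorem MC.modelComplete (h : MC.{u, v, w} T Tmc) {M N : Type w} [L.Structure M] [L.Structure N]
    [hMn : Nonempty M] [hNn : Nonempty N] (hM : M ⊨ T) (hN : N ⊨ T) (f : M ↪[L] N) : IsElem L f := by
  have key : ∀ (α : Type) (l : ℕ) (φ : L.BoundedFormula α l), 
    ∀ (M N : Type w) [L.Structure M] [L.Structure N]
    [hMn : Nonempty M] [hNn : Nonempty N] (hM : M ⊨ T) (hN : N ⊨ T) (f : M ↪[L] N)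
      (x : α → M) (xs : Fin l → M),
      φ.Realize (f ∘ x) (f ∘ xs) ↔ φ.Realize x xs := by
    intro α l φ
    induction φ with
    | falsum => intros; rfl
    | equal t1 t2 =>
      intro M N _ _ _ _ hM hN f x xs
      simp only [BoundedFormula.Realize, ← Sum.comp_elim, HomClass.realize_term]
      exact f.injective.eq_iff
    | rel R ts =>
      intro M N _ _ _ _ hM hN f x xs
      simp only [BoundedFormula.Realize, ← Sum.comp_elim, HomClass.realize_term]
      exact f.map_rel R _
    | imp f1 f2 h1 h2 =>
      intro M N _ _ _ _ hM hN f x xs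
      simp only [BoundedFormula.realize_imp, h1 M N hM hN, h2 M N hM hN]
    | all φ ih =>
      intro M N _ _ _ _ hM hN f x xs
      constructor
      · intro h a
        rw [← ih M N hM hN f]
        have := h (f a)
        rwa [← Fin.comp_snoc] at this
      · intro h1 e
        obtain ⟨K, g, hg⟩ := h.step hM hN f
        rw [← ih N K hN K.mod g]
        have h2 := (hg.toEmb.map_boundedFormula (φ.all) x xs).2 h1
        have h3 := h2 (g e)
        rw [Fin.comp_snoc]
        exact h3
  intro n φ x
  have := key _ _ φ M N hM hN f x default
  unfold Formula.Realize
  rw [← this]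
  apply iff_of_eq; congr 1; exact Subsingleton.elim _ _

/-- morphisms of models with automorphism -/
structure IsHom {A B : AM.{u, v, w} T} (f : A → B) : Prop where
  elem : IsElem L f
  comm : ∀ x, f (A.σ x) = B.σ (f x)

theorem IsHom.of_elem {A B : AM.{u, v, w} T} {f : A → B} (hf : IsElem (LPlus L) f) : IsHom f :=
  ⟨AM.elem_red hf, AM.elem_comm hf⟩

theorem IsHom.comp {A B C : AM.{u, v, w} T} {g : B → C} {f : A → B} (hg : IsHom g) (hf : IsHom f) :
    IsHom (g ∘ f) := ⟨hg.elem.comp hf.elem, fun x => by simp [hf.comm, hg.comm]⟩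

theorem IsHom.ident {A : AM.{u, v, w} T} : IsHom (fun x : A => x) := ⟨IsElem.ident, fun _ => rfl⟩

/-- bundled -/
def IsHom.toEmb {A B : AM.{u, v, w} T} {f : A → B} (hf : IsHom f) : A ↪[LPlus L] B :=
  AM.mkEmb hf.elem.toEmb.toEmbedding hf.comm

theorem MC.isHom (h : MC.{u, v, w} T Tmc) {A B : AM.{u, v, w} T} (f : A ↪[LPlus L] B) : IsHom f :=
  ⟨h.modelComplete A.mod B.mod (AM.redEmb f), AM.emb_comm f⟩

theorem MC.ext (h : MC.{u, v, w} T Tmc) (A : AM.{u, v, w} T) : ∃ (K : AM.{u, v, w} T) (f : A → K),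
    K ⊨ Tmc ∧ IsHom f := by
  obtain ⟨K, hK, ⟨f⟩⟩ := h.h1 A
  exact ⟨K, f, hK, h.isHom f⟩

theorem MC.same (h : MC.{u, v, w} T Tmc) {A K1 K2 : AM.{u, v, w} T} {f1 : A → K1} {f2 : A → K2}
    (hf1 : IsHom f1) (hf2 : IsHom f2) (h1 : K1 ⊨ Tmc) (h2 : K2 ⊨ Tmc) (φ : (LPlus L).Formula A) :
    φ.Realize f1 ↔ φ.Realize f2 := h.h2 A K1 K2 hf1.toEmb hf2.toEmb h1 h2 φ

theorem MC.elem (h : MC.{u, v, w} T Tmc) {K1 K2 : AM.{u, v, w} T} {f : K1 → K2}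
    (hf : IsHom f) (h1 : K1 ⊨ Tmc) (h2 : K2 ⊨ Tmc) : IsElem (LPlus L) f := by
  apply IsElem.of_all
  intro φ hφ
  exact (h.same IsHom.ident hf h1 h2 φ).1 hφ

end ShelahE34
end FirstOrder

namespace FirstOrder
set_option linter.all false
open Language Structure
universe u v w u' v' w'
namespace ShelahE34

section Iter
variable {J : Type}

/-- dependence on a set of coordinates -/
def DepOn {β : Sort*} (S : Set J) (P : (J → ℕ) → β) : Prop := ∀ f g, (∀ j ∈ S, f j = g j) → P f = P g

variable [LinearOrder J]

/-- iterated quantifier -/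
def ItL (U : Ultrafilter ℕ) : List J → ((J → ℕ) → Prop) → (J → ℕ) → Prop
  | [], P, f => P f
  | j :: l, P, f => ∀ᶠ i in U, ItL U l P (Function.update f j i)

variable {U : Ultrafilter ℕ}

theorem ItL_and (l : List J) (P Q : (J → ℕ) → Prop) (f : J → ℕ) :
    ItL U l (fun f => P f ∧ Q f) f ↔ ItL U l P f ∧ ItL U l Q f := by
  induction l generalizing f with
  | nil => exact Iff.rfl
  | cons j l ih =>
    simp only [ItL, ih]
    exact Filter.eventually_and

theorem ItL_not (l : List J) (P : (J → ℕ) → Prop) (f : J → ℕ) :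
    ItL U l (fun f => ¬ P f) f ↔ ¬ ItL U l P f := by
  induction l generalizing f with
  | nil => exact Iff.rfl
  | cons j l ih =>
    simp only [ItL, ih]
    exact Ultrafilter.eventually_not

theorem ItL_exists (l : List J) (P : (J → ℕ) → Prop) (f : J → ℕ) (h : ItL U l P f) : ∃ g, P g := by
  induction l generalizing f with
  | nil => exact ⟨f, h⟩
  | cons j l ih =>
    simp only [ItL] at h
    obtain ⟨i, hi⟩ := h.exists
    exact ih _ hi

theorem ItL_dep {S : Set J} {P : (J → ℕ) → Prop} (hP : DepOn S P) (l : List J) (f g : J → ℕ)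
    (h : ∀ j ∈ S, j ∉ l → f j = g j) : ItL U l P f ↔ ItL U l P g := by
  induction l generalizing f g with
  | nil => exact iff_of_eq (hP f g (fun j hj => h j hj (by simp)))
  | cons j l ih =>
    simp only [ItL]
    have : ∀ i, ItL U l P (Function.update f j i) ↔ ItL U l P (Function.update g j i) := by
      intro i
      apply ih
      intro j' hj' hl
      by_cases e : j' = j
      · subst e; simp
      · rw [Function.update_of_ne e, Function.update_of_ne e]
        exact h j' hj' (by simp [e, hl])
    simp only [this]

theorem ItL_dummy {S : Set J} {P : (J → ℕ) → Prop} (hP : DepOn S P) {l l' : List J}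
    (hl : l.Sublist l') (nd : l'.Nodup) (hS : ∀ j ∈ S, j ∈ l' → j ∈ l) (f : J → ℕ) :
    ItL U l P f ↔ ItL U l' P f := by
  induction hl generalizing f with
  | slnil => exact Iff.rfl
  | @cons l l' a hl ih =>
    rw [List.nodup_cons] at nd
    simp only [ItL]
    have ih' := ih nd.2 (fun j hj hj' => hS j hj (by simp [hj']))
    simp only [← ih']
    have : ∀ i, ItL U l P (Function.update f a i) ↔ ItL U l P f := by
      intro i
      apply ItL_dep hP
      intro j hj hjl
      rw [Function.update_of_ne]
      rintro rfl
      exact hjl (hS j hj (by simp))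
    simp [this]
  | @cons_cons l l' a hl ih =>
    rw [List.nodup_cons] at nd
    simp only [ItL]
    have ih' := ih nd.2 (fun j hj hj' => by
      have := hS j hj (by simp [hj'])
      rw [List.mem_cons] at this
      rcases this with rfl | h
      · exact absurd hj' nd.1
      · exact h)
    simp only [ih']

theorem ItL_map {S : Set J} {P : (J → ℕ) → Prop} (hP : DepOn S P) {h : J → J} (hh : Set.InjOn h S)
    (l : List J) (hl : ∀ j ∈ l, j ∈ S) (f f' : J → ℕ) (hf : ∀ j ∈ S, f j = f' (h j)) :
    ItL U l P f ↔ ItL U (l.map h) (fun g => P (g ∘ h)) f' := by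
  induction l generalizing f f' with
  | nil => exact iff_of_eq (hP f _ hf)
  | cons j l ih =>
    simp only [ItL, List.map_cons]
    have : ∀ i, ItL U l P (Function.update f j i) ↔
        ItL U (l.map h) (fun g => P (g ∘ h)) (Function.update f' (h j) i) := by
      intro i
      apply ih (fun j' hj' => hl j' (by simp [hj']))
      intro j' hj'
      by_cases e : j' = j
      · subst e; simp
      · rw [Function.update_of_ne e, Function.update_of_ne]
        · exact hf j' hj'
        · intro e'
          exact e (hh hj' (hl j (by simp)) e')
    simp only [this]

theorem sort_sub {l : List J} (hl : l.Pairwise (· < ·)) (s : Finset J) (h : ∀ j ∈ l, j ∈ s) :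
    l.Sublist (s.sort (· ≤ ·)) := by
  apply List.sublist_of_subperm_of_pairwise (r := (· ≤ ·))
  · apply List.subperm_of_subset
    · exact hl.imp (fun h => ne_of_lt h)
    · intro j hj; simpa using h j hj
  · exact hl.imp (fun h => le_of_lt h)
  · exact Finset.pairwise_sort s (· ≤ ·)

/-- The iterated ultrafilter -/
theorem exists_iter (hU : ∀ n : ℕ, ∀ᶠ i : ℕ in U, n < i) : ∃ V : Ultrafilter (J → ℕ),
    (∀ (s : Finset J) (P : (J → ℕ) → Prop) (h : J → J), DepOn (s : Set J) P →
      StrictMonoOn h (s : Set J) →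
      ((∀ᶠ f in V, P f) ↔ ∀ᶠ f in V, P (f ∘ h))) ∧ ∀ u v : J, u < v → ∀ᶠ f : J → ℕ in V, f u < f v := by
  classical
  obtain ⟨V, hV⟩ := exists_uf {A : Set (J → ℕ) | ∃ s : Finset J, DepOn (s : Set J) (· ∈ A) ∧
      ∀ f, ItL U (s.sort (· ≤ ·)) (· ∈ A) f} ⟨Set.univ, ∅, fun f g _ => rfl, fun f => by
        rw [Finset.sort_empty]; exact trivial⟩ (by
      rintro A ⟨s, hA, h1⟩ B ⟨t, hB, h2⟩
      refine ⟨A ∩ B, ⟨s ∪ t, ?_, ?_⟩, subset_rfl⟩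
      · intro f g h
        have e1 := hA f g (fun j hj => h j (by simp at hj ⊢; exact Or.inl hj))
        have e2 := hB f g (fun j hj => h j (by simp at hj ⊢; exact Or.inr hj))
        simp only [Set.mem_inter_iff, e1, e2]
      · intro f
        refine (ItL_and _ _ _ f).2 ⟨?_, ?_⟩
        · refine (ItL_dummy hA (sort_sub (l := s.sort (· ≤ ·)) (Finset.sortedLT_sort s).pairwise _ ?_) (Finset.sort_nodup _ _) ?_ f).1 (h1 f)
          · intro j hj; simp at hj ⊢; exact Or.inl hj
          · intro j hj _; simpa using hj
        · refine (ItL_dummy hB (sort_sub (l := t.sort (· ≤ ·)) (Finset.sortedLT_sort t).pairwise _ ?_) (Finset.sort_nodup _ _) ?_ f).1 (h2 f)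
          · intro j hj; simp at hj ⊢; exact Or.inr hj
          · intro j hj _; simpa using hj) (by
      rintro A ⟨s, hA, h1⟩
      exact ItL_exists _ _ (fun _ => 0) (h1 _))
  have key : ∀ (s : Finset J) (P : (J → ℕ) → Prop), DepOn (s : Set J) P → ∀ f,
      ((∀ᶠ f in V, P f) ↔ ItL U (s.sort (· ≤ ·)) P f) := by
    intro s P hP f
    have one : ∀ P : (J → ℕ) → Prop, DepOn (s : Set J) P → ItL U (s.sort (· ≤ ·)) P f → ∀ᶠ f in V, P f := by
      intro P hP h
      refine hV {f | P f} ⟨s, hP, fun g => ?_⟩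
      refine (ItL_dep hP _ f g ?_).1 h
      intro j hj hj'
      exact absurd (by simpa using hj) hj'
    refine ⟨fun h => ?_, one P hP⟩
    by_contra h2
    rw [← ItL_not] at h2
    have := one _ (fun f g h => by rw [hP f g h]) h2
    exact (Ultrafilter.eventually_not.1 this) h
  refine ⟨V, ?_, ?_⟩
  · intro s P h hP hh
    have d : DepOn ((s.image h : Finset J) : Set J) (fun f => P (f ∘ h)) := by
      intro f g hfg
      apply hP
      intro j hj
      exact hfg (h j) (by simp; exact ⟨j, hj, rfl⟩)
    rw [key s P hP (fun _ => 0), key (s.image h) _ d (fun _ => 0)]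
    rw [ItL_map hP hh.injOn _ (by simp) (fun _ => 0) (fun _ => 0) (fun _ _ => rfl)]
    apply ItL_dummy d (sort_sub _ _ _) (Finset.sort_nodup _ _)
    · intro j hj _
      simp at hj ⊢
      exact hj
    · rw [List.pairwise_map]
      refine List.Pairwise.imp_of_mem ?_ (Finset.sortedLT_sort s).pairwise
      intro a b ha hb hab
      exact hh (by simpa using ha) (by simpa using hb) hab
    · intro j hj
      simpa using hj
  · intro u v huv
    have d : DepOn (({u, v} : Finset J) : Set J) (fun f : J → ℕ => f u < f v) := by
      intro f g h
      simp only [h u (by simp), h v (by simp)]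
    rw [key _ _ d (fun _ => 0), ← ItL_dummy (l := [u, v]) d (sort_sub (by simpa using huv) _ (by simp))
      (Finset.sort_nodup _ _) (by simp)]
    simp only [ItL]
    refine Filter.Eventually.of_forall fun i => ?_
    filter_upwards [hU i] with j hj
    rw [Function.update_of_ne huv.ne]
    simpa using hj

end Iter

end ShelahE34
end FirstOrder

namespace FirstOrder
set_option linter.all false
open Language Structure
universe u v w u' v' w'
namespace ShelahE34
variable {L : Language.{u, v}}

section Iter
variable {J : Type} [LinearOrder J] {Q : Type w} [L.Structure Q] [Nonempty Q]

/-- finite dependence -/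
def FD (J' : Set J) (f : (J → ℕ) → Q) : Prop := ∃ s : Finset J, (s : Set J) ⊆ J' ∧ DepOn (s : Set J) f

/-- pull back -/
def pull (h : J → J) (f : (J → ℕ) → Q) : (J → ℕ) → Q := fun a => f (a ∘ h)

theorem DepOn.mono {β : Sort*} {S S' : Set J} {f : (J → ℕ) → β} (hf : DepOn S f) (h : S ⊆ S') :
    DepOn S' f := fun a b hab => hf a b (fun j hj => hab j (h hj))

theorem FD.pull {J' J'' : Set J} {f : (J → ℕ) → Q} (hf : FD J' f) {h : J → J} (hh : ∀ j ∈ J', h j ∈ J'') :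
    FD J'' (pull h f) := by
  classical
  obtain ⟨s, hs, d⟩ := hf
  refine ⟨s.image h, ?_, ?_⟩
  · intro j hj
    simp only [Finset.coe_image, Set.mem_image] at hj
    obtain ⟨i, hi, rfl⟩ := hj
    exact hh i (hs hi)
  · intro a b hab
    apply d
    intro j hj
    exact hab (h j) (by simp; exact ⟨j, hj, rfl⟩)

theorem FD.fin {J' : Set J} {n : ℕ} {f : Fin n → (J → ℕ) → Q} (hf : ∀ i, FD J' (f i)) :
    ∃ s : Finset J, (s : Set J) ⊆ J' ∧ ∀ i, DepOn (s : Set J) (f i) := by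
  classical
  choose s hs hd using hf
  refine ⟨Finset.univ.biUnion s, ?_, fun i => (hd i).mono ?_⟩
  · intro j hj
    simp only [Finset.coe_biUnion, Set.mem_iUnion] at hj
    obtain ⟨i, _, hi⟩ := hj
    exact hs i hi
  · intro j hj
    simp only [Finset.coe_biUnion, Set.mem_iUnion]
    exact ⟨i, by simp, hj⟩

/-- main property -/
def IterUF (V : Ultrafilter (J → ℕ)) : Prop := 
  ∀ (s : Finset J) (P : (J → ℕ) → Prop) (h : J → J), DepOn (s : Set J) P →
      StrictMonoOn h (s : Set J) →
      ((∀ᶠ f in V, P f) ↔ ∀ᶠ f in V, P (f ∘ h))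

variable {V : Ultrafilter (J → ℕ)}

theorem pull_fin (hV : IterUF V) {n : ℕ} (φ : L.Formula (Fin n)) (f : Fin n → (J → ℕ) → Q)
    (s : Finset J) (hs : ∀ i, DepOn (s : Set J) (f i)) (h : J → J) (hh : StrictMonoOn h (s : Set J)) :
    φ.Realize (fun i => UP.mk V (f i)) ↔ φ.Realize (fun i => UP.mk V (pull h (f i))) := by
  rw [UP.los, UP.los]
  refine hV s (fun g => φ.Realize fun i => f i g) h ?_ hh
  intro a b hab
  have : (fun i => f i a) = fun i => f i b := funext fun i => hs i a b hab
  simp only [this]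

theorem pull_formula (hV : IterUF V) {α : Type*} (φ : L.Formula α) (f : α → (J → ℕ) → Q)
    {J' : Set J} (hf : ∀ i, FD J' (f i)) (h : J → J) (hh : StrictMonoOn h J') :
    φ.Realize (fun i => UP.mk V (f i)) ↔ φ.Realize (fun i => UP.mk V (pull h (f i))) := by
  obtain ⟨p, g, ψ, _, hψ⟩ := finvar.{u, v, w} φ
  rw [hψ, hψ]
  obtain ⟨s, hs, hd⟩ := FD.fin (fun i => hf (g i))
  exact pull_fin hV ψ (fun i => f (g i)) s hd h (hh.mono hs)

theorem iter_sub (V : Ultrafilter (J → ℕ)) (J' : Set J) : ∃ (C : Type w) (_ : L.Structure C) (ι : C → UP V Q), IsElem L ι ∧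
    Set.range ι = {c | ∃ f, FD J' f ∧ UP.mk V f = c} := by
  classical
  apply exists_elem_sub
  intro n φ x d hx h
  choose f hf hfx using hx
  obtain ⟨s, hs, hd⟩ := FD.fin hf
  obtain ⟨d, rfl⟩ := UP.surj d
  have : ∀ y : Fin n → Q, ∃ e : Q, (∃ e', φ.Realize (Sum.elim y fun _ => e')) → φ.Realize (Sum.elim y fun _ => e) := by
    intro y
    by_cases he : ∃ e', φ.Realize (Sum.elim y fun _ => e')
    · exact ⟨he.choose, fun _ => he.choose_spec⟩
    · exact ⟨Classical.arbitrary Q, fun h => absurd h he⟩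
  choose G hG using this
  refine ⟨UP.mk V fun a => G fun i => f i a, ⟨_, ⟨s, hs, ?_⟩, rfl⟩, ?_⟩
  · intro a b hab
    have : (fun i => f i a) = fun i => f i b := funext fun i => hd i a b hab
    simp only [this]
  · have e1 : ∀ g : (J → ℕ) → Q, Sum.elim x (fun _ : Unit => UP.mk V g) =
        fun i => UP.mk V (Sum.elim f (fun _ : Unit => g) i) := by
      intro g
      funext i
      rcases i with i | i
      · exact (hfx i).symm
      · rfl
    rw [e1, UP.los] at h
    rw [e1, UP.los]
    filter_upwards [h] with a ha
    have := hG (fun i => f i a) ⟨d a, by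
      convert ha using 1
      funext i; rcases i with i | i <;> rfl⟩
    convert this using 1
    funext i; rcases i with i | i <;> rfl

theorem iter_aut (hV : IterUF V) {J' : Set J} {C : Type w} [L.Structure C] {ι : C → UP V Q}
    (hι : IsElem L ι) (hr : Set.range ι = {c | ∃ f, FD J' f ∧ UP.mk V f = c})
    {h h' : J → J} (hh : StrictMonoOn h J') (h1 : ∀ j ∈ J', h j ∈ J') (h2 : ∀ j ∈ J', h' j ∈ J')
    (h3 : ∀ j, h (h' j) = j) :
    ∃ s : C ≃[L] C, ∀ c f, FD J' f → ι c = UP.mk V f → ι (s c) = UP.mk V (pull h f) := by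
  have e : ∀ f, FD J' f → ∃ c, ι c = UP.mk V f := by
    intro f hf
    have : UP.mk V f ∈ Set.range ι := by rw [hr]; exact ⟨f, hf, rfl⟩
    exact this
  haveI : Nonempty C := 
    ⟨(e (fun _ => Classical.arbitrary Q) ⟨∅, by simp, fun _ _ _ => rfl⟩).choose⟩
  choose! pt hpt using e
  have hsurj : ∀ c : C, ∃ f, FD J' f ∧ UP.mk V f = ι c := by
    intro c
    have : ι c ∈ Set.range ι := ⟨c, rfl⟩
    rw [hr] at this
    exact this
  obtain ⟨s, hs⟩ := exists_equiv_of_surj (L := L) (Ξ := {f : (J → ℕ) → Q // FD J' f})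
    (fun f => pt f.1) (fun f => pt (pull h f.1)) (by
      intro c
      obtain ⟨f, hf, hc⟩ := hsurj c
      exact ⟨⟨f, hf⟩, hι.inj (by rw [hpt _ hf, hc])⟩) (by
      intro c
      obtain ⟨f, hf, hc⟩ := hsurj c
      refine ⟨⟨pull h' f, hf.pull h2⟩, hι.inj ?_⟩
      change ι (pt (pull h (pull h' f))) = _
      rw [hpt _ ((hf.pull h2).pull h1), ← hc]
      congr 1
      funext a
      simp only [pull]
      congr 1; funext j; simp [h3]) (by
      intro φ
      rw [← hι.formula', ← hι.formula']
      have e1 : ∀ f : {f : (J → ℕ) → Q // FD J' f}, ι (pt f.1) = UP.mk V f.1 := fun f => hpt _ f.2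
      have e2 : ∀ f : {f : (J → ℕ) → Q // FD J' f}, ι (pt (pull h f.1)) = UP.mk V (pull h f.1) :=
        fun f => hpt _ (f.2.pull h1)
      simp only [e1, e2]
      exact pull_formula hV φ _ (fun f => f.2) h hh)
  refine ⟨s, ?_⟩
  intro c f hf hc
  have : c = pt f := hι.inj (by rw [hc, hpt _ hf])
  rw [this, hs ⟨f, hf⟩, hpt _ (hf.pull h1)]

end Iter

end ShelahE34
end FirstOrder

namespace FirstOrder
set_option linter.all false
open Language Structure
universe u v w u' v' w'
namespace ShelahE34
variable {L : Language.{u, v}} {T : L.Theory} {Tmc : (LPlus L).Theory}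

/-- no ladders: stability of `T` -/
def NoLadder (T : L.Theory) : Prop := ∀ (D : Type w) [L.Structure D] [Nonempty D], D ⊨ T →
  ∀ (m n : ℕ) (χ : L.Formula (Fin m ⊕ Fin n)) (x : ℕ → Fin m → D) (y : ℕ → Fin n → D),
    ¬ ∀ i j, i < j → χ.Realize (Sum.elim (x i) (y j)) ∧ ¬ χ.Realize (Sum.elim (x j) (y i))

theorem fixFormula {m n : ℕ} (χ : L.Formula (Fin m ⊕ Fin n)) : ∃ Ψ : (LPlus L).Formula (Fin n ⊕ Fin n),
    ∀ (A : AM.{u, v, w} T) (y' y : Fin n → A), Ψ.Realize (Sum.elim y' y) ↔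
      ∃ x : Fin m → A, (∀ i, A.σ (x i) = x i) ∧ χ.Realize (Sum.elim x y') ∧ ¬ χ.Realize (Sum.elim x y) := by
  let χ' := (LHom.sumInl : L →ᴸ LPlus L).onFormula χ
  let body : (LPlus L).Formula ((Fin n ⊕ Fin n) ⊕ Fin m) :=
    (Formula.iInf (fun i : Fin m => Term.equal (sigmaTerm (Term.var (Sum.inr i))) (Term.var (Sum.inr i)))) ⊓
    (χ'.relabel (Sum.elim Sum.inr (fun i => Sum.inl (Sum.inl i))) ⊓
    (χ'.relabel (Sum.elim Sum.inr (fun i => Sum.inl (Sum.inr i)))).not)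
  refine ⟨Formula.iExs (Fin m) body, ?_⟩
  intro A y' y
  rw [Formula.realize_iExs]
  apply exists_congr
  intro x
  simp only [body, Formula.realize_inf, Formula.realize_not, Formula.realize_relabel, χ']
  refine and_congr ?_ (and_congr ?_ (not_congr ?_))
  · rw [Formula.realize_iInf]
    simp only [Formula.realize_equal, A.realize_sigmaTerm, Term.realize, Sum.elim_inr]
  · refine (red_realize (A := A) χ _).trans ?_
    apply iff_of_eq; congr 1; funext i; rcases i with i | i <;> rfl
  · refine (red_realize (A := A) χ _).trans ?_
    apply iff_of_eq; congr 1; funext i; rcases i with i | i <;> rfl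

abbrev JJ := ℤ ×ₗ ℤ

/-- shift -/
def sh (k : ℤ) (j : JJ) : JJ := toLex ((ofLex j).1, if (ofLex j).1 = 1 then (ofLex j).2 else (ofLex j).2 + k)

/-- collapse level 2 to level 0 -/
def hn (n : ℕ) (j : JJ) : JJ := if (ofLex j).1 = 2 then toLex (0, (ofLex j).2 + n) else j

/-- all but the middle -/
def J0 : Set JJ := {j | (ofLex j).1 ≠ 1}

theorem sh_mono (k : ℤ) : StrictMono (sh k) := by
  intro a b h
  rw [Prod.Lex.lt_iff] at h ⊢
  simp only [sh, ofLex_toLex]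
  split_ifs <;> omega

theorem sh_sh (k : ℤ) (j : JJ) : sh k (sh (-k) j) = j := by
  apply ofLex.injective
  ext
  · simp [sh]
  · simp only [sh, ofLex_toLex]; split_ifs <;> omega

theorem sh_J0 (k : ℤ) (j : JJ) (h : j ∈ J0) : sh k j ∈ J0 := h

theorem hn_mono (s : Finset JJ) (hs : (s : Set JJ) ⊆ J0) : ∀ᶠ n : ℕ in Filter.atTop, StrictMonoOn (hn n) (s : Set JJ) := by
  have : ∀ᶠ n : ℕ in Filter.atTop, ∀ a ∈ s, ∀ b ∈ s, (ofLex a).2 < (ofLex b).2 + n := by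
    rw [Filter.eventually_all_finset]
    intro a ha
    rw [Filter.eventually_all_finset]
    intro b hb
    filter_upwards [Filter.eventually_gt_atTop ((ofLex a).2 - (ofLex b).2).toNat] with n hn
    omega
  filter_upwards [this] with n hn' a ha b hb hab
  have h1 : (ofLex a).1 ≠ 1 := hs ha
  have h2 : (ofLex b).1 ≠ 1 := hs hb
  have h3 := hn' a ha b hb
  rw [Prod.Lex.lt_iff] at hab ⊢
  simp only [hn]
  split_ifs <;> (try simp only [ofLex_toLex]) <;> first | omega | (simp; omega)

theorem hn_sh (n : ℕ) (k : ℤ) (j : JJ) : hn n (sh k j) = sh k (hn n j) := by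
  simp only [hn, sh, ofLex_toLex]
  split_ifs <;> simp_all <;> omega

theorem MC.noLadder (h : MC.{u, v, w} T Tmc) : NoLadder.{u, v, w} T := by
  intro D _ _ hD m n χ x y hl
  let U : Ultrafilter ℕ := Filter.hyperfilter ℕ
  have hU : ∀ n : ℕ, ∀ᶠ i : ℕ in U, n < i := fun n =>
    (Filter.eventually_gt_atTop n).filter_mono Nat.hyperfilter_le_atTop
  obtain ⟨V, hV, hlt⟩ := exists_iter (J := JJ) hU
  have hP : UP V D ⊨ T := (UP.diag_elem (U := V).model T).1 hD
  obtain ⟨CB, _, ιB, hιB, hrB⟩ := iter_sub (L := L) (Q := D) V (Set.univ : Set JJ)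
  obtain ⟨CM, _, ιM, hιM, hrM⟩ := iter_sub (L := L) (Q := D) V J0
  have ptB : ∀ f : (JJ → ℕ) → D, FD Set.univ f → ∃ c, ιB c = UP.mk V f := by
    intro f hf
    have : UP.mk V f ∈ Set.range ιB := by rw [hrB]; exact ⟨f, hf, rfl⟩
    exact this
  have ptM : ∀ f : (JJ → ℕ) → D, FD J0 f → ∃ c, ιM c = UP.mk V f := by
    intro f hf
    have : UP.mk V f ∈ Set.range ιM := by rw [hrM]; exact ⟨f, hf, rfl⟩
    exact this
  have rep : ∀ c, ∃ f : (JJ → ℕ) → D, FD J0 f ∧ ιM c = UP.mk V f := by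
    intro c
    have : ιM c ∈ Set.range ιM := ⟨c, rfl⟩
    rw [hrM] at this
    obtain ⟨f, hf, h⟩ := this
    exact ⟨f, hf, h.symm⟩
  haveI : Nonempty CB := 
    ⟨(ptB (fun _ => Classical.arbitrary D) ⟨∅, by simp, fun _ _ _ => rfl⟩).choose⟩
  haveI : Nonempty CM := 
    ⟨(ptM (fun _ => Classical.arbitrary D) ⟨∅, by simp, fun _ _ _ => rfl⟩).choose⟩
  obtain ⟨sB, hsB⟩ := iter_aut hV hιB hrB (h := sh 1) (h' := sh (-1)) ((sh_mono 1).strictMonoOn _) (by simp) (by simp)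
    (sh_sh 1)
  obtain ⟨sM, hsM⟩ := iter_aut hV hιM hrM (h := sh 1) (h' := sh (-1)) ((sh_mono 1).strictMonoOn _) (sh_J0 _) (sh_J0 _)
    (sh_sh 1)
  obtain ⟨B, hB⟩ : ∃ B : AM.{u, v, w} T, B = AM.of CB ((hιB.model T).2 hP) sB := ⟨_, rfl⟩
  obtain ⟨M, hM⟩ : ∃ B : AM.{u, v, w} T, B = AM.of CM ((hιM.model T).2 hP) sM := ⟨_, rfl⟩
  obtain ⟨jB, hjB, hjBs, hjBp⟩ : ∃ ι : B → UP V D, IsElem L ι ∧ (∀ (c : B) f, FD Set.univ f → ι c = UP.mk V f →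
      ι (B.σ c) = UP.mk V (pull (sh 1) f)) ∧ ∀ f : (JJ → ℕ) → D, FD Set.univ f → ∃ c, ι c = UP.mk V f := by
    subst hB; exact ⟨ιB, hιB, hsB, ptB⟩
  obtain ⟨jM, hjM, hjMs, hjMp, hjMr⟩ : ∃ ι : M → UP V D, IsElem L ι ∧ (∀ (c : M) f, FD J0 f → ι c = UP.mk V f →
      ι (M.σ c) = UP.mk V (pull (sh 1) f)) ∧ (∀ f : (JJ → ℕ) → D, FD J0 f → ∃ c, ι c = UP.mk V f) ∧
      ∀ c, ∃ f : (JJ → ℕ) → D, FD J0 f ∧ ι c = UP.mk V f := by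
    subst hM; exact ⟨ιM, hιM, hsM, ptM, rep⟩
  clear hM hB hrM hrB hιM hιB hsM hsB ptB ptM rep
  clear sM sB ιM ιB
  choose! pt hpt using hjBp
  choose ptM hptM using hjMp
  choose rp hrp1 hrp2 using hjMr
  have fdu : ∀ {J' : Set JJ} {f : (JJ → ℕ) → D}, FD J' f → FD Set.univ f := by
    rintro J' f ⟨s, _, hs⟩
    exact ⟨s, by simp, hs⟩
  have fdp : ∀ {J' : Set JJ} {f : (JJ → ℕ) → D} (g : JJ → JJ), FD J' f → FD Set.univ (pull g f) := by
    intro J' f g hf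
    exact hf.pull (by simp)
  obtain ⟨K, κ, hK, hκ⟩ := h.ext B
  -- inclusion of M in B
  have inc : IsHom (fun c : M => pt (rp c)) := by
    have e : ∀ c, jB (pt (rp c)) = jM c := fun c => by rw [hpt _ (fdu (hrp1 c)), hrp2]
    refine ⟨IsElem.of_comp hjB ?_, ?_⟩
    · convert hjM using 1
      funext c; exact e c
    · intro c
      apply hjB.inj
      rw [e, hjBs _ _ (fdu (hrp1 c)) (hpt _ (fdu (hrp1 c))), hjMs c _ (hrp1 c) (hrp2 c)]
  let VV : Ultrafilter (ULift.{w} ℕ) := U.map ULift.up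
  have hVV : ∀ P : ℕ → Prop, (∀ᶠ n in Filter.atTop, P n) → ∀ᶠ n : ULift.{w} ℕ in VV, P n.down := by
    intro P hP
    change ∀ᶠ n : ULift.{w} ℕ in (Filter.map ULift.up (U : Filter ℕ)), P n.down
    rw [Filter.eventually_map]
    exact hP.filter_mono Nat.hyperfilter_le_atTop
  let F : M → K.up VV := fun c => K.mk' VV fun n => κ (pt (pull (hn n.down) (rp c)))
  -- transfer along hn
  have tr : ∀ {p : ℕ} (φ : L.Formula (Fin p)) (f : Fin p → (JJ → ℕ) → D), (∀ i, FD J0 (f i)) →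
      ∀ᶠ n : ULift.{w} ℕ in VV, (φ.Realize (fun i => pt (pull (hn n.down) (f i))) ↔ φ.Realize (fun i => UP.mk V (f i))) := by
    intro p φ f hf
    obtain ⟨s, hs, hd⟩ := FD.fin hf
    apply hVV (fun n => φ.Realize (fun i => pt (pull (hn n) (f i))) ↔ φ.Realize (fun i => UP.mk V (f i)))
    filter_upwards [hn_mono s hs] with n hn'
    rw [pull_fin hV φ f s hd _ hn', ← hjB.formula']
    simp only [hpt _ (fdp (hn n) (hf _))]
  have tr2 : ∀ (f g : (JJ → ℕ) → D), FD J0 f → FD J0 g → UP.mk V f = UP.mk V g → ∀ᶠ n : ULift.{w} ℕ in VV,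
      pt (pull (hn n.down) f) = pt (pull (hn n.down) g) := by
    intro f g hf hg hfg
    filter_upwards [tr (Term.equal (Term.var 0) (Term.var 1) : L.Formula (Fin 2)) ![f, g] (by
      intro i; fin_cases i; exacts [hf, hg])] with n hn'
    simpa [Formula.realize_equal, hfg] using hn'
  have hF : IsHom F := by
    constructor
    · intro p φ z
      refine (K.los VV φ (fun a n => κ (pt (pull (hn n.down) (rp (z a)))))).trans ?_
      have e : (∀ᶠ n : ULift.{w} ℕ in VV, (φ.Realize (fun a => κ (pt (pull (hn n.down) (rp (z a))))) ↔ φ.Realize z)) := by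
        filter_upwards [tr φ (fun a => rp (z a)) (fun a => hrp1 _)] with n hn'
        rw [hκ.elem.formula', hn', ← hjM.formula']
        simp only [hrp2]
      rw [Filter.eventually_congr e]
      simp
    · intro c
      change K.mk' VV _ = (K.up VV).σ (K.mk' VV _)
      rw [K.up_sigma, K.mk'_eq]
      filter_upwards [tr2 (rp (M.σ c)) (pull (sh 1) (rp c)) (hrp1 _) ((hrp1 c).pull (sh_J0 1)) (by
        rw [← hrp2, hjMs c _ (hrp1 c) (hrp2 c)])] with n hn'
      rw [hn', ← hκ.comm]
      congr 1
      apply hjB.inj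
      rw [hjBs _ _ (fdp (hn n.down) (hrp1 c)) (hpt _ (fdp (hn n.down) (hrp1 c))), 
        hpt _ (((hrp1 c).pull (sh_J0 1)).pull (by simp))]
      congr 1
      funext a
      simp only [pull]
      congr 1
      funext j
      simp [hn_sh]
  -- points
  let X : JJ → Fin m → (JJ → ℕ) → D := fun j i a => x (a j) i
  let Y : JJ → Fin n → (JJ → ℕ) → D := fun j i a => y (a j) i
  have hX : ∀ j i (J' : Set JJ), j ∈ J' → FD J' (X j i) := by
    intro j i J' hj
    refine ⟨{j}, by simpa using hj, ?_⟩
    intro a b hab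
    simp only [X, hab j (by simp)]
  have hY : ∀ j i (J' : Set JJ), j ∈ J' → FD J' (Y j i) := by
    intro j i J' hj
    refine ⟨{j}, by simpa using hj, ?_⟩
    intro a b hab
    simp only [Y, hab j (by simp)]
  let lo : JJ := toLex (0, 0)
  let mi : JJ := toLex (1, 0)
  let hi : JJ := toLex (2, 0)
  have hlo : lo ∈ J0 := by simp [lo, J0]
  have hhi : hi ∈ J0 := by simp [hi, J0]
  have hlm : lo < mi := by rw [Prod.Lex.lt_iff]; simp [lo, mi]
  have hmh : mi < hi := by rw [Prod.Lex.lt_iff]; simp [hi, mi]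
  have chi : ∀ u v, χ.Realize (Sum.elim (fun i => UP.mk V (X u i)) (fun i => UP.mk V (Y v i))) ↔
      ∀ᶠ a : JJ → ℕ in V, χ.Realize (Sum.elim (x (a u)) (y (a v))) := by
    intro u v
    have := UP.los (U := V) χ (Sum.elim (X u) (Y v))
    rw [show (fun a => UP.mk V (Sum.elim (X u) (Y v) a)) = Sum.elim (fun i => UP.mk V (X u i)) (fun i => UP.mk V (Y v i)) by
      funext i; rcases i with i | i <;> rfl] at this
    rw [this]
    apply iff_of_eq; congr 1; funext a; congr 1; funext i; rcases i with i | i <;> rfl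
  obtain ⟨Ψ, hΨ⟩ := fixFormula.{u, v, w} (T := T) χ
  let pY : JJ → Fin n → B := fun j i => pt (Y j i)
  have hjpY : ∀ j i, jB (pY j i) = UP.mk V (Y j i) := fun j i => hpt _ (hY j i _ (by simp))
  let yl : Fin n → M := fun i => ptM (Y lo i) (hY lo i _ hlo)
  let yh : Fin n → M := fun i => ptM (Y hi i) (hY hi i _ hhi)
  have key := h.same hF (hκ.comp inc) (by
      have := ((K.diag_elem VV).model Tmc).1 hK
      exact this) hK (Ψ.relabel (Sum.elim yh yl))
  rw [Formula.realize_relabel, Formula.realize_relabel] at key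
  have e2 : ∀ {E : AM.{u, v, w} T} (g : M → E), g ∘ Sum.elim yh yl = Sum.elim (fun i => g (yh i)) (fun i => g (yl i)) := by
    intro E g; funext i; rcases i with i | i <;> rfl
  rw [e2, e2, hΨ, hΨ] at key
  have pure1 : ∃ z : Fin m → K, (∀ i, K.σ (z i) = z i) ∧
      χ.Realize (Sum.elim z (fun i => κ (pt (rp (yh i))))) ∧ ¬ χ.Realize (Sum.elim z (fun i => κ (pt (rp (yl i))))) := by
    have j1 : ∀ i, jB (pt (rp (yh i))) = UP.mk V (Y hi i) := by
      intro i; rw [hpt _ (fdu (hrp1 _)), ← hrp2, hptM]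
    have j2 : ∀ i, jB (pt (rp (yl i))) = UP.mk V (Y lo i) := by
      intro i; rw [hpt _ (fdu (hrp1 _)), ← hrp2, hptM]
    have j3 : ∀ i, jB (pt (X mi i)) = UP.mk V (X mi i) := fun i => hpt _ (hX mi i _ (by simp))
    have j4 : ∀ (v : JJ) (z : Fin n → B), (∀ i, jB (z i) = UP.mk V (Y v i)) → 
        (χ.Realize (Sum.elim (fun i => κ (pt (X mi i))) fun i => κ (z i)) ↔ 
        ∀ᶠ a : JJ → ℕ in V, χ.Realize (Sum.elim (x (a mi)) (y (a v)))) := by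
      intro v z hz
      rw [← chi, ← funext j3, ← funext hz]
      have e : ∀ {E : Type w} (g : B → E), Sum.elim (fun i => g (pt (X mi i))) (fun i => g (z i)) =
          g ∘ (Sum.elim (fun i => pt (X mi i)) z) := by
        intro E g; funext i; rcases i with i | i <;> rfl
      rw [e, e, hκ.elem.formula, hjB.formula]
    refine ⟨fun i => κ (pt (X mi i)), ?_, ?_, ?_⟩
    · intro i
      rw [← hκ.comm]
      congr 1
      apply hjB.inj
      rw [hjBs _ _ (hX mi i _ (by simp)) (j3 i), j3]
      congr 1
    · rw [j4 hi _ j1]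
      filter_upwards [hlt _ _ hmh] with a ha
      exact (hl _ _ ha).1
    · rw [j4 lo _ j2, ← Ultrafilter.eventually_not]
      filter_upwards [hlt _ _ hlm] with a ha
      exact (hl _ _ ha).2
  obtain ⟨z, hz1, hz2, hz3⟩ := key.2 pure1
  -- contradiction
  obtain ⟨z, rfl⟩ : ∃ z' : Fin m → ULift.{w} ℕ → K, z = fun i => K.mk' VV (z' i) := by
    choose z' hz' using fun i => K.up_surj VV (z i)
    exact ⟨z', funext fun i => (hz' i).symm⟩
  have e3 : ∀ w : Fin n → M, Sum.elim (fun i => K.mk' VV (z i)) (fun i => F (w i)) =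
      fun i => K.mk' VV (Sum.elim z (fun i n => κ (pt (pull (hn n.down) (rp (w i))))) i) := by
    intro w; funext i; rcases i with i | i <;> rfl
  rw [e3, K.los] at hz2 hz3
  rw [← Ultrafilter.eventually_not] at hz3
  simp only [K.up_sigma, K.mk'_eq] at hz1
  rw [← Filter.eventually_all] at hz1
  have hl' : ∀ᶠ n : ULift.{w} ℕ in VV, ∀ i, pt (pull (hn n.down) (rp (yl i))) = pY lo i := by
    rw [Filter.eventually_all]
    intro i
    filter_upwards [tr2 (rp (yl i)) (Y lo i) (hrp1 _) (hY _ _ _ hlo) (by rw [← hrp2, hptM])] with n hn'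
    rw [hn']
    congr 1
  have hh' : ∀ᶠ n : ULift.{w} ℕ in VV, ∀ i, pt (pull (hn n.down) (rp (yh i))) = pY (sh n.down lo) i := by
    rw [Filter.eventually_all]
    intro i
    filter_upwards [tr2 (rp (yh i)) (Y hi i) (hrp1 _) (hY _ _ _ hhi) (by rw [← hrp2, hptM])] with n hn'
    rw [hn']
    rfl
  obtain ⟨k, ⟨⟨⟨h1, h2⟩, h3⟩, h4⟩, h5⟩ := ((((hz2.and hz3).and hz1).and hl').and hh').exists
  have e5 : ∀ w : Fin n → M, (fun a => Sum.elim z (fun i n => κ (pt (pull (hn n.down) (rp (w i))))) a k) = 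
      Sum.elim (fun i => z i k) (fun i => κ (pt (pull (hn k.down) (rp (w i))))) := by
    intro w; funext i; rcases i with i | i <;> rfl
  rw [e5] at h1 h2
  simp only [h4, h5] at h1 h2
  have shf : ∀ q : ℕ, χ.Realize (Sum.elim (fun i => z i k) fun i => κ (pY (sh q lo) i)) ↔ 
    χ.Realize (Sum.elim (fun i => z i k) fun i => κ (pY lo i)) := by
    intro q
    induction q with
    | zero => 
      apply iff_of_eq; rfl
    | succ q ih =>
      rw [← ih]
      refine Iff.trans ?_ ((IsElem.of_equiv K.σ).formula χ
        (Sum.elim (fun i => z i k) fun i => κ (pY (sh q lo) i)))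
      apply iff_of_eq; congr 1
      funext i
      rcases i with i | i
      · simp [h3]
      · simp only [Function.comp, Sum.elim_inr]
        rw [← hκ.comm]
        congr 1
        apply hjB.inj
        rw [hjBs _ _ (hY _ i _ (by simp)) (hjpY _ i), hjpY]
        congr 1
  exact h2 ((shf _).1 h1)

end ShelahE34
end FirstOrder

namespace FirstOrder
set_option linter.all false
open Language Structure
universe u v w u' v' w'
namespace ShelahE34
variable {L : Language.{u, v}} {T : L.Theory} {Tmc : (LPlus L).Theory}

section TreeComb
variable {Y Z : Type*} (c : Y → Z → Prop)

/-- binary trees -/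
def Tre : ℕ → Set Z → Set Y → Prop
  | 0, P, _ => P.Nonempty
  | h+1, P, B => ∃ b ∈ B, Tre h {z | z ∈ P ∧ c b z} B ∧ Tre h {z | z ∈ P ∧ ¬ c b z} B

variable {c}

theorem Tre.mono {h : ℕ} {P P' : Set Z} {B B' : Set Y} (ht : Tre c h P B) (hP : P ⊆ P') (hB : B ⊆ B') :
    Tre c h P' B' := by
  induction h generalizing P P' with
  | zero => exact Set.Nonempty.mono hP ht
  | succ h ih =>
    obtain ⟨b, hb, h1, h2⟩ := ht
    exact ⟨b, hB hb, ih h1 (fun z hz => ⟨hP hz.1, hz.2⟩), ih h2 (fun z hz => ⟨hP hz.1, hz.2⟩)⟩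

theorem Tre.nonempty {h : ℕ} {P : Set Z} {B : Set Y} (ht : Tre c h P B) : P.Nonempty := by
  induction h generalizing P with
  | zero => exact ht
  | succ h ih =>
    obtain ⟨b, hb, h1, h2⟩ := ht
    exact (ih h1).mono (fun z hz => hz.1)

theorem Tre.le {h h' : ℕ} (hh : h ≤ h') {P : Set Z} {B : Set Y} (ht : Tre c h' P B) : Tre c h P B := by
  induction h generalizing P h' with
  | zero => exact ht.nonempty
  | succ h ih =>
    obtain ⟨h', rfl⟩ : ∃ k, h' = k + 1 := ⟨h' - 1, by omega⟩
    obtain ⟨b, hb, h1, h2⟩ := ht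
    exact ⟨b, hb, ih (by omega) h1, ih (by omega) h2⟩

theorem Tre.color {n h1 h2 : ℕ} (hn : h1 + h2 ≤ n) {P : Set Z} {B1 B2 : Set Y} (ht : Tre c n P (B1 ∪ B2)) :
    Tre c h1 P B1 ∨ Tre c h2 P B2 := by
  induction n generalizing h1 h2 P with
  | zero =>
    left
    have : h1 = 0 := by omega
    subst this
    exact ht
  | succ n ih =>
    rcases h1 with _ | h1
    · left; exact ht.nonempty
    rcases h2 with _ | h2
    · right; exact ht.nonempty
    obtain ⟨b, hb, t1, t2⟩ := ht
    rcases hb with hb | hb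
    · rcases ih (h1 := h1) (h2 := h2+1) (by omega) t1 with r1 | r1
      · rcases ih (h1 := h1) (h2 := h2+1) (by omega) t2 with r2 | r2
        · left; exact ⟨b, hb, r1, r2⟩
        · right; exact r2.mono (fun z hz => hz.1) le_rfl
      · right; exact r1.mono (fun z hz => hz.1) le_rfl
    · rcases ih (h1 := h1+1) (h2 := h2) (by omega) t1 with r1 | r1
      · left; exact r1.mono (fun z hz => hz.1) le_rfl
      · rcases ih (h1 := h1+1) (h2 := h2) (by omega) t2 with r2 | r2
        · left; exact r2.mono (fun z hz => hz.1) le_rfl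
        · right; exact ⟨b, hb, r1, r2⟩

/-- height needed -/
def hgt : ℕ → ℕ
  | 0 => 0
  | n+1 => 2 * (hgt n + 1)

theorem Tre.ladder [Nonempty Y] (n : ℕ) {P : Set Z} {B : Set Y} (ht : Tre c (hgt n) P B) :
    ∃ (b : ℕ → Y) (d : ℕ → Z) (e : ℕ → Prop), (∀ i < n, b i ∈ B ∧ d i ∈ P) ∧
      ∀ i j, i < j → j < n → (c (b j) (d i) ↔ e i) ∧ (c (b i) (d j) ↔ ¬ e i) := by
  induction n generalizing P B with
  | zero =>
    obtain ⟨z, hz⟩ := ht.nonempty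
    exact ⟨fun _ => Classical.arbitrary Y, fun _ => z, fun _ => True, by simp, by simp⟩
  | succ n ih =>
    obtain ⟨d, hd⟩ := ht.nonempty
    have : ∃ ε : Prop, Tre c (hgt n + 1) P {b | b ∈ B ∧ (c b d ↔ ε)} := by
      have h2 : B = {b | b ∈ B ∧ c b d} ∪ {b | b ∈ B ∧ ¬ c b d} := by
        ext b; simp; tauto
      rw [h2] at ht
      rcases Tre.color (h1 := hgt n + 1) (h2 := hgt n + 1) (by simp [hgt]; omega) ht with h | h
      · refine ⟨True, ?_⟩; simpa using h
      · refine ⟨False, ?_⟩; simpa using h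
    obtain ⟨ε, b, ⟨hb, hbd⟩, t1, t2⟩ := this
    have : Tre c (hgt n) {z | z ∈ P ∧ (c b z ↔ ¬ ε)} {b | b ∈ B ∧ (c b d ↔ ε)} := by
      by_cases hε : ε
      · simpa [hε] using t2
      · simpa [hε] using t1
    obtain ⟨b', d', e', h1, h2⟩ := ih this
    refine ⟨fun i => Nat.casesOn i b b', fun i => Nat.casesOn i d d', fun i => Nat.casesOn i ε e', ?_, ?_⟩
    · rintro (_ | i) hi
      · exact ⟨hb, hd⟩
      · exact ⟨(h1 i (by omega)).1.1, (h1 i (by omega)).2.1⟩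
    · rintro (_ | i) (_ | j) hij hj
      · omega
      · exact ⟨(h1 j (by omega)).1.2, (h1 j (by omega)).2.2⟩
      · omega
      · exact h2 i j (by omega) (by omega)

end TreeComb

theorem NoLadder.bounded (h : NoLadder.{u, v, w} T) {D : Type w} [L.Structure D] [Nonempty D] (hD : D ⊨ T)
    {m n : ℕ} (χ : L.Formula (Fin m ⊕ Fin n)) :
    ∃ K, ¬ Tre (fun (y : Fin m → D) (z : Fin n → D) => χ.Realize (Sum.elim y z)) K Set.univ Set.univ := by
  by_contra hcon
  push Not at hcon
  have h1 := fun k => Tre.ladder k (hcon (hgt k))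
  choose b d e _ hbd using h1
  let U : Ultrafilter ℕ := Filter.hyperfilter ℕ
  have hU : ∀ j : ℕ, ∀ᶠ k in U, j < k := by
    intro j
    have : (U : Filter ℕ) ≤ Filter.atTop := by
      rw [← Nat.cofinite_eq_atTop]; exact Filter.hyperfilter_le_cofinite
    exact this (Filter.eventually_gt_atTop j)
  let b' : ℕ → Fin m → UP U D := fun i t => UP.mk U fun k => b k i t
  let d' : ℕ → Fin n → UP U D := fun i t => UP.mk U fun k => d k i t
  have los : ∀ i j, χ.Realize (Sum.elim (b' i) (d' j)) ↔ ∀ᶠ k in U, χ.Realize (Sum.elim (b k i) (d k j)) := by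
    intro i j
    have := UP.los (U := U) χ (Sum.elim (fun t k => b k i t) (fun t k => d k j t))
    convert this using 2
    · ext (t | t) <;> rfl
    · ext k; congr! 1; ext (t | t) <;> rfl
  have key : ∀ i j, i < j → (χ.Realize (Sum.elim (b' j) (d' i)) ↔ ∀ᶠ k in U, e k i) ∧
      (χ.Realize (Sum.elim (b' i) (d' j)) ↔ ¬ ∀ᶠ k in U, e k i) := by
    intro i j hij
    constructor
    · rw [los]
      apply Filter.eventually_congr
      filter_upwards [hU j] with k hk
      exact (hbd k i j hij hk).1
    · rw [los, ← Ultrafilter.eventually_not]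
      apply Filter.eventually_congr
      filter_upwards [hU j] with k hk
      exact (hbd k i j hij hk).2
  have hD' : UP U D ⊨ T := (UP.diag_elem.model T).1 hD
  rcases (show ({i | ∀ᶠ k in U, e k i} : Set ℕ).Infinite ∨ ({i | ∀ᶠ k in U, e k i}ᶜ : Set ℕ).Infinite from by
      by_contra hc; rw [not_or, Set.not_infinite, Set.not_infinite] at hc
      exact Set.infinite_univ (by rw [← Set.union_compl_self]; exact hc.1.union hc.2)) with hi | hi
  · let f := Nat.nth (· ∈ {i | ∀ᶠ k in U, e k i})
    have hf : StrictMono f := Nat.nth_strictMono hi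
    have hm : ∀ i, f i ∈ {i | ∀ᶠ k in U, e k i} := fun i => Nat.nth_mem_of_infinite hi i
    apply h (UP U D) hD' m n χ.not (fun i => b' (f i)) (fun i => d' (f i))
    intro i j hij
    have := key _ _ (hf hij)
    have h2 := hm i
    simp only [Formula.realize_not, this.1, this.2]
    exact ⟨not_not.2 h2, not_not.2 h2⟩
  · let f := Nat.nth (· ∈ {i | ∀ᶠ k in U, e k i}ᶜ)
    have hf : StrictMono f := Nat.nth_strictMono hi
    have hm : ∀ i, f i ∈ {i | ∀ᶠ k in U, e k i}ᶜ := fun i => Nat.nth_mem_of_infinite hi i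
    apply h (UP U D) hD' m n χ (fun i => b' (f i)) (fun i => d' (f i))
    intro i j hij
    have := key _ _ (hf hij)
    have h2 := hm i
    simp only [this.1, this.2]
    exact ⟨h2, h2⟩

end ShelahE34
end FirstOrder

namespace FirstOrder
set_option linter.all false
open Language Structure
universe u v w u' v' w'
namespace ShelahE34
variable {L : Language.{u, v}} {T : L.Theory} {Tmc : (LPlus L).Theory}

section UDsec
variable {α : Type u'} {β : Type v'}

/-- uniformly definable predicates -/
def UD (L : Language.{u, v}) {α : Type u'} (Q : ∀ (D : Type w) [L.Structure D], (α → D) → Prop) : Prop :=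
  ∃ ψ : L.Formula α, ∀ (D : Type w) [L.Structure D] (v : α → D), ψ.Realize v ↔ Q D v

theorem UD.form (ψ : L.Formula α) : UD.{u, v, w} L (fun D _ v => ψ.Realize v) := ⟨ψ, fun _ _ _ => Iff.rfl⟩

theorem UD.formc (ψ : L.Formula α) (f : α → β) : UD.{u, v, w} L (fun D _ v => ψ.Realize (fun a => v (f a))) :=
  ⟨ψ.relabel f, fun _ _ _ => by rw [Formula.realize_relabel]; rfl⟩

theorem UD.congr {Q Q' : ∀ (D : Type w) [L.Structure D], (α → D) → Prop} (h : UD.{u, v, w} L Q)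
    (hQ : ∀ (D : Type w) [L.Structure D] (v : α → D), Q D v ↔ Q' D v) : UD.{u, v, w} L Q' := by
  obtain ⟨ψ, hψ⟩ := h
  exact ⟨ψ, fun D _ v => (hψ D v).trans (hQ D v)⟩

theorem UD.and {Q Q' : ∀ (D : Type w) [L.Structure D], (α → D) → Prop} (h : UD.{u, v, w} L Q)
    (h' : UD.{u, v, w} L Q') : UD.{u, v, w} L (fun D _ v => Q D v ∧ Q' D v) := by
  obtain ⟨ψ, hψ⟩ := h
  obtain ⟨ψ', hψ'⟩ := h'
  exact ⟨ψ ⊓ ψ', fun D _ v => by rw [Formula.realize_inf, hψ, hψ']⟩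

theorem UD.not {Q : ∀ (D : Type w) [L.Structure D], (α → D) → Prop} (h : UD.{u, v, w} L Q) :
    UD.{u, v, w} L (fun D _ v => ¬ Q D v) := by
  obtain ⟨ψ, hψ⟩ := h
  exact ⟨ψ.not, fun D _ v => by rw [Formula.realize_not, hψ]⟩

theorem UD.const (P : Prop) : UD.{u, v, w} L (fun D _ (v : α → D) => P) := by
  by_cases hP : P
  · exact ⟨⊤, fun D _ v => by simp [hP, Formula.Realize]⟩
  · exact ⟨⊥, fun D _ v => by simp [hP, Formula.Realize]⟩

theorem UD.imp {Q Q' : ∀ (D : Type w) [L.Structure D], (α → D) → Prop} (h : UD.{u, v, w} L Q)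
    (h' : UD.{u, v, w} L Q') : UD.{u, v, w} L (fun D _ v => Q D v → Q' D v) :=
  (h.and h'.not).not.congr (fun D _ v => by tauto)

theorem UD.iff {Q Q' : ∀ (D : Type w) [L.Structure D], (α → D) → Prop} (h : UD.{u, v, w} L Q)
    (h' : UD.{u, v, w} L Q') : UD.{u, v, w} L (fun D _ v => Q D v ↔ Q' D v) :=
  ((h.imp h').and (h'.imp h)).congr (fun D _ v => by tauto)

theorem UD.all {S : Type*} [Finite S] {Q : S → ∀ (D : Type w) [L.Structure D], (α → D) → Prop}
    (h : ∀ s, UD.{u, v, w} L (Q s)) : UD.{u, v, w} L (fun D _ v => ∀ s, Q s D v) := by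
  choose ψ hψ using h
  refine ⟨Formula.iInf ψ, fun D _ v => ?_⟩
  simp only [← hψ]
  exact BoundedFormula.realize_iInf

theorem UD.any {S : Type*} [Finite S] {Q : S → ∀ (D : Type w) [L.Structure D], (α → D) → Prop}
    (h : ∀ s, UD.{u, v, w} L (Q s)) : UD.{u, v, w} L (fun D _ v => ∃ s, Q s D v) :=
  (UD.all (fun s => (h s).not)).not.congr (fun D _ v => by simp)

theorem UD.ex [Finite β] {Q : ∀ (D : Type w) [L.Structure D], (α ⊕ β → D) → Prop} (h : UD.{u, v, w} L Q) :
    UD.{u, v, w} L (fun D _ v => ∃ b : β → D, Q D (Sum.elim v b)) := by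
  obtain ⟨ψ, hψ⟩ := h
  refine ⟨Formula.iExs β ψ, fun D _ v => ?_⟩
  simp only [← hψ]
  rw [Formula.realize_iExs]

theorem UD.comp {Q : ∀ (D : Type w) [L.Structure D], (α → D) → Prop} (h : UD.{u, v, w} L Q) (f : α → β) :
    UD.{u, v, w} L (fun D _ v => Q D (fun a => v (f a))) := by
  obtain ⟨ψ, hψ⟩ := h
  exact ⟨ψ.relabel f, fun D _ v => by rw [Formula.realize_relabel, hψ]; rfl⟩

/-- uniform definable predicates are elementary -/
theorem UD.elem {Q : ∀ (D : Type w) [L.Structure D], (α → D) → Prop} (h : UD.{u, v, w} L Q)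
    {D E : Type w} [L.Structure D] [L.Structure E] {f : D → E} (hf : IsElem L f) (v : α → D) :
    Q E (fun a => f (v a)) ↔ Q D v := by
  obtain ⟨ψ, hψ⟩ := h
  rw [← hψ, ← hψ, hf.formula']

end UDsec

/-- the relation of a formula -/
def rl {m n : ℕ} (χ : L.Formula (Fin m ⊕ Fin n)) (D : Type*) [L.Structure D] (y : Fin m → D) (z : Fin n → D) : Prop :=
  χ.Realize (Sum.elim y z)

theorem sumElim_eq {α β D : Type*} (v : α ⊕ β → D) : Sum.elim (fun a => v (.inl a)) (fun a => v (.inr a)) = v := by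
  ext (a | a) <;> rfl

theorem UD.tre {m n : ℕ} (χ : L.Formula (Fin m ⊕ Fin n)) (h : ℕ) :
    ∀ {α : Type} {Q : ∀ (D : Type w) [L.Structure D], (α ⊕ Fin n → D) → Prop},
      UD.{u, v, w} L Q → 
      UD.{u, v, w} L (fun D _ v => Tre (rl χ D) h {z | Q D (Sum.elim v z)} Set.univ) := by
  induction h with
  | zero => 
    intro α Q hQ
    exact hQ.ex
  | succ h ih =>
    intro α Q hQ
    have hχ : UD.{u, v, w} L (fun D _ (v : (α ⊕ Fin m) ⊕ Fin n → D) => rl χ D (fun i => v (.inl (.inr i))) (fun i => v (.inr i))) :=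
      (UD.formc χ (Sum.map Sum.inr id)).congr (fun D _ v => by
        unfold rl; congr! 1; ext (i | i) <;> rfl)
    have hQ' := hQ.comp (Sum.map Sum.inl id : α ⊕ Fin n → (α ⊕ Fin m) ⊕ Fin n)
    have := ((ih (hQ'.and hχ)).and (ih (hQ'.and hχ.not))).ex
    refine this.congr (fun D _ v => ?_)
    have e : ∀ (b : Fin m → D) (z : Fin n → D), (fun a => (Sum.elim (Sum.elim v b) z : _ → D) (Sum.map Sum.inl id a)) = Sum.elim v z := by
      intro b z; ext (i | i) <;> rfl
    simp only [e, Sum.elim_inl, Sum.elim_inr, Tre, Set.mem_univ, true_and, Set.mem_setOf_eq]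

/-- stability data -/
structure Stab (T : L.Theory) : Prop where
  nl : NoLadder.{u, v, w} T
  eqv : ∀ (M N : Type w) [L.Structure M] [L.Structure N] [Nonempty M] [Nonempty N],
    M ⊨ T → N ⊨ T → ∀ φ : L.Sentence, M ⊨ φ ↔ N ⊨ φ

theorem Stab.bounded (h : Stab.{u, v, w} T) {m n : ℕ} (χ : L.Formula (Fin m ⊕ Fin n)) :
    ∃ K, ∀ (D : Type w) [L.Structure D] [Nonempty D], D ⊨ T → ¬ Tre (rl χ D) K Set.univ Set.univ := by
  by_cases hD : ∃ (D : Type w) (_ : L.Structure D) (_ : Nonempty D), D ⊨ T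
  · obtain ⟨D, sD, nD, hD⟩ := hD
    obtain ⟨K, hK⟩ := h.nl.bounded hD χ
    refine ⟨K, fun E _ _ hE h1 => hK ?_⟩
    obtain ⟨ψ, hψ⟩ := UD.tre.{u, v, w} χ K (α := Empty) (UD.const.{u, v, w} (L := L) (α := Empty ⊕ Fin n) True)
    have h2 := (hψ E default).2 (by simpa using h1)
    have h3 : D ⊨ (ψ : L.Sentence) := (h.eqv D E hD hE ψ).2 h2
    have h4 := (hψ D default).1 h3
    simp only [Set.setOf_true] at h4; exact h4
  · exact ⟨0, fun D _ i2 h1 => (hD ⟨D, _, i2, h1⟩).elim⟩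

theorem tre_min {Y Z : Type*} (c : Y → Z → Prop) (K : ℕ) (hK : ¬ Tre c K Set.univ Set.univ) (X : Set Y) (hX : X.Nonempty) (d : Z) :
    ∃ r < K, ∃ x : Fin K → Y, (∀ i, x i ∈ X) ∧ ∀ y ∈ X, c y d ↔
      Tre c r {z | (∀ i : Fin K, i.1 + r < K - 1 → (c (x i) z ↔ c (x i) d)) ∧ c y z} Set.univ := by
  classical
  obtain ⟨x0, hx0⟩ := hX
  let P : ℕ → (ℕ → Y) → Set Z := fun j x => {z | ∀ i < j, (c (x i) z ↔ c (x i) d)}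
  by_contra hcon
  have key : ∀ j ≤ K, ∃ x : ℕ → Y, (∀ i, x i ∈ X) ∧ ¬ Tre c (K - j) (P j x) Set.univ := by
    intro j hj
    induction j with
    | zero => exact ⟨fun _ => x0, fun _ => hx0, by simpa [P] using hK⟩
    | succ j ih =>
      obtain ⟨x, hx, h1⟩ := ih (by omega)
      by_cases h2 : ∀ y ∈ X, Tre c (K - (j+1)) (P j x ∩ {z | c y z ↔ c y d}) Set.univ
      · exfalso
        apply hcon
        refine ⟨K - (j+1), by omega, fun i => x i, fun i => hx i, fun y hy => ?_⟩
        have e : {z | (∀ i : Fin K, i.1 + (K - (j+1)) < K - 1 → (c (x i) z ↔ c (x i) d)) ∧ c y z} = P j x ∩ {z | c y z} := by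
          ext z
          simp only [P, Set.mem_inter_iff, Set.mem_setOf_eq]
          refine and_congr ⟨fun h i hi => h ⟨i, by omega⟩ (by simp; omega), fun h i hi => h i (by omega)⟩ Iff.rfl
        rw [e]
        constructor
        · intro hc
          simpa [hc] using h2 y hy
        · intro ht
          by_contra hc
          have h3 := h2 y hy
          apply h1
          have : K - j = K - (j+1) + 1 := by omega
          rw [this]
          refine ⟨y, trivial, ht, ?_⟩
          simp only [hc, iff_false] at h3; exact h3
      · push Not at h2
        obtain ⟨y, hy, h2⟩ := h2
        refine ⟨Function.update x j y, ?_, ?_⟩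
        · intro i
          by_cases hi : i = j
          · subst hi; simpa using hy
          · simpa [hi] using hx i
        · intro ht
          apply h2
          refine ht.mono ?_ le_rfl
          intro z hz
          refine ⟨fun i hi => ?_, ?_⟩
          · have := hz i (by omega)
            rwa [Function.update_of_ne (by omega)] at this
          · have := hz j (by omega)
            rwa [Function.update_self] at this
  obtain ⟨x, hx, h1⟩ := key K le_rfl
  apply h1
  rw [Nat.sub_self]
  exact ⟨d, fun i hi => Iff.rfl⟩

/-- definability of types over sets -/
theorem Stab.defset (h : Stab.{u, v, w} T) {m n : ℕ} (χ : L.Formula (Fin m ⊕ Fin n)) :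
    ∃ (K : ℕ) (S : Type) (_ : Finite S) (δ : S → L.Formula (Fin m ⊕ (Fin K × Fin m))),
      ∀ (D : Type w) [L.Structure D] [Nonempty D], D ⊨ T → ∀ (X : Set (Fin m → D)), X.Nonempty → ∀ d : Fin n → D,
      ∃ s, ∃ x : Fin K → Fin m → D, (∀ i, x i ∈ X) ∧ 
        ∀ y ∈ X, χ.Realize (Sum.elim y d) ↔ (δ s).Realize (Sum.elim y (fun i => x i.1 i.2)) := by
  obtain ⟨K, hK⟩ := h.bounded χ
  have hδ : ∀ s : Fin K × (Fin K → Bool), ∃ δ : L.Formula (Fin m ⊕ (Fin K × Fin m)), ∀ (D : Type w) [L.Structure D] 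
      (v : Fin m ⊕ (Fin K × Fin m) → D), δ.Realize v ↔ 
        Tre (rl χ D) s.1 {z | (∀ i : Fin K, i.1 + s.1 < K - 1 → (rl χ D (fun t => v (.inr (i, t))) z ↔ s.2 i = true)) ∧ 
          rl χ D (fun t => v (.inl t)) z} Set.univ := by
    rintro ⟨r, s⟩
    have h1 : ∀ i : Fin K, UD.{u, v, w} L (fun D _ (v : (Fin m ⊕ (Fin K × Fin m)) ⊕ Fin n → D) => 
        rl χ D (fun t => v (.inl (.inr (i, t)))) (fun t => v (.inr t))) := fun i => 
      (UD.formc χ (Sum.map (fun t => Sum.inr (i, t)) id)).congr (fun D _ v => by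
        unfold rl; congr! 1; ext (i | i) <;> rfl)
    have h2 : UD.{u, v, w} L (fun D _ (v : (Fin m ⊕ (Fin K × Fin m)) ⊕ Fin n → D) => 
        rl χ D (fun t => v (.inl (.inl t))) (fun t => v (.inr t))) := 
      (UD.formc χ (Sum.map (fun t => Sum.inl t) id)).congr (fun D _ v => by
        unfold rl; congr! 1; ext (i | i) <;> rfl)
    exact UD.tre.{u, v, w} χ r ((UD.all (fun i => (UD.const _).imp ((h1 i).iff (UD.const (s i = true))))).and h2)
  choose δ hδ using hδ
  refine ⟨K, _, inferInstance, δ, fun D _ _ hD X hX d => ?_⟩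
  obtain ⟨r, hr, x, hx, hy⟩ := tre_min (rl χ D) K (hK D hD) X hX d
  classical
  refine ⟨(⟨r, hr⟩, fun i => decide (rl χ D (x i) d)), x, hx, fun y hyX => ?_⟩
  rw [hδ]
  refine (hy y hyX).trans ?_
  simp only [Sum.elim_inl, Sum.elim_inr, decide_eq_true_eq]

end ShelahE34
end FirstOrder

namespace FirstOrder
set_option linter.all false
open Language Structure
universe u v w u' v' w'
namespace ShelahE34
variable {L : Language.{u, v}} {T : L.Theory} {Tmc : (LPlus L).Theory}

section FSsec
variable {D : Type w} [L.Structure D]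

/-- the type of `A` over `B ∪ N` is finitely satisfiable in `N` -/
def FS (L : Language.{u, v}) {D : Type w} [L.Structure D] (A B N : Set D) : Prop :=
  ∀ (p q : ℕ) (φ : L.Formula (Fin p ⊕ Fin q)) (a : Fin p → D) (b : Fin q → D),
    (∀ i, a i ∈ A) → (∀ i, b i ∈ B ∪ N) → φ.Realize (Sum.elim a b) →
      ∃ a' : Fin p → D, (∀ i, a' i ∈ N) ∧ φ.Realize (Sum.elim a' b)

/-- elementary subsets -/
def ElS (L : Language.{u, v}) {D : Type w} [L.Structure D] (N : Set D) : Prop :=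
  ∀ (p q : ℕ) (φ : L.Formula (Fin p ⊕ Fin q)) (a : Fin p → D) (b : Fin q → D),
    (∀ i, b i ∈ N) → φ.Realize (Sum.elim a b) →
      ∃ a' : Fin p → D, (∀ i, a' i ∈ N) ∧ φ.Realize (Sum.elim a' b)

theorem FS.formula {A B N : Set D} (h : FS L A B N) (hN : N.Nonempty) {X : Type u'} {Y : Type v'} (φ : L.Formula (X ⊕ Y))
    (a : X → D) (b : Y → D) (ha : ∀ i, a i ∈ A) (hb : ∀ i, b i ∈ B ∪ N) (hφ : φ.Realize (Sum.elim a b)) :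
    ∃ a' : X → D, (∀ i, a' i ∈ N) ∧ φ.Realize (Sum.elim a' b) := by
  classical
  obtain ⟨p, q, f, g, ψ, hf, hg, hψ⟩ := finvars.{u, v, w} φ
  obtain ⟨a', ha', h1⟩ := h p q ψ (a ∘ f) (b ∘ g) (fun i => ha _) (fun i => hb _) ((hψ D _ _).1 hφ)
  obtain ⟨n, hn⟩ := hN
  refine ⟨Function.extend f a' (fun _ => n), ?_, ?_⟩
  · intro i
    by_cases hi : ∃ j, f j = i
    · obtain ⟨j, rfl⟩ := hi
      rw [hf.extend_apply]; exact ha' j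
    · rw [Function.extend_apply' _ _ _ hi]; exact hn
  · rw [hψ, Function.extend_comp hf]; exact h1

theorem ElS.iff_FS {N : Set D} : ElS L N ↔ FS L Set.univ N N := by
  unfold ElS FS; simp

theorem ElS.formula {N : Set D} (h : ElS L N) (hN : N.Nonempty) {X : Type u'} {Y : Type v'} (φ : L.Formula (X ⊕ Y))
    (a : X → D) (b : Y → D) (hb : ∀ i, b i ∈ N) (hφ : φ.Realize (Sum.elim a b)) :
    ∃ a' : X → D, (∀ i, a' i ∈ N) ∧ φ.Realize (Sum.elim a' b) := 
  (ElS.iff_FS.1 h).formula hN φ a b (fun _ => trivial) (fun i => Or.inl (hb i)) hφ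

theorem FS.ud {A B N : Set D} (h : FS L A B N) (hN : N.Nonempty) {X : Type u'} {Y : Type v'} 
    {Q : ∀ (D : Type w) [L.Structure D], (X ⊕ Y → D) → Prop} (hQ : UD.{u, v, w} L Q)
    (a : X → D) (b : Y → D) (ha : ∀ i, a i ∈ A) (hb : ∀ i, b i ∈ B ∪ N) (hφ : Q D (Sum.elim a b)) :
    ∃ a' : X → D, (∀ i, a' i ∈ N) ∧ Q D (Sum.elim a' b) := by
  obtain ⟨ψ, hψ⟩ := hQ
  simp only [← hψ] at hφ ⊢
  exact h.formula hN ψ a b ha hb hφ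

theorem ElS.ud {N : Set D} (h : ElS L N) (hN : N.Nonempty) {X : Type u'} {Y : Type v'} 
    {Q : ∀ (D : Type w) [L.Structure D], (X ⊕ Y → D) → Prop} (hQ : UD.{u, v, w} L Q)
    (a : X → D) (b : Y → D) (hb : ∀ i, b i ∈ N) (hφ : Q D (Sum.elim a b)) :
    ∃ a' : X → D, (∀ i, a' i ∈ N) ∧ Q D (Sum.elim a' b) := 
  (ElS.iff_FS.1 h).ud hN hQ a b (fun _ => trivial) (fun i => Or.inl (hb i)) hφ

theorem ElS.range {M : Type w} [L.Structure M] [Nonempty M] {f : M → D} (hf : IsElem L f) : ElS L (Set.range f) := by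
  intro p q φ a b hb hφ
  choose b' hb' using hb
  obtain rfl : (fun i => f (b' i)) = b := funext hb'
  obtain ⟨x', hx'⟩ := transfer (L := L) (M := D) (M' := M) (y := fun i => f (b' i)) (y' := b') (fun ψ hψ => (hf.formula' ψ b').1 hψ) φ a hφ
  refine ⟨fun i => f (x' i), fun i => ⟨_, rfl⟩, ?_⟩
  rw [← hf.formula] at hx'
  convert hx' using 1
  ext (i | i) <;> rfl

theorem FS.mono {A B N A' B' : Set D} (h : FS L A B N) (hA : A' ⊆ A) (hB : B' ⊆ B) : FS L A' B' N :=
  fun p q φ a b ha hb hφ => h p q φ a b (fun i => hA (ha i)) (fun i => (hb i).imp (fun h => hB h) id) hφ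

/-- add `N` to the left -/
theorem FS.left {A B N : Set D} (h : FS L A B N) : FS L (A ∪ N) B N := by
  classical
  intro p q φ a b ha hb hφ
  by_cases hN : N.Nonempty
  swap
  · rw [Set.not_nonempty_iff_eq_empty] at hN
    subst hN
    exact h p q φ a b (fun i => by simpa using ha i) hb hφ
  let ψ : L.Formula ({i // a i ∈ A} ⊕ (Fin q ⊕ {i // a i ∈ N})) := 
    φ.relabel (Sum.elim (fun i => if h : a i ∈ A then Sum.inl ⟨i, h⟩ else Sum.inr (Sum.inr ⟨i, (ha i).resolve_left h⟩))
      (fun i => Sum.inr (Sum.inl i)))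
  obtain ⟨a', ha', h1⟩ := h.formula hN ψ (fun i => a i) (Sum.elim b (fun i => a i)) (fun i => i.2) (by
    rintro (i | i)
    · exact hb i
    · exact Or.inr i.2) (by
      rw [Formula.realize_relabel]
      convert hφ using 1
      ext (i | i)
      · by_cases h : a i ∈ A <;> simp [h]
      · simp)
  refine ⟨fun i => if h : a i ∈ A then a' ⟨i, h⟩ else a i, ?_, ?_⟩
  · intro i
    by_cases h : a i ∈ A
    · simpa [h] using ha' _
    · simpa [h] using (ha i).resolve_left h
  · rw [Formula.realize_relabel] at h1
    convert h1 using 1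
    ext (i | i)
    · by_cases h : a i ∈ A <;> simp [h]
    · simp

theorem FS.uf {A B N : Set D} (h : FS L A B N) (hN : N.Nonempty) {X : Type u'} {Y : Type v'} (a : X → D) (b : Y → D)
    (ha : ∀ i, a i ∈ A ∪ N) (hb : ∀ i, b i ∈ B ∪ N) :
    ∃ U : Ultrafilter (X → N), ∀ φ : L.Formula (X ⊕ Y), φ.Realize (Sum.elim a b) → 
      ∀ᶠ g in (U : Filter (X → N)), φ.Realize (Sum.elim (fun i => (g i : D)) b) := by
  refine exists_uf_formula (L := L) (Sum.elim a b) (I := X → N) (fun g φ => φ.Realize (Sum.elim (fun i => (g i : D)) b)) ?_ ?_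
  · intro i φ ψ h; exact Formula.realize_inf.1 h
  · intro φ hφ
    obtain ⟨a', ha', h1⟩ := h.left.formula hN φ a b ha hb hφ
    exact ⟨fun i => ⟨a' i, ha' i⟩, h1⟩

theorem NoLadder.symm (hl : NoLadder.{u, v, w} T) [Nonempty D] (hD : D ⊨ T) {A B N : Set D} (hN : ElS L N) (hN0 : N.Nonempty)
    (h : FS L A B N) : FS L B A N := by
  classical
  intro p q φ b a hb ha hφ
  by_contra hcon
  push Not at hcon
  have hL := h.left
  obtain ⟨f, hf, hr⟩ := exists_seq_of_forall_finset_exists (α := (Fin p → D) × (Fin q → D))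
    (fun x => (∀ i, x.1 i ∈ N) ∧ (∀ i, x.2 i ∈ N) ∧ φ.Realize (Sum.elim b x.2))
    (fun x y => ¬ φ.Realize (Sum.elim x.1 y.2) ∧ φ.Realize (Sum.elim y.1 x.2)) (by
      intro s hs
      -- choose n'
      have u1 : UD.{u, v, w} L (fun D _ (v : Fin q ⊕ (Fin p ⊕ (s × Fin p)) → D) =>
          φ.Realize (Sum.elim (fun i => v (.inr (.inl i))) (fun i => v (.inl i))) ∧ 
          ∀ x : s, ¬ φ.Realize (Sum.elim (fun i => v (.inr (.inr (x, i)))) (fun i => v (.inl i)))) := by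
        refine UD.and ?_ (UD.all fun x => UD.not ?_)
        · refine (UD.formc φ (Sum.elim (fun i => Sum.inr (.inl i)) (fun i => .inl i))).congr (fun D _ v => ?_)
          congr! 1; ext (i | i) <;> rfl
        · refine (UD.formc φ (Sum.elim (fun i => Sum.inr (.inr (x, i))) (fun i => .inl i))).congr (fun D _ v => ?_)
          congr! 1; ext (i | i) <;> rfl
      obtain ⟨n', hn', h1, h2⟩ := hL.ud hN0 u1 a (Sum.elim b (fun x => x.1.1.1 x.2)) ha (by
        rintro (i | ⟨x, i⟩)
        · exact Or.inl (hb i)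
        · exact Or.inr ((hs x.1 x.2).1 i)) ⟨hφ, fun x => hcon _ (hs x.1 x.2).1⟩
      have u2 : UD.{u, v, w} L (fun D _ (v : Fin p ⊕ (s × Fin q) → D) =>
          ∀ x : s, φ.Realize (Sum.elim (fun i => v (.inl i)) (fun i => v (.inr (x, i))))) := by
        refine UD.all fun x => ?_
        refine (UD.formc φ (Sum.elim (fun i => .inl i) (fun i => .inr (x, i)))).congr (fun D _ v => ?_)
        congr! 1; ext (i | i) <;> rfl
      obtain ⟨m', hm', h3⟩ := hN.ud hN0 u2 b (fun x => x.1.1.2 x.2) (by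
        rintro ⟨x, i⟩
        exact (hs x.1 x.2).2.1 i) (fun x => (hs x.1 x.2).2.2)
      exact ⟨(m', n'), ⟨hm', hn', h1⟩, fun x hx => ⟨h2 ⟨x, hx⟩, h3 ⟨x, hx⟩⟩⟩)
  apply hl D hD p q φ.not (fun i => (f i).1) (fun i => (f i).2)
  intro i j hij
  have := hr i j hij
  exact ⟨this.1, fun h => h this.2⟩

end FSsec

end ShelahE34
end FirstOrder

namespace FirstOrder
set_option linter.all false
open Language Structure
universe u v w u' v' w'
namespace ShelahE34
variable {L : Language.{u, v}} {T : L.Theory} {Tmc : (LPlus L).Theory}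

theorem Tre.of_ladder {Y Z : Type*} {c : Y → Z → Prop} (K : ℕ) (s : ℕ) (b : ℕ → Y) (z : ℕ → Z)
    (h : ∀ i j, i < s + 2^K → j < s + 2^K → (c (b i) (z j) ↔ i ≤ j)) :
    Tre c K {x | ∃ j, s ≤ j ∧ j < s + 2^K ∧ x = z j} Set.univ := by
  induction K generalizing s with
  | zero => exact ⟨z s, s, le_rfl, by simp, rfl⟩
  | succ K ih =>
    have e : 2^(K+1) = 2^K + 2^K := by ring
    have hp : 0 < 2^K := Nat.pow_pos (by norm_num)
    refine ⟨b (s + 2^K), trivial, ?_, ?_⟩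
    · refine (ih (s + 2^K) (fun i j hi hj => h i j (by omega) (by omega))).mono ?_ le_rfl
      rintro x ⟨j, h1, h2, rfl⟩
      exact ⟨⟨j, by omega, by omega, rfl⟩, (h _ _ (by omega) (by omega)).2 h1⟩
    · refine (ih s (fun i j hi hj => h i j (by omega) (by omega))).mono ?_ le_rfl
      rintro x ⟨j, h1, h2, rfl⟩
      exact ⟨⟨j, by omega, by omega, rfl⟩, fun h3 => by
        have := (h _ _ (by omega) (by omega)).1 h3
        omega⟩

theorem Stab.finladder (h : Stab.{u, v, w} T) {m n : ℕ} (χ : L.Formula (Fin m ⊕ Fin n)) :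
    ∃ K : ℕ, ∀ (D : Type w) [L.Structure D] [Nonempty D], D ⊨ T → ∀ (b : ℕ → Fin m → D) (z : ℕ → Fin n → D),
      ¬ ∀ i j, i < K → j < K → (χ.Realize (Sum.elim (b i) (z j)) ↔ i ≤ j) := by
  obtain ⟨K, hK⟩ := h.bounded χ
  refine ⟨2^K, fun D _ _ hD b z h1 => hK D hD ?_⟩
  exact (Tre.of_ladder (c := rl χ D) K 0 b z (fun i j hi hj => h1 i j (by omega) (by omega))).mono (fun _ _ => trivial) le_rfl

section Divide
variable {Y Z : Type*} (c : Z → Y → Prop) (U : Ultrafilter Y)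

/-- iterated consistency -/
def Con : ℕ → List Y → Prop
  | 0, l => ∃ z, ∀ y ∈ l, c z y
  | k+1, l => ∀ᶠ y in U, Con k (y :: l)

variable {c U}

theorem Con.ladder (F : Set Z) (hF : ∀ z ∈ F, ∀ᶠ y in U, ¬ c z y) (G : Set Y) (hG : ∀ᶠ y in U, y ∈ G)
    (hel : ∀ l : List Y, (∀ y ∈ l, y ∈ G) → (∃ z, ∀ y ∈ l, c z y) → ∃ z ∈ F, ∀ y ∈ l, c z y)
    (n : ℕ) : ∀ (k : ℕ) (l : List Y), (∀ y ∈ l, y ∈ G) → Con c U (k + n) l →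
      ∀ (s : Finset Z), (∀ z ∈ s, z ∈ F) → 
      ∃ (b : ℕ → Y) (z : ℕ → Z), ∀ j < n, (∀ y ∈ l, c (z j) y) ∧ (∀ z ∈ s, ¬ c z (b j)) ∧ ∀ i < n, (c (z j) (b i) ↔ i ≤ j) := by
  induction n with
  | zero => 
    intro k l hl hc s hs
    obtain ⟨y, hy⟩ := hG.exists
    obtain ⟨z, hz, -⟩ := hel [] (by simp) (by
      by_contra hcon
      have : ∀ k l, ¬ Con c U k l := by
        intro k
        induction k with
        | zero => rintro l ⟨z, hz⟩; exact hcon ⟨z, by simp⟩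
        | succ k ih => intro l hl; obtain ⟨y, hy⟩ := Filter.Eventually.exists hl; exact ih _ hy
      exact this _ _ hc)
    exact ⟨fun _ => y, fun _ => z, by simp⟩
  | succ n ih =>
    intro k l hl hc s hs
    have h1 : ∀ᶠ y in U, Con c U (k + n) (y :: l) := hc
    have h2 : ∀ᶠ y in U, ∀ z ∈ s, ¬ c z y := (Filter.eventually_all_finset s).2 (fun z hz => hF z (hs z hz))
    obtain ⟨y, ⟨hy1, hy2⟩, hyG⟩ := ((h1.and h2).and hG).exists
    have hl' : ∀ y' ∈ y :: l, y' ∈ G := by simpa using ⟨hyG, hl⟩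
    have hcon : ∀ (k) (l : List Y), Con c U k l → ∃ z, ∀ y ∈ l, c z y := by
      intro k
      induction k with
      | zero => intro l h; exact h
      | succ k ih => 
        intro l hl; obtain ⟨y, hy⟩ := Filter.Eventually.exists hl
        obtain ⟨z, hz⟩ := ih _ hy
        exact ⟨z, fun y hy => hz y (by simp [hy])⟩
    obtain ⟨z, hz, hzl⟩ := hel _ hl' (hcon _ _ hy1)
    classical
    obtain ⟨b', z', h3⟩ := ih k (y :: l) hl' hy1 (insert z s) (by
      intro z' hz'
      rcases Finset.mem_insert.1 hz' with rfl | h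
      · exact hz
      · exact hs _ h)
    refine ⟨fun i => Nat.casesOn i y b', fun i => Nat.casesOn i z z', ?_⟩
    rintro (_ | j) hj
    · refine ⟨fun y' hy' => hzl y' (by simp [hy']), hy2, ?_⟩
      rintro (_ | i) hi
      · simpa using hzl y (by simp)
      · simpa using (h3 i (by omega)).2.1 z (by simp)
    · obtain ⟨a1, a2, a3⟩ := h3 j (by omega)
      refine ⟨fun y' hy' => a1 y' (by simp [hy']), fun z hz => a2 z (by simp [hz]), ?_⟩
      rintro (_ | i) hi
      · simpa using a1 y (by simp)
      · simpa using a3 i (by omega)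

theorem Con.seq {k : ℕ} (hk : ¬ Con c U k []) {R : Y → Prop} (hR : ∀ᶠ y in U, R y) (w : ℕ) :
    ∃ l : List Y, l.length = w ∧ (∀ y ∈ l, R y) ∧ ∀ l', List.Sublist l' l → l'.length ≤ k → ¬ Con c U (k - l'.length) l' := by
  induction w with
  | zero => exact ⟨[], rfl, by simp, by
      intro l' hl' _
      obtain rfl : l' = [] := List.sublist_nil.1 hl'
      exact hk⟩
  | succ w ih =>
    obtain ⟨l, h1, h2, h3⟩ := ih
    have h4 : ∀ᶠ y in U, ∀ l' ∈ {l' | List.Sublist l' l}, l'.length + 1 ≤ k → ¬ Con c U (k - (l'.length + 1)) (y :: l') := by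
      have fin : {l' | List.Sublist l' l}.Finite := by
        have : {l' | List.Sublist l' l} = {l' | l' ∈ l.sublists} := by ext; simp
        rw [this]; exact List.finite_toSet _
      rw [Filter.eventually_all_finite fin]
      intro l' hl'
      by_cases hk' : l'.length + 1 ≤ k
      · have := h3 l' hl' (by omega)
        rw [show k - l'.length = k - (l'.length + 1) + 1 by omega] at this
        have := Ultrafilter.eventually_not.2 this
        filter_upwards [this] with y hy _ using hy
      · simp [hk']
    obtain ⟨y, hy1, hy2⟩ := (h4.and hR).exists
    refine ⟨y :: l, by simp [h1], by simpa using ⟨hy2, h2⟩, ?_⟩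
    intro l' hl' hlen
    rcases List.sublist_cons_iff.1 hl' with h | ⟨l'', rfl, h⟩
    · exact h3 l' h hlen
    · exact hy1 l'' h (by simpa using hlen)

end Divide

/-- `k`-inconsistency of families -/
def Inc {Y Z : Type*} (c : Z → Y → Prop) (k : ℕ) {w : ℕ} (b : Fin w → Y) : Prop :=
  ∀ s : Finset (Fin w), s.card = k → ¬ ∃ z, ∀ t ∈ s, c z (b t)

theorem Inc.mono {Y Z : Type*} {c : Z → Y → Prop} {k k' : ℕ} (hk : k ≤ k') {w : ℕ} {b : Fin w → Y} (h : Inc c k b) :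
    Inc c k' b := by
  intro s hs ⟨z, hz⟩
  obtain ⟨s', hs', hc⟩ := Finset.exists_subset_card_eq (s := s) (n := k) (by omega)
  exact h s' hc ⟨z, fun t ht => hz t (hs' ht)⟩

theorem Con.inc {Y Z : Type*} {c : Z → Y → Prop} {U : Ultrafilter Y} {k : ℕ} (hk : ¬ Con c U k []) {R : Y → Prop} (hR : ∀ᶠ y in U, R y) (w : ℕ) :
    ∃ b : Fin w → Y, (∀ t, R (b t)) ∧ Inc c k b := by
  obtain ⟨l, rfl, h2, h3⟩ := Con.seq hk hR w
  refine ⟨fun t => l.get t, fun t => h2 _ (List.get_mem _ _), ?_⟩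
  rintro s hs ⟨z, hz⟩
  have hsub : List.Sublist ((s.sort (· ≤ ·)).map (fun t => l.get t)) l := by
    have := List.map_getElem_sublist (l := l) (is := s.sort (· ≤ ·)) (by
      exact (Finset.sortedLT_sort s).pairwise)
    simpa using this
  have := h3 _ hsub (by simp [hs])
  apply this
  simp only [List.length_map, Finset.length_sort, hs, Nat.sub_self]
  refine ⟨z, fun y hy => ?_⟩
  simp only [List.mem_map, Finset.mem_sort] at hy
  obtain ⟨t, ht, rfl⟩ := hy
  exact hz t ht

theorem Stab.div (h : Stab.{u, v, w} T) {D : Type w} [L.Structure D] [Nonempty D] (hD : D ⊨ T) {F : Set D} (hF : ElS L F) (hF0 : F.Nonempty)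
    {p q : ℕ} (χ : L.Formula (Fin p ⊕ Fin q)) (b : Fin q → D) 
    (hb : ∀ z : Fin p → D, (∀ i, z i ∈ F) → ¬ χ.Realize (Sum.elim z b)) :
    ∃ k, ∀ {Y : Type u'} (ρ : L.Formula (Fin q ⊕ Y)) (e : Y → D), (∀ i, e i ∈ F) → ρ.Realize (Sum.elim b e) →
      ∀ w : ℕ, ∃ b' : Fin w → Fin q → D, (∀ t, (ρ.Realize (Sum.elim (b' t) e))) ∧ Inc (rl χ D) k b' := by
  obtain ⟨U, hU⟩ := (ElS.iff_FS.1 hF).uf hF0 b (fun x : F => (x : D)) (fun _ => Or.inl trivial) (fun i => Or.inl i.2)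
  let U' : Ultrafilter (Fin q → D) := U.map (fun g i => (g i : D))
  have hU' : ∀ {Y : Type u'} (ρ : L.Formula (Fin q ⊕ Y)) (e : Y → D), (∀ i, e i ∈ F) → ρ.Realize (Sum.elim b e) →
      ∀ᶠ y in U', ρ.Realize (Sum.elim y e) := by
    intro Y ρ e he hρ
    have := hU (ρ.relabel (Sum.map id (fun i => ⟨e i, he i⟩))) (by
      rw [Formula.realize_relabel]; convert hρ using 1; ext (i | i) <;> rfl)
    simp only [U', Ultrafilter.coe_map, Filter.eventually_map]
    filter_upwards [this] with g hg
    rw [Formula.realize_relabel] at hg; convert hg using 1; ext (i | i) <;> rfl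
  have hG : ∀ᶠ y in U', y ∈ {y : Fin q → D | ∀ i, y i ∈ F} := by
    simp only [U', Ultrafilter.coe_map, Filter.eventually_map]
    exact Filter.Eventually.of_forall (fun g i => (g i).2)
  have : ∃ k, ¬ Con (rl χ D) U' k [] := by
    by_contra hcon
    push Not at hcon
    obtain ⟨K, hK⟩ := h.finladder (χ.relabel Sum.swap : L.Formula (Fin q ⊕ Fin p))
    obtain ⟨b', z', h1⟩ := Con.ladder {z : Fin p → D | ∀ i, z i ∈ F} (c := rl χ D) (U := U') (by
      intro z hz
      have := hU (χ.not.relabel (Sum.elim (fun i => Sum.inr ⟨z i, hz i⟩) Sum.inl)) (by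
        rw [Formula.realize_relabel, Formula.realize_not]
        have := hb z hz
        convert this using 2; ext (i | i) <;> rfl)
      simp only [U', Ultrafilter.coe_map, Filter.eventually_map]
      filter_upwards [this] with g hg
      rw [Formula.realize_relabel, Formula.realize_not] at hg; convert hg using 2; 
      unfold rl
      congr! 1
      ext (i | i) <;> rfl) _ hG (by
      rintro l hl ⟨z, hz⟩
      have u2 : UD.{u, v, w} L (fun D _ (v : Fin p ⊕ (Fin l.length × Fin q) → D) =>
          ∀ x : Fin l.length, χ.Realize (Sum.elim (fun i => v (.inl i)) (fun i => v (.inr (x, i))))) := by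
        refine UD.all fun x => ?_
        refine (UD.formc χ (Sum.elim (fun i => .inl i) (fun i => .inr (x, i)))).congr (fun D _ v => ?_)
        congr! 1; ext (i | i) <;> rfl
      obtain ⟨z', hz', h3⟩ := hF.ud hF0 u2 z (fun x => l.get x.1 x.2) (by
        rintro ⟨x, i⟩
        exact hl _ (List.get_mem _ _) _) (fun x => hz _ (List.get_mem _ _))
      refine ⟨z', hz', fun y hy => ?_⟩
      obtain ⟨x, rfl⟩ := List.get_of_mem hy
      exact h3 x) K 0 [] (by simp) (hcon _) ∅ (by simp)
    refine hK D hD b' z' (fun i j hi hj => ?_)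
    have := (h1 j hj).2.2 i hi
    rw [← this, Formula.realize_relabel]
    unfold rl
    congr! 1
    ext (i | i) <;> rfl
  obtain ⟨k, hk⟩ := this
  exact ⟨k, fun ρ e he hρ w => Con.inc hk (hU' ρ e he hρ) w⟩

end ShelahE34
end FirstOrder

namespace FirstOrder
set_option linter.all false
open Language Structure
universe u v w u' v' w'
namespace ShelahE34
variable {L : Language.{u, v}} {T : L.Theory} {Tmc : (LPlus L).Theory}

section TrComb
variable {ι : Type*} {Z : Type*} {Y : ι → Type*} (c : ∀ i, Z → Y i → Prop) (k w : ℕ)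

/-- dividing trees with labels -/
def Tr (I : Set ι) : ℕ → Set Z → Prop
  | 0, P => P.Nonempty
  | n+1, P => ∃ i ∈ I, ∃ b : Fin w → Y i, Inc (c i) k b ∧ ∀ t, Tr I n {z | z ∈ P ∧ c i z (b t)}

variable {c k w}

theorem Inc.comp {Y Z : Type*} {c : Z → Y → Prop} {k : ℕ} {w w' : ℕ} {b : Fin w → Y} (h : Inc c k b)
    (f : Fin w' → Fin w) (hf : Function.Injective f) : Inc c k (fun t => b (f t)) := by
  classical
  rintro s hs ⟨z, hz⟩
  refine h (s.image f) (by rw [Finset.card_image_of_injective _ hf, hs]) ⟨z, ?_⟩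
  intro t ht
  obtain ⟨t, ht', rfl⟩ := Finset.mem_image.1 ht
  exact hz t ht'

theorem Tr.mono {I : Set ι} {n : ℕ} {P P' : Set Z} (h : Tr c k w I n P) (hP : P ⊆ P') : Tr c k w I n P' := by
  induction n generalizing P P' with
  | zero => exact Set.Nonempty.mono hP h
  | succ n ih =>
    obtain ⟨i, hi, b, hb, ht⟩ := h
    exact ⟨i, hi, b, hb, fun t => ih (ht t) (fun z hz => ⟨hP hz.1, hz.2⟩)⟩

theorem Tr.wle {I : Set ι} {n : ℕ} {P : Set Z} {w' : ℕ} (hw : w' ≤ w) (h : Tr c k w I n P) : Tr c k w' I n P := by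
  induction n generalizing P with
  | zero => exact h
  | succ n ih =>
    obtain ⟨i, hi, b, hb, ht⟩ := h
    exact ⟨i, hi, fun t => b (Fin.castLE hw t), hb.comp _ (Fin.castLE_injective hw), fun t => ih (ht _)⟩

theorem Tr.nonempty {I : Set ι} {n : ℕ} {P : Set Z} (hw : 0 < w) (h : Tr c k w I n P) : P.Nonempty := by
  induction n generalizing P with
  | zero => exact h
  | succ n ih =>
    obtain ⟨i, hi, b, hb, ht⟩ := h
    exact (ih (ht ⟨0, hw⟩)).mono (fun z hz => hz.1)

theorem Tr.nle {I : Set ι} {n n' : ℕ} {P : Set Z} (hw : 0 < w) (hn : n' ≤ n) (h : Tr c k w I n P) : Tr c k w I n' P := by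
  induction n generalizing P n' with
  | zero => obtain rfl : n' = 0 := by omega
            exact h
  | succ n ih =>
    rcases n' with _ | n'
    · exact h.nonempty hw
    obtain ⟨i, hi, b, hb, ht⟩ := h
    exact ⟨i, hi, b, hb, fun t => ih (by omega) (ht t)⟩

theorem Tr.color {I J : Set ι} {n h1 h2 : ℕ} (hw : 0 < w) (hn : h1 + h2 ≤ n) {P : Set Z} (ht : Tr c k w (I ∪ J) n P) :
    Tr c k w I h1 P ∨ Tr c k w J h2 P := by
  induction n generalizing h1 h2 P with
  | zero =>
    left
    have : h1 = 0 := by omega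
    subst this
    exact ht
  | succ n ih =>
    rcases h1 with _ | h1
    · left; exact ht.nonempty hw
    rcases h2 with _ | h2
    · right; exact ht.nonempty hw
    obtain ⟨i, hi, b, hb, ht⟩ := ht
    rcases hi with hi | hi
    · by_cases hc : ∃ t, Tr c k w J (h2+1) {z | z ∈ P ∧ c i z (b t)}
      · obtain ⟨t, hc⟩ := hc
        right; exact hc.mono (fun z hz => hz.1)
      · left
        exact ⟨i, hi, b, hb, fun t => (ih (h1 := h1) (h2 := h2+1) (by omega) (ht t)).resolve_right (fun h => hc ⟨t, h⟩)⟩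
    · by_cases hc : ∃ t, Tr c k w I (h1+1) {z | z ∈ P ∧ c i z (b t)}
      · obtain ⟨t, hc⟩ := hc
        left; exact hc.mono (fun z hz => hz.1)
      · right
        exact ⟨i, hi, b, hb, fun t => (ih (h1 := h1+1) (h2 := h2) (by omega) (ht t)).resolve_left (fun h => hc ⟨t, h⟩)⟩

theorem exists_single {I : Set ι} (hI : I.Finite) {P : Set Z} (h : ∀ n w, Tr c k w I n P) :
    ∃ i, ∀ n w, Tr c k w {i} n P := by
  induction I, hI using Set.Finite.induction_on with
  | empty =>
    obtain ⟨i, hi, _⟩ := h 1 0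
    exact hi.elim
  | @insert i I _ _ ih =>
    by_cases h1 : ∀ n w, Tr c k w I n P
    · exact ih h1
    · refine ⟨i, ?_⟩
      push Not at h1
      obtain ⟨n, w, hn⟩ := h1
      intro n' w'
      have h2 := h (n + n') (max (max w w') 1)
      rw [Set.insert_eq, Set.union_comm] at h2
      have hp : 0 < (max (max w w') 1) := by positivity
      rcases Tr.color hp le_rfl h2 with h3 | h3
      · exact (hn (h3.wle (by simp))).elim
      · exact h3.wle (by simp)

theorem Tr.union {I : Set ι} {n : ℕ} {P Q : Set Z} (ht : Tr c k (2 * w) I n (P ∪ Q)) :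
    Tr c k w I n P ∨ Tr c k w I n Q := by
  classical
  induction n generalizing P Q with
  | zero =>
    obtain ⟨z, hz | hz⟩ := ht
    · left; exact ⟨z, hz⟩
    · right; exact ⟨z, hz⟩
  | succ n ih =>
    obtain ⟨i, hi, b, hb, ht⟩ := ht
    have h1 : ∀ t, Tr c k w I n {z | z ∈ P ∧ c i z (b t)} ∨ Tr c k w I n {z | z ∈ Q ∧ c i z (b t)} := by
      intro t
      apply ih
      refine (ht t).mono ?_
      rintro z ⟨hz | hz, h2⟩
      · exact Or.inl ⟨hz, h2⟩
      · exact Or.inr ⟨hz, h2⟩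
    let A := Finset.univ.filter (fun t : Fin (2*w) => Tr c k w I n {z | z ∈ P ∧ c i z (b t)})
    let B := Finset.univ.filter (fun t : Fin (2*w) => ¬ Tr c k w I n {z | z ∈ P ∧ c i z (b t)})
    have hAB : A.card + B.card = 2 * w := by
      simp only [A, B]
      rw [Finset.card_filter_add_card_filter_not]; simp
    have hsub : ∀ S : Finset (Fin (2*w)), w ≤ S.card → ∃ f : Fin w → Fin (2*w), Function.Injective f ∧ ∀ t, f t ∈ S := by
      intro S hS
      obtain ⟨S', h2, h3⟩ := Finset.exists_subset_card_eq hS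
      exact ⟨fun t => (S'.orderEmbOfFin h3 t), (S'.orderEmbOfFin h3).injective, fun t => h2 (Finset.orderEmbOfFin_mem _ _ _)⟩
    by_cases hA : w ≤ A.card
    · left
      obtain ⟨f, hf, hfA⟩ := hsub A hA
      exact ⟨i, hi, fun t => b (f t), hb.comp f hf, fun t => (Finset.mem_filter.1 (hfA t)).2⟩
    · right
      obtain ⟨f, hf, hfB⟩ := hsub B (by omega)
      exact ⟨i, hi, fun t => b (f t), hb.comp f hf, fun t => (h1 _).resolve_left (Finset.mem_filter.1 (hfB t)).2⟩

theorem exists_union {I : Set ι} {n : ℕ} {κ : Type*} {J : Set κ} (hJ : J.Finite) (P : κ → Set Z)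
    (h : ∀ w, Tr c k w I n {z | ∃ j ∈ J, z ∈ P j}) (h0 : n = 0 → J.Nonempty) :
    ∃ j ∈ J, ∀ w, Tr c k w I n (P j) := by
  classical
  induction J, hJ using Set.Finite.induction_on with
  | empty =>
    obtain ⟨z, hz⟩ := (h 1).nonempty (by norm_num)
    simp at hz
  | @insert j J _ _ ih =>
    by_cases h1 : ∀ w, Tr c k w I n (P j)
    · exact ⟨j, by simp, h1⟩
    · push Not at h1
      obtain ⟨w, hw⟩ := h1
      have h2 : ∀ w', Tr c k w' I n {z | ∃ j ∈ J, z ∈ P j} := by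
        intro w'
        have h3 := (h (2 * (max w w'))).mono (P' := P j ∪ {z | ∃ j ∈ J, z ∈ P j}) (by
          rintro z ⟨j', hj', hz⟩
          rcases hj' with rfl | hj'
          · exact Or.inl hz
          · exact Or.inr ⟨_, hj', hz⟩)
        rcases h3.union with h4 | h4
        · exact (hw (h4.wle (by simp))).elim
        · exact h4.wle (by simp)
      obtain ⟨j', h5, h6⟩ := ih h2 (fun _ => by
        obtain ⟨z, j, hj, _⟩ := (h2 1).nonempty (by norm_num)
        exact ⟨j, hj⟩)
      exact ⟨j', by simp [h5], h6⟩

/-- extraction of the parameters -/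
theorem Tr.params {i : ι} [hY : Nonempty (Y i)] (hw : 0 < w) {n : ℕ} {P : Set Z} (h : Tr c k w {i} n P) :
    ∃ a : List ℕ → Y i, (∀ η : List ℕ, η.length < n → (∀ t ∈ η, t < w) → Inc (c i) k (fun t : Fin w => a (η ++ [t.1]))) ∧
      ∀ η : List ℕ, η.length ≤ n → (∀ t ∈ η, t < w) → ∃ z ∈ P, ∀ θ, θ ≠ [] → θ <+: η → c i z (a θ) := by
  induction n generalizing P with
  | zero =>
    refine ⟨fun _ => Classical.choice hY, by simp, ?_⟩
    intro η hη _
    obtain rfl : η = [] := by simpa using hη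
    obtain ⟨z, hz⟩ := h
    exact ⟨z, hz, fun θ h1 h2 => (h1 (by simpa using h2)).elim⟩
  | succ n ih =>
    obtain ⟨i', hi, b, hb, ht⟩ := h
    obtain rfl : i' = i := hi
    choose a' ha1 ha2 using fun t => ih (ht t)
    refine ⟨fun η => match η with
      | [] => b ⟨0, hw⟩
      | t :: η' => if ht : t < w then (if η' = [] then b ⟨t, ht⟩ else a' ⟨t, ht⟩ η') else b ⟨0, hw⟩, ?_, ?_⟩
    · rintro (_ | ⟨t, η⟩) hη hw'
      · simpa using hb
      · have htw : t < w := hw' t (by simp)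
        have := ha1 ⟨t, htw⟩ η (by simpa using hη) (fun s hs => hw' s (by simp [hs]))
        simpa [htw] using this
    · rintro (_ | ⟨t, η⟩) hη hw'
      · obtain ⟨z, hz, _⟩ := ha2 ⟨0, hw⟩ [] (by simp) (by simp)
        exact ⟨z, hz.1, fun θ h1 h2 => (h1 (by simpa using h2)).elim⟩
      · have htw : t < w := hw' t (by simp)
        obtain ⟨z, hz, h2⟩ := ha2 ⟨t, htw⟩ η (by simpa using hη) (fun s hs => hw' s (by simp [hs]))
        refine ⟨z, hz.1, ?_⟩
        rintro (_ | ⟨s, θ⟩) h3 h4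
        · exact (h3 rfl).elim
        · rw [List.cons_prefix_cons] at h4
          obtain ⟨rfl, h4⟩ := h4
          by_cases hθ : θ = []
          · simpa [htw, hθ] using hz.2
          · simpa [htw, hθ] using h2 θ hθ h4

end TrComb

theorem UD.inc {p q : ℕ} (χ : L.Formula (Fin p ⊕ Fin q)) (k w : ℕ) {α : Type} (f : Fin w × Fin q → α) :
    UD.{u, v, w'} L (fun D _ (v : α → D) => Inc (rl χ D) k (fun (t : Fin w) i => v (f (t, i)))) := by
  refine UD.all (S := Finset (Fin w)) fun s => (UD.const (s.card = k)).imp (UD.not ?_)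
  have h1 : UD.{u, v, w'} L (fun D _ (v : α ⊕ Fin p → D) => ∀ t : Fin w, t ∈ s → rl χ D (fun i => v (.inr i)) (fun i => v (.inl (f (t, i))))) := by
    refine UD.all fun t => (UD.const _).imp ?_
    refine (UD.formc χ (Sum.elim (fun i => .inr i) (fun i => .inl (f (t, i))))).congr (fun D _ v => ?_)
    unfold rl; congr! 1; ext (i | i) <;> rfl
  exact h1.ex

theorem UD.tr {ι : Type*} [Finite ι] {p : ℕ} {q : ι → ℕ} (χ : ∀ i, L.Formula (Fin p ⊕ Fin (q i))) (k w : ℕ) (I : Set ι) (n : ℕ) :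
    ∀ {α : Type} {Q : ∀ (D : Type w') [L.Structure D], (α ⊕ Fin p → D) → Prop},
      UD.{u, v, w'} L Q → 
      UD.{u, v, w'} L (fun D _ v => Tr (fun i => rl (χ i) D) k w I n {z | Q D (Sum.elim v z)}) := by
  induction n with
  | zero => 
    intro α Q hQ
    exact hQ.ex
  | succ n ih =>
    intro α Q hQ
    have h1 : ∀ i, UD.{u, v, w'} L (fun D _ (v : α → D) => i ∈ I ∧ ∃ b : Fin w × Fin (q i) → D, 
        Inc (rl (χ i) D) k (fun t j => b (t, j)) ∧ ∀ t, Tr (fun i => rl (χ i) D) k w I n {z | Q D (Sum.elim v z) ∧ rl (χ i) D z (fun j => b (t, j))}) := by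
      intro i
      refine (UD.const _).and ?_
      have h2 := UD.inc.{u, v, w'} (χ i) k w (α := α ⊕ (Fin w × Fin (q i))) (fun x => .inr x)
      have h3 : ∀ t, UD.{u, v, w'} L (fun D _ (v : α ⊕ (Fin w × Fin (q i)) → D) => 
        Tr (fun i => rl (χ i) D) k w I n {z | Q D (Sum.elim (fun a => v (.inl a)) z) ∧ rl (χ i) D z (fun j => v (.inr (t, j)))}) := by
        intro t
        have h4 := hQ.comp (Sum.map Sum.inl id : α ⊕ Fin p → (α ⊕ (Fin w × Fin (q i))) ⊕ Fin p)
        have h5 : UD.{u, v, w'} L (fun D _ (v : (α ⊕ (Fin w × Fin (q i))) ⊕ Fin p → D) => rl (χ i) D (fun j => v (.inr j)) (fun j => v (.inl (.inr (t, j))))) :=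
          (UD.formc (χ i) (Sum.elim (fun j => .inr j) (fun j => .inl (.inr (t, j))))).congr (fun D _ v => by
            unfold rl; congr! 1; ext (i | i) <;> rfl)
        refine (ih (h4.and h5)).congr (fun D _ v => ?_)
        have e : ∀ (z : Fin p → D), (fun a => (Sum.elim v z : _ → D) (Sum.map Sum.inl id a)) = Sum.elim (fun a => v (.inl a)) z := by
          intro z; ext (i | i) <;> rfl
        simp only [e, Sum.elim_inl, Sum.elim_inr]
      exact (h2.and (UD.all h3)).ex
    refine (UD.any h1).congr (fun D _ v => ?_)
    simp only [Tr, Set.mem_setOf_eq]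
    refine exists_congr fun i => and_congr Iff.rfl ?_
    constructor
    · rintro ⟨b, h1, h2⟩
      exact ⟨fun t j => b (t, j), h1, h2⟩
    · rintro ⟨b, h1, h2⟩
      exact ⟨fun x => b x.1 x.2, h1, h2⟩

theorem tree_property {D : Type w} [L.Structure D] [Nonempty D] (hD : D ⊨ T) {p : ℕ}
    {ι : Type*} {q' : ι → ℕ} (i : ι) (χ' : ∀ i, L.Formula (Fin p ⊕ Fin (q' i))) (k : ℕ) (hk : 2 ≤ k) 
    (h : ∀ n w, Tr (fun i => rl (χ' i) D) k w {i} n Set.univ) : HasTreeProperty.{u, v, w} T := by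
  have h1 := fun n => (h (n+1) (n+1)).params (by omega)
  choose a ha1 ha2 using h1
  let U : Ultrafilter ℕ := Filter.hyperfilter ℕ
  have hU : ∀ j : ℕ, ∀ᶠ k in U, j < k := by
    intro j
    have : (U : Filter ℕ) ≤ Filter.atTop := by
      rw [← Nat.cofinite_eq_atTop]; exact Filter.hyperfilter_le_cofinite
    exact this (Filter.eventually_gt_atTop j)
  have hL : ∀ η : List ℕ, ∀ᶠ n in U, η.length < n ∧ ∀ t ∈ η, t < n := by
    intro η
    refine (hU _).and ?_
    exact (Filter.eventually_all_finite (List.finite_toSet η)).2 (fun t _ => hU t)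
  let b : List ℕ → Fin (q' i) → UP U D := fun η j => UP.mk U fun n => a n η j
  have hD' : UP U D ⊨ T := (UP.diag_elem.model T).1 hD
  have los : ∀ (z : ℕ → Fin p → D) η, (χ' i).Realize (Sum.elim (fun j => UP.mk U fun n => z n j) (b η)) ↔ ∀ᶠ n in U, rl (χ' i) D (z n) (a n η) := by
    intro z η
    have := UP.los (U := U) (χ' i) (Sum.elim (fun t k => z k t) (fun t k => a k η t))
    convert this using 2
    · ext (t | t) <;> rfl
    · unfold rl; ext k; congr! 1; ext (t | t) <;> rfl
  haveI : Nonempty (UP U D) := ⟨UP.diag U (Classical.arbitrary D)⟩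
  refine ⟨p, q' i, χ' i, k, hk, @Theory.ModelType.of _ T (UP U D) _ hD' _, fun η => b (0 :: η), ?_, ?_⟩
  · intro ρ n
    let η := 0 :: (List.range n).map ρ
    have h2 : ∀ N : ℕ, ∃ z : Fin p → D, (η.length < N ∧ ∀ t ∈ η, t < N) → ∀ θ, θ ≠ [] → θ <+: η → rl (χ' i) D z (a N θ) := by
      intro N
      by_cases hN : (η.length < N ∧ ∀ t ∈ η, t < N)
      · obtain ⟨z, _, hz⟩ := ha2 N η (by omega) (fun t ht => by have := hN.2 t ht; omega)
        exact ⟨z, fun _ => hz⟩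
      · exact ⟨fun _ => Classical.arbitrary D, fun h => (hN h).elim⟩
    choose z hz using h2
    refine ⟨UP U D, inferInstance, IsElem.ident.toEmb, fun j => UP.mk U fun n => z n j, ?_⟩
    intro m hm
    refine (los z _).2 ?_
    filter_upwards [hL η] with N hN
    refine hz N hN _ (by simp) ?_
    rw [List.cons_prefix_cons]
    refine ⟨rfl, List.IsPrefix.map ρ ?_⟩
    rw [List.prefix_iff_eq_take]
    simp [List.take_range, hm]
  · intro η N' _ g c s hs h2
    have ud : UD.{u, v, w} L (fun D _ (v : s × Fin (q' i) → D) => ∃ c : Fin p → D, ∀ t : s, rl (χ' i) D c (fun j => v (t, j))) := by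
      refine UD.ex (Q := fun D _ v => ∀ t : s, rl (χ' i) D (fun j => v (.inr j)) (fun j => v (.inl (t, j)))) ?_
      refine UD.all fun t => ?_
      refine (UD.formc (χ' i) (Sum.elim (fun i => .inr i) (fun i => .inl (t, i)))).congr (fun D _ v => ?_)
      unfold rl; congr! 1; ext (i | i) <;> rfl
    have h3 := (ud.elem (IsElem.of_emb g) (fun x => b (0 :: (η ++ [x.1.1])) x.2)).1 ⟨c, fun t => h2 t.1 t.2⟩
    obtain ⟨c, hc⟩ := h3
    obtain ⟨z, hz⟩ : ∃ z : ℕ → Fin p → D, (fun j => UP.mk U fun n => z n j) = c := 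
      ⟨fun n j => (c j).out n, by ext j; exact UP.mk_out _⟩
    rw [← hz] at hc
    have h4 : ∀ᶠ n in U, ∀ t : s, rl (χ' i) D (z n) (a n (0 :: (η ++ [t.1]))) := Filter.eventually_all.2 (fun t => (los z _).1 (hc t))
    have h5 : ∀ᶠ n in U, ∀ t ∈ s, t < n := (Filter.eventually_all_finset s).2 (fun t _ => hU t)
    obtain ⟨n, ⟨h6, h7⟩, h8⟩ := ((h4.and h5).and (hL (0 :: η))).exists
    have := ha1 n (0 :: η) (by omega) (fun t ht => by have := h8.2 t ht; omega)
    refine this (s.attachFin (fun t ht => by have := h7 t ht; omega)) (by simp [hs]) ⟨z n, fun t ht => ?_⟩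
    exact h6 ⟨t.1, by simpa using ht⟩

end ShelahE34
end FirstOrder

namespace FirstOrder
set_option linter.all false
open Language Structure
universe u v w u' v' w'
namespace ShelahE34
variable {L : Language.{u, v}} {T : L.Theory} {Tmc : (LPlus L).Theory}

theorem finvars_family {ι : Type*} [Finite ι] {X : Type*} {Y : ι → Type*} (φ : ∀ i, L.Formula (X ⊕ Y i)) :
    ∃ (p : ℕ) (e : Fin p → X) (q : ι → ℕ) (g : ∀ i, Fin (q i) → Y i) (χ : ∀ i, L.Formula (Fin p ⊕ Fin (q i))),
      Function.Injective e ∧ 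
      ∀ i (M : Type w) [L.Structure M] (x : X → M) (y : Y i → M),
        (φ i).Realize (Sum.elim x y) ↔ (χ i).Realize (Sum.elim (x ∘ e) (y ∘ g i)) := by
  classical
  have h := fun i => finvars.{u, v, w} (φ i)
  choose p q f g ψ hf hg hψ using h
  let V : Set X := ⋃ i, Set.range (f i)
  have hV : V.Finite := Set.finite_iUnion (fun i => Set.finite_range _)
  haveI : Finite V := hV.to_subtype
  obtain ⟨n, ⟨E⟩⟩ := Finite.exists_equiv_fin V
  refine ⟨n, fun i => (E.symm i).1, q, g, fun i => (ψ i).relabel (Sum.map (fun j => E ⟨f i j, Set.mem_iUnion.2 ⟨i, j, rfl⟩⟩) id), ?_, ?_⟩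
  · exact Subtype.val_injective.comp E.symm.injective
  · intro i M _ x y
    rw [hψ, Formula.realize_relabel]
    apply iff_of_eq
    congr 1
    ext (j | j)
    · simp
    · simp

theorem lemmaE (hs : IsSimpleTheory.{u, v, w} T) (st : Stab.{u, v, w} T) {D : Type w} [L.Structure D] [Nonempty D] (hD : D ⊨ T)
    {X : Type w} (f0 : X → D) (A : Set D) {μ : Type*} [Nonempty μ] (F : μ → Set D) (hF : ∀ m, ElS L (F m)) (hF0 : ∀ m, (F m).Nonempty)
    (hA : ∀ m, A ⊆ F m) :
    ∃ 𝔰 : Ultrafilter (X → D), (∀ φ : L.Formula (X ⊕ A), φ.Realize (Sum.elim f0 (fun a => a.1)) → 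
        ∀ᶠ x in 𝔰, φ.Realize (Sum.elim x (fun a => a.1))) ∧
      ∀ ψ : L.Formula (X ⊕ D), (∀ᶠ x in 𝔰, ψ.Realize (Sum.elim x id)) → ∀ m, ∃ x, (∀ i, x i ∈ F m) ∧ ψ.Realize (Sum.elim x id) := by
  classical
  let S : Set (Set (X → D)) := {s | ∃ (φ : L.Formula (X ⊕ A)) (ψ : L.Formula (X ⊕ D)) (m : μ), 
    φ.Realize (Sum.elim f0 (fun a => a.1)) ∧ (∀ x : X → D, (∀ i, x i ∈ F m) → ¬ ψ.Realize (Sum.elim x id)) ∧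
    s = {x | φ.Realize (Sum.elim x (fun a => a.1)) ∧ ¬ ψ.Realize (Sum.elim x id)}}
  have : ∃ U : Ultrafilter (X → D), S ⊆ (U : Filter (X → D)).sets := by
    apply Ultrafilter.exists_ultrafilter_of_finite_inter_nonempty
    intro t ht
    by_contra hcon
    have h1 : ∀ s : t, s.1 ∈ S := fun s => ht s.2
    choose φ ψ m hφ hψ hs' using h1
    let φ0 : L.Formula (X ⊕ A) := Formula.iInf φ
    have hφ0 : φ0.Realize (Sum.elim f0 (fun a => a.1)) := BoundedFormula.realize_iInf.2 hφ
    have hcov : ∀ x : X → D, φ0.Realize (Sum.elim x (fun a => a.1)) → ∃ s, (ψ s).Realize (Sum.elim x id) := by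
      intro x hx
      by_contra h2
      push Not at h2
      apply hcon
      refine ⟨x, ?_⟩
      rw [Set.mem_sInter]
      intro s hst
      have := hs' ⟨s, hst⟩
      simp only at this
      rw [this]
      exact ⟨(BoundedFormula.realize_iInf.1 hx) ⟨s, hst⟩, h2 _⟩
    let Y : Option t → Type w := fun o => match o with | none => A | some _ => D
    let Φ : ∀ o : Option t, L.Formula (X ⊕ Y o) := fun o => match o with | none => φ0 | some s => ψ s
    obtain ⟨p, e, q, g, χ, he, hχ⟩ := finvars_family.{u, v, w} Φ
    have hχ0 := hχ none
    have hχs := fun s => hχ (some s)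
    let α : Fin (q none) → D := fun j => (show A from g none j).1
    let b : ∀ s : t, Fin (q (some s)) → D := fun s => g (some s)
    have hφ' : ∀ x : X → D, φ0.Realize (Sum.elim x (fun a => a.1)) ↔ (χ none).Realize (Sum.elim (x ∘ e) α) := 
      fun x => hχ0 D x (fun a => a.1)
    have hψ' : ∀ s (x : X → D), (ψ s).Realize (Sum.elim x id) ↔ (χ (some s)).Realize (Sum.elim (x ∘ e) (b s)) := 
      fun s x => hχs s D x id
    have hext : ∀ (z : Fin p → D) (d : D), ∃ x : X → D, x ∘ e = z ∧ ∀ G : Set D, d ∈ G → (∀ i, z i ∈ G) → ∀ i, x i ∈ G := by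
      intro z d
      refine ⟨Function.extend e z (fun _ => d), ?_, ?_⟩
      · ext i; simp [he.extend_apply]
      · intro G hd hz i
        by_cases hi : ∃ j, e j = i
        · obtain ⟨j, rfl⟩ := hi
          rw [he.extend_apply]; exact hz j
        · rw [Function.extend_apply' _ _ _ hi]; exact hd
    have hdiv : ∀ s : t, ∃ k, ∀ {Y : Type} (ρ : L.Formula (Fin (q (some s)) ⊕ Y)) (e : Y → D), (∀ i, e i ∈ F (m s)) → ρ.Realize (Sum.elim (b s) e) →
      ∀ w : ℕ, ∃ b' : Fin w → Fin (q (some s)) → D, (∀ t, (ρ.Realize (Sum.elim (b' t) e))) ∧ Inc (rl (χ (some s)) D) k b' := by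
      intro s
      refine st.div hD (hF (m s)) (hF0 (m s)) (χ (some s)) (b s) ?_
      intro z hz h3
      obtain ⟨d, hd⟩ := hF0 (m s)
      obtain ⟨x, hx1, hx2⟩ := hext z d
      refine hψ s x (hx2 _ hd hz) ((hψ' s x).2 ?_)
      rw [hx1]; exact h3
    choose k hk using hdiv
    let k0 := Finset.univ.sup k + 2
    have hk0 : ∀ s, k s ≤ k0 := fun s => (Finset.le_sup (Finset.mem_univ s)).trans (by omega)
    let c : ∀ s : t, (Fin p → D) → (Fin (q (some s)) → D) → Prop := fun s => rl (χ (some s)) D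
    let P : Set (Fin p → D) := {z | (χ none).Realize (Sum.elim z α)}
    have claim : ∀ n w, Tr c k0 w Set.univ n P := by
      intro n
      induction n with
      | zero => intro w; exact ⟨f0 ∘ e, (hφ' f0).1 hφ0⟩
      | succ n ih =>
        have h4 : ∀ w, Tr c k0 w Set.univ n {z | ∃ s ∈ (Set.univ : Set t), z ∈ {z | z ∈ P ∧ c s z (b s)}} := by
          intro w
          refine (ih w).mono ?_
          intro z hz
          obtain ⟨x, hx, -⟩ := hext z (Classical.arbitrary D)
          obtain ⟨s, h5⟩ := hcov x ((hφ' x).2 (by rw [hx]; exact hz))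
          refine ⟨s, trivial, hz, ?_⟩
          have := (hψ' s x).1 h5
          rw [hx] at this; exact this
        obtain ⟨s, -, h5⟩ := exists_union Set.finite_univ _ h4 (fun _ => by
          obtain ⟨z, s, _⟩ := (h4 1).nonempty (by norm_num)
          exact ⟨s, trivial⟩)
        intro w
        have ud : UD.{u, v, w} L (fun D _ (v : Fin (q (some s)) ⊕ Fin (q none) → D) => 
            Tr (fun i : t => rl (χ (some i)) D) k0 w Set.univ n 
              {z | (χ none).Realize (Sum.elim z (fun i => v (.inr i))) ∧ rl (χ (some s)) D z (fun i => v (.inl i))}) := by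
          have u1 : UD.{u, v, w} L (fun D _ (v : (Fin (q (some s)) ⊕ Fin (q none)) ⊕ Fin p → D) => 
             (χ none).Realize (Sum.elim (fun i => v (.inr i)) (fun i => v (.inl (.inr i)))) ∧ rl (χ (some s)) D (fun i => v (.inr i)) (fun i => v (.inl (.inl i)))) := by
            refine UD.and ?_ ?_
            · refine (UD.formc (χ none) (Sum.elim (fun i => .inr i) (fun i => .inl (.inr i)))).congr (fun D _ v => ?_)
              congr! 1; ext (i | i) <;> rfl
            · refine (UD.formc (χ (some s)) (Sum.elim (fun i => .inr i) (fun i => .inl (.inl i)))).congr (fun D _ v => ?_)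
              unfold rl; congr! 1; ext (i | i) <;> rfl
          exact UD.tr.{u, v, w} (fun i : t => χ (some i)) k0 w Set.univ n u1
        obtain ⟨ρ, hρ⟩ := ud
        obtain ⟨b', hb1, hb2⟩ := hk s ρ α (fun j => hA _ (show A from g none j).2) ((hρ D _).2 (h5 w)) w
        refine ⟨s, trivial, b', hb2.mono (hk0 s), fun t => ?_⟩
        exact (hρ D _).1 (hb1 t)
    obtain ⟨s, h6⟩ := exists_single Set.finite_univ (fun n w => (claim n w).mono (Set.subset_univ _))
    exact hs (tree_property hD s (fun s : t => χ (some s)) k0 (by omega) h6)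
  obtain ⟨U, hU⟩ := this
  refine ⟨U, ?_, ?_⟩
  · intro φ hφ
    have : {x : X → D | φ.Realize (Sum.elim x (fun a => a.1)) ∧ ¬ (⊥ : L.Formula (X ⊕ D)).Realize (Sum.elim x id)} ∈ U := 
      hU ⟨φ, ⊥, Classical.arbitrary μ, hφ, fun x _ => by simp [Formula.Realize], rfl⟩
    filter_upwards [this] with x hx using hx.1
  · intro ψ hψ m
    by_contra hcon
    push Not at hcon
    have : {x : X → D | (⊤ : L.Formula (X ⊕ A)).Realize (Sum.elim x (fun a => a.1)) ∧ ¬ ψ.Realize (Sum.elim x id)} ∈ U := 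
      hU ⟨⊤, ψ, m, by simp [Formula.Realize], hcon, rfl⟩
    have h2 : ∀ᶠ x in U, ¬ ψ.Realize (Sum.elim x id) := by
      filter_upwards [this] with x hx using hx.2
    obtain ⟨x, hx⟩ := (hψ.and h2).exists
    exact hx.2 hx.1

end ShelahE34
end FirstOrder

namespace FirstOrder
set_option linter.all false
open Language Structure
universe u v w u' v' w'
namespace ShelahE34
variable {L : Language.{u, v}} {T : L.Theory} {Tmc : (LPlus L).Theory}

theorem rz {α : Type u'} {M : Type v'} [L.Structure M] {φ : L.Formula α} {x y : α → M} (h : φ.Realize x) (e : ∀ a, x a = y a) :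
    φ.Realize y := by
  obtain rfl : x = y := funext e
  exact h

theorem rziff {α : Type u'} {M : Type v'} [L.Structure M] {φ : L.Formula α} {x y : α → M} (e : ∀ a, x a = y a) :
    φ.Realize x ↔ φ.Realize y := by
  obtain rfl : x = y := funext e
  exact Iff.rfl

/-- definability of ultrafilter types -/
theorem Stab.defuf (st : Stab.{u, v, w} T) {D : Type w} [L.Structure D] [Nonempty D] (hD : D ⊨ T) {W : Type w} (U : Ultrafilter W)
    {V : Type u'} {B : Type v'} (y : W → V → D) (ψ : L.Formula (V ⊕ B)) :
    ∃ δ : L.Formula (B ⊕ D), ∀ b : B → D, (∀ᶠ t in U, ψ.Realize (Sum.elim (y t) b)) ↔ δ.Realize (Sum.elim b id) := by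
  obtain ⟨p, q, f, g, χ, hf, hg, hχ⟩ := finvars.{u, v, w} ψ
  obtain ⟨K, S, _, δ, hδ⟩ := st.defset (χ.relabel Sum.swap : L.Formula (Fin q ⊕ Fin p))
  have hD' : UP U D ⊨ T := (UP.diag_elem.model T).1 hD
  haveI : Nonempty (UP U D) := ⟨UP.diag U (Classical.arbitrary D)⟩
  obtain ⟨s, x, hx, h1⟩ := hδ (UP U D) hD' {z | ∃ z' : Fin q → D, z = fun i => UP.diag U (z' i)} 
    ⟨_, fun _ => Classical.arbitrary D, rfl⟩ (fun i => UP.mk U fun t => y t (f i))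
  choose x' hx' using hx
  refine ⟨(δ s).relabel (Sum.elim (fun i => .inl (g i)) (fun i => .inr (x' i.1 i.2))), fun b => ?_⟩
  have h2 := h1 (fun i => UP.diag U (b (g i))) ⟨_, rfl⟩
  rw [Formula.realize_relabel] at h2 ⊢
  have e1 : (∀ᶠ t in U, ψ.Realize (Sum.elim (y t) b)) ↔ 
      χ.Realize (Sum.elim (fun i => UP.diag U (b (g i))) (fun i => UP.mk U fun t => y t (f i)) ∘ Sum.swap) := by
    have := UP.los (U := U) χ (Sum.elim (fun i t => y t (f i)) (fun i t => b (g i)))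
    simp only [hχ]
    rw [show ((Sum.elim (fun i => UP.diag U (b (g i))) (fun i => UP.mk U fun t => y t (f i))) ∘ Sum.swap : Fin p ⊕ Fin q → UP U D) = 
      fun a => UP.mk U (Sum.elim (fun i t => y t (f i)) (fun i t => b (g i)) a) by ext (i | i) <;> rfl]
    rw [this]
    apply Filter.eventually_congr
    filter_upwards with t
    apply iff_of_eq
    congr 1
    ext (i | i) <;> rfl
  rw [e1, h2]
  refine Iff.trans ?_ ((UP.diag_elem (U := U)).formula' _ _)
  apply rziff
  rintro (i | i)
  · rfl
  · simp [hx']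

/-- closed under the automorphism -/
def SC (D : AM.{u, v, w} T) (S : Set D) : Prop := ∀ x, D.σ x ∈ S ↔ x ∈ S

theorem AM.sigma_elem (D : AM.{u, v, w} T) : IsElem L D.σ := IsElem.of_equiv D.σ

theorem SC.image {A B : AM.{u, v, w} T} {f : A → B} (hf : IsHom f) {S : Set A} (hS : SC A S) : SC B (f '' S) := by
  intro x
  constructor
  · rintro ⟨y, hy, h⟩
    refine ⟨A.σ.symm y, ?_, ?_⟩
    · rw [← hS]; simpa using hy
    · apply B.σ.injective
      rw [← hf.comm, ← h]; simp
  · rintro ⟨y, hy, rfl⟩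
    exact ⟨A.σ y, (hS y).2 hy, hf.comm y⟩

theorem FS.image {D E : Type w} [L.Structure D] [L.Structure E] {f : D → E} (hf : IsElem L f) {A B N : Set D} (h : FS L A B N) :
    FS L (f '' A) (f '' B) (f '' N) := by
  intro p q φ a b ha hb hφ
  rw [← Set.image_union] at hb
  choose a' ha' ha2 using ha
  choose b' hb' hb2 using hb
  obtain rfl : (fun i => f (a' i)) = a := funext ha2
  obtain rfl : (fun i => f (b' i)) = b := funext hb2
  have e : ∀ a : Fin p → D, (Sum.elim (fun i => f (a i)) (fun i => f (b' i))) = f ∘ (Sum.elim a b') := by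
    intro a; ext (i | i) <;> rfl
  rw [e, hf.formula] at hφ
  obtain ⟨a2, h1, h2⟩ := h p q φ a' b' ha' hb' hφ
  refine ⟨fun i => f (a2 i), fun i => ⟨_, h1 i, rfl⟩, ?_⟩
  rw [e, hf.formula]; exact h2

theorem ElS.image {D E : Type w} [L.Structure D] [L.Structure E] [Nonempty D] {f : D → E} (hf : IsElem L f) {N : Set D} (h : ElS L N) :
    ElS L (f '' N) := by
  intro p q φ a b hb hφ
  choose b' hb' hb2 using hb
  obtain rfl : (fun i => f (b' i)) = b := funext hb2
  obtain ⟨a1, ha1⟩ := transfer (L := L) (M := E) (M' := D) (y := fun i => f (b' i)) (y' := b') 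
    (fun ψ h => (hf.formula' ψ b').1 h) φ a hφ
  obtain ⟨a2, h1, h2⟩ := h p q φ a1 b' hb' ha1
  refine ⟨fun i => f (a2 i), fun i => ⟨_, h1 i, rfl⟩, ?_⟩
  rw [← hf.formula φ] at h2
  convert h2 using 1
  ext (i | i) <;> rfl

/-- step A -/
theorem extA (D : AM.{u, v, w} T) {N1 Y N : Set D} (hN0 : N.Nonempty) (hFS : FS L N1 Y N) :
    ∃ (Ds : AM.{u, v, w} T) (k : D → Ds) (f0 : D → Ds), IsHom k ∧ IsElem L f0 ∧ (∀ y ∈ Y, f0 y = k y) ∧ 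
      FS L (k '' N1) (Set.range f0) (f0 '' N) := by
  obtain ⟨𝔤, h𝔤⟩ := hFS.uf hN0 (fun x : N1 => x.1) (fun x : Y => x.1) (fun i => Or.inl i.2) (fun i => Or.inl i.2)
  let E1 := UP 𝔤 D
  haveI : Nonempty E1 := ⟨UP.diag 𝔤 (Classical.arbitrary D)⟩
  let e' : N1 → E1 := fun e => UP.mk 𝔤 fun g => (g e).1
  obtain ⟨E, _, i, h, hi, hh⟩ := realize_type (L := L) (M := D) (M' := E1) (fun x : D => x) 
    (y := Sum.elim (fun x : N1 => x.1) (fun x : Y => x.1)) (y' := Sum.elim e' (fun x => UP.diag 𝔤 x.1)) (by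
      intro ψ hψ
      have := h𝔤 ψ hψ
      have h2 := (UP.los (U := 𝔤) ψ (Sum.elim (fun e g => (g e).1) (fun x _ => x.1))).2 (by
        filter_upwards [this] with g hg
        convert hg using 1; ext (i | i) <;> rfl)
      convert h2 using 1
      ext (i | i) <;> rfl)
  have he1 : IsElem L h := by
    apply IsElem.of_all
    intro φ hφ
    have := (hh (φ.relabel Sum.inl)).1 (by rw [Formula.realize_relabel]; exact hφ)
    rw [Formula.realize_relabel] at this; exact this
  have hhe : ∀ e : N1, h e.1 = i (e' e) := by
    intro e
    have := (hh (Term.equal (Term.var (.inl e.1)) (Term.var (.inr (.inl e))))).1 (by simp [Formula.realize_equal])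
    simpa [Formula.realize_equal] using this
  have hhy : ∀ y : Y, h y.1 = i (UP.diag 𝔤 y.1) := by
    intro e
    have := (hh (Term.equal (Term.var (.inl e.1)) (Term.var (.inr (.inr e))))).1 (by simp [Formula.realize_equal])
    simpa [Formula.realize_equal] using this
  haveI : Nonempty E := ⟨h (Classical.arbitrary D)⟩
  obtain ⟨E', _, i', s, hi', hs⟩ := aut_lemma (L := L) h (h ∘ D.σ) (by
    intro φ hφ
    rw [he1.formula] 
    rw [show h = h ∘ id from rfl, he1.formula] at hφ
    have := (D.sigma_elem.formula φ id).2 hφ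
    exact this)
  haveI : Nonempty E' := ⟨i' (h (Classical.arbitrary D))⟩
  have hE' : E' ⊨ T := ((hi'.comp he1).model T).1 D.mod
  have hf0 : IsElem L (fun d => i' (i (UP.diag 𝔤 d))) := hi'.comp (hi.comp UP.diag_elem)
  refine ⟨AM.of E' hE' s, fun d => i' (h d), fun d => i' (i (UP.diag 𝔤 d)), ⟨hi'.comp he1, fun x => (hs x).symm⟩, hf0, ?_, ?_⟩
  · intro y hy
    exact (congrArg i' (hhy ⟨y, hy⟩)).symm
  · intro p q φ a b ha hb hφ
    have hb' : ∀ j, ∃ d, i' (i (UP.diag 𝔤 d)) = b j := by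
      intro j
      rcases hb j with ⟨d, hd⟩ | ⟨d, _, hd⟩ <;> exact ⟨d, hd⟩
    choose a' ha' ha2 using ha
    choose b' hb' using hb'
    have h1 : φ.Realize (Sum.elim (fun j => e' ⟨a' j, ha' j⟩) (fun j => UP.diag 𝔤 (b' j))) := by
      rw [← (hi'.comp hi).formula φ]
      refine rz hφ ?_
      rintro (j | j)
      · simp [← ha2, ← hhe ⟨a' j, ha' j⟩]
      · simp [← hb']
    have h2 := (UP.los (U := 𝔤) φ (Sum.elim (fun j g => (g ⟨a' j, ha' j⟩).1) (fun j _ => b' j))).1 (by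
      convert h1 using 1; ext (j | j) <;> rfl)
    obtain ⟨g, hg⟩ := h2.exists
    refine ⟨fun j => i' (i (UP.diag 𝔤 (g ⟨a' j, ha' j⟩))), fun j => ⟨_, (g ⟨a' j, ha' j⟩).2, rfl⟩, ?_⟩
    rw [← hf0.formula' φ] at hg
    refine rz hg ?_
    rintro (j | j)
    · rfl
    · exact hb' j

end ShelahE34
end FirstOrder

namespace FirstOrder
set_option linter.all false
open Language Structure
universe u v w u' v' w'
namespace ShelahE34
variable {L : Language.{u, v}} {T : L.Theory} {Tmc : (LPlus L).Theory}

section iter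
variable {Z : Type w}

/-- iterated product of ultrafilters -/
noncomputable def Jt (s : ℕ → Ultrafilter Z) (z0 : Z) : ℕ → Ultrafilter (ℕ → Z)
  | 0 => pure (fun _ => z0)
  | (r + 1) => (Jt s z0 r).bind (fun x => (s r).map (fun y => Function.update x r y))

theorem Jt_succ (s : ℕ → Ultrafilter Z) (z0 : Z) (r : ℕ) (P : (ℕ → Z) → Prop) :
    (∀ᶠ x in Jt s z0 (r+1), P x) ↔ ∀ᶠ x in Jt s z0 r, ∀ᶠ y in s r, P (Function.update x r y) := Iff.rfl

theorem Jt_zero (s : ℕ → Ultrafilter Z) (z0 : Z) (P : (ℕ → Z) → Prop) :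
    (∀ᶠ x in Jt s z0 0, P x) ↔ P (fun _ => z0) := Iff.rfl

def Dep (r : ℕ) (P : (ℕ → Z) → Prop) : Prop := ∀ x x', (∀ i < r, x i = x' i) → (P x ↔ P x')

theorem Dep.mono {r r' : ℕ} {P : (ℕ → Z) → Prop} (h : Dep r P) (hr : r ≤ r') : Dep r' P :=
  fun x x' hx => h x x' fun i hi => hx i (lt_of_lt_of_le hi hr)

theorem Dep.stable {s : ℕ → Ultrafilter Z} {z0 : Z} {r : ℕ} {P : (ℕ → Z) → Prop} (h : Dep r P) (r' : ℕ) (hr : r ≤ r') :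
    (∀ᶠ x in Jt s z0 r', P x) ↔ ∀ᶠ x in Jt s z0 r, P x := by
  induction r', hr using Nat.le_induction with
  | base => exact Iff.rfl
  | succ n hn ih =>
    rw [Jt_succ, ← ih]
    apply Filter.eventually_congr
    filter_upwards with x
    rw [← Filter.eventually_const (f := (s n : Filter Z)) (p := P x)]
    apply Filter.eventually_congr
    filter_upwards with y
    apply h
    intro i hi
    rw [Function.update_of_ne (by omega)]

noncomputable def Jlim (s : ℕ → Ultrafilter Z) (z0 : Z) : Ultrafilter (ℕ → Z) := (Filter.hyperfilter ℕ).bind (Jt s z0)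

theorem Dep.lim {s : ℕ → Ultrafilter Z} {z0 : Z} {r : ℕ} {P : (ℕ → Z) → Prop} (h : Dep r P) :
    (∀ᶠ x in Jlim s z0, P x) ↔ ∀ᶠ x in Jt s z0 r, P x := by
  have : (∀ᶠ x in Jlim s z0, P x) ↔ ∀ᶠ r in (Filter.hyperfilter ℕ), ∀ᶠ x in Jt s z0 r, P x := Iff.rfl
  rw [this, ← Filter.eventually_const (f := (Filter.hyperfilter ℕ : Filter ℕ)) (p := ∀ᶠ x in Jt s z0 r, P x)]
  apply Filter.eventually_congr
  have : ∀ᶠ n in (Filter.hyperfilter ℕ : Filter ℕ), r ≤ n := by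
    apply Nat.hyperfilter_le_atTop
    exact Filter.eventually_ge_atTop r
  filter_upwards [this] with n hn
  exact h.stable n hn

theorem Dep.shift {s : ℕ → Ultrafilter Z} {z0 : Z} {g : Z → Z} (hs : ∀ n, s (n+1) = (s n).map g) (r : ℕ) :
    ∀ {P : (ℕ → Z) → Prop} (h : Dep r P),
    (∀ᶠ x : ℕ → Z in Jt s z0 (r+1), P (fun n => x (n+1))) ↔ ∀ᶠ x : ℕ → Z in Jt s z0 r, P (fun n => g (x n)) := by
  induction r with
  | zero =>
    intro P h
    have : ∀ x, P x ↔ P (fun _ => z0) := fun x => h _ _ (fun i hi => absurd hi (Nat.not_lt_zero _))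
    constructor
    · intro h1
      obtain ⟨x, hx⟩ := h1.exists
      filter_upwards with y
      rw [this] at hx ⊢; exact hx
    · intro h1
      obtain ⟨x, hx⟩ := h1.exists
      filter_upwards with y
      rw [this] at hx ⊢; exact hx
  | succ r ih =>
    intro P h
    let Q : (ℕ → Z) → Prop := fun x => ∀ᶠ y in s (r+1), P (Function.update x r y)
    have hQ : Dep r Q := by
      intro x x' hx
      apply Filter.eventually_congr
      filter_upwards with y
      apply h
      intro i hi
      by_cases h2 : i = r
      · subst h2; simp
      · rw [Function.update_of_ne h2, Function.update_of_ne h2]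
        exact hx i (by omega)
    rw [Jt_succ s z0 (r+1), Jt_succ s z0 r (fun x => P (fun n => g (x n)))]
    have e1 := ih hQ
    rw [show (∀ᶠ x : ℕ → Z in Jt s z0 (r+1), ∀ᶠ y in s (r+1), P (fun n => Function.update x (r+1) y (n+1))) ↔ 
        ∀ᶠ x : ℕ → Z in Jt s z0 (r+1), Q (fun n => x (n+1)) from ?_, e1]
    · apply Filter.eventually_congr
      filter_upwards with x
      show (∀ᶠ y : Z in s (r+1), P (Function.update (fun n => g (x n)) r y)) ↔ _
      rw [hs]
      apply Filter.eventually_congr (f := (s r : Filter Z))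
      filter_upwards with y
      apply iff_of_eq; congr 1
      ext n
      by_cases h2 : n = r
      · subst h2; simp
      · rw [Function.update_of_ne h2, Function.update_of_ne h2]
    · apply Filter.eventually_congr
      filter_upwards with x
      apply Filter.eventually_congr
      filter_upwards with y
      apply iff_of_eq; congr 1
      ext n
      by_cases h2 : n = r
      · subst h2; simp
      · rw [Function.update_of_ne h2, Function.update_of_ne (by omega)]
end iter

/-- a formula depends on finitely many coordinates -/
theorem dep_formula {α : Type u'} {X : Type v'} (φ : L.Formula (α ⊕ (ℕ × X))) :
    ∃ r : ℕ, ∀ (M : Type w) [L.Structure M] (a : α → M),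
      Dep r (fun x : ℕ → X → M => φ.Realize (Sum.elim a (fun p => x p.1 p.2))) := by
  obtain ⟨p, q, f, g, ψ, hf, hg, hψ⟩ := finvars.{u, v, w} φ
  refine ⟨Finset.univ.sup (fun i => (g i).1) + 1, fun M _ a x x' h => ?_⟩
  simp only [hψ]
  apply rziff
  rintro (i | i)
  · rfl
  · show x _ _ = x' _ _
    rw [h]
    have : (g i).1 ≤ Finset.univ.sup (fun i => (g i).1) := Finset.le_sup (f := fun i => (g i).1) (Finset.mem_univ i)
    omega

/-- finite satisfiability of the iterated product -/
theorem Jt_fs (st : Stab.{u, v, w} T) {D : Type w} [L.Structure D] [Nonempty D] (hD : D ⊨ T) {X : Type w}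
    (s : ℕ → Ultrafilter (X → D)) (f0 : X → D) (F : Set D) (hf0 : ∀ x, f0 x ∈ F)
    (hs : ∀ n, ∀ ψ : L.Formula (X ⊕ D), (∀ᶠ x in s n, ψ.Realize (Sum.elim x id)) → ∃ x : X → D, (∀ i, x i ∈ F) ∧ ψ.Realize (Sum.elim x id))
    (r : ℕ) : ∀ ψ : L.Formula (D ⊕ (ℕ × X)), (∀ᶠ x : ℕ → X → D in Jt s f0 r, ψ.Realize (Sum.elim id (fun p => x p.1 p.2))) → 
      ∃ x : ℕ → X → D, (∀ n i, x n i ∈ F) ∧ ψ.Realize (Sum.elim id (fun p => x p.1 p.2)) := by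
  classical
  induction r with
  | zero =>
    intro ψ h
    exact ⟨_, fun _ => hf0, (Jt_zero s f0 _).1 h⟩
  | succ r ih =>
    intro ψ h
    rw [Jt_succ] at h
    let ρ : D ⊕ (ℕ × X) → X ⊕ (D ⊕ (ℕ × X)) := Sum.elim (fun d => .inr (.inl d)) 
      (fun p => if p.1 = r then .inl p.2 else .inr (.inr p))
    have hρ : ∀ (x : ℕ → X → D) (y : X → D), ψ.Realize (Sum.elim id (fun p => (Function.update x r y) p.1 p.2)) ↔
        (ψ.relabel ρ).Realize (Sum.elim y (Sum.elim id (fun p => x p.1 p.2))) := by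
      intro x y
      rw [Formula.realize_relabel]
      apply rziff
      rintro (d | ⟨n, i⟩)
      · rfl
      · by_cases h2 : n = r
        · subst h2; simp [ρ]
        · simp [ρ, h2]
    obtain ⟨δ, hδ⟩ := st.defuf hD (s r) (fun y => y) (ψ.relabel ρ)
    simp only [hρ, hδ] at h
    obtain ⟨x, hx, hx2⟩ := ih (δ.relabel (Sum.elim id Sum.inl)) (by
      filter_upwards [h] with x hx
      rw [Formula.realize_relabel]
      refine rz hx ?_
      rintro ((d | p) | d) <;> rfl)
    rw [Formula.realize_relabel] at hx2
    have h3 := (hδ (Sum.elim id (fun p => x p.1 p.2))).2 (by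
      refine rz hx2 ?_
      rintro ((d | p) | d) <;> rfl)
    obtain ⟨y, hy, hy2⟩ := hs r ((ψ.relabel ρ).relabel (Sum.elim Sum.inl (fun e => .inr (Sum.elim id (fun p => x p.1 p.2) e)))) (by
      filter_upwards [h3] with y hy
      rw [Formula.realize_relabel]
      refine rz hy ?_
      rintro (i | (d | p)) <;> rfl)
    refine ⟨Function.update x r y, ?_, ?_⟩
    · intro n i
      by_cases h2 : n = r
      · subst h2; simpa using hy i
      · rw [Function.update_of_ne h2]; exact hx n i
    · rw [hρ]
      rw [Formula.realize_relabel] at hy2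
      refine rz hy2 ?_
      rintro (i | (d | p)) <;> rfl

end ShelahE34
end FirstOrder

namespace FirstOrder
set_option linter.all false
open Language Structure
universe u v w u' v' w'
namespace ShelahE34
variable {L : Language.{u, v}} {T : L.Theory} {Tmc : (LPlus L).Theory}

theorem AM.iter_elem (D : AM.{u, v, w} T) (n : ℕ) : IsElem L (D.σ^[n]) := by
  induction n with
  | zero => exact IsElem.ident
  | succ n ih => rw [Function.iterate_succ]; exact ih.comp D.sigma_elem

theorem SC.iter {D : AM.{u, v, w} T} {S : Set D} (h : SC D S) (n : ℕ) (x : D) : D.σ^[n] x ∈ S ↔ x ∈ S := by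
  induction n generalizing x with
  | zero => exact Iff.rfl
  | succ n ih => rw [Function.iterate_succ, Function.comp, ih, h]

theorem AM.iter_surj (D : AM.{u, v, w} T) (n : ℕ) : Function.Surjective (D.σ^[n]) := 
  Function.Surjective.iterate D.σ.surjective n

/-- closing up a forward closed set -/
theorem orb_close (D : AM.{u, v, w} T) {S N1 N : Set D} (hS : ∀ x ∈ S, D.σ x ∈ S) (h1 : SC D N1) (h0 : SC D N) (h : FS L N1 S N) :
    SC D {y | ∃ n, D.σ^[n] y ∈ S} ∧ FS L N1 {y | ∃ n, D.σ^[n] y ∈ S} N := by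
  have hSi : ∀ m x, x ∈ S → D.σ^[m] x ∈ S := by
    intro m
    induction m with
    | zero => exact fun x h => h
    | succ m ih => intro x hx; rw [Function.iterate_succ]; exact ih _ (hS x hx)
  constructor
  · intro x
    constructor
    · rintro ⟨n, hn⟩
      exact ⟨n+1, hn⟩
    · rintro ⟨n, hn⟩
      refine ⟨n, ?_⟩
      rw [← Function.iterate_succ_apply, Function.iterate_succ_apply']
      exact hS _ hn
  · intro p q φ a b ha hb hφ
    have : ∃ n, ∀ j, D.σ^[n] (b j) ∈ S ∪ N := by
      have : ∀ j, ∃ n, ∀ m, n ≤ m → D.σ^[m] (b j) ∈ S ∪ N := by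
        intro j
        rcases hb j with ⟨n, hn⟩ | hn
        · refine ⟨n, fun m hm => Or.inl ?_⟩
          obtain ⟨k, rfl⟩ := Nat.exists_eq_add_of_le' hm
          rw [Function.iterate_add_apply]
          exact hSi k _ hn
        · exact ⟨0, fun m _ => Or.inr ((h0.iter m _).2 hn)⟩
      choose n hn using this
      exact ⟨Finset.univ.sup n, fun j => hn j _ (Finset.le_sup (Finset.mem_univ j))⟩
    obtain ⟨n, hn⟩ := this
    rw [← (D.iter_elem n).formula'] at hφ
    obtain ⟨a', ha', h2⟩ := h p q φ (fun i => D.σ^[n] (a i)) (fun i => D.σ^[n] (b i)) (fun i => (h1.iter n _).2 (ha i)) hn (by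
      refine rz hφ ?_
      rintro (i | i) <;> rfl)
    choose a2 ha2 using fun i => D.iter_surj n (a' i)
    refine ⟨a2, fun i => (h0.iter n _).1 (by rw [ha2]; exact ha' i), ?_⟩
    rw [← (D.iter_elem n).formula']
    refine rz h2 ?_
    rintro (i | i)
    · exact (ha2 i).symm
    · rfl

theorem extBC (hs : IsSimpleTheory.{u, v, w} T) (st : Stab.{u, v, w} T) (Ds : AM.{u, v, w} T) {X : Type w} [L.Structure X] [Nonempty X]
    {f0 : X → Ds} (hf0 : IsElem L f0) {N1 N A : Set Ds} (hA : A ⊆ Set.range f0) (scA : SC Ds A) (sc1 : SC Ds N1) (sc0 : SC Ds N)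
    (hN : ElS L N) (hN0 : N.Nonempty) (hFS : FS L N1 (Set.range f0) N) :
    ∃ (D2 : AM.{u, v, w} T) (k : Ds → D2) (z : X → D2) (Y2 : Set D2), IsHom k ∧ IsElem L z ∧ (∀ d, f0 d ∈ A → z d = k (f0 d)) ∧ 
      SC D2 Y2 ∧ Set.range z ⊆ Y2 ∧ FS L (k '' N1) Y2 (k '' N) := by
  let μ := {τ : Ds ≃[L] Ds // ∀ x, τ x ∈ A ↔ x ∈ A}
  let τ0 : μ := ⟨Language.Equiv.refl L Ds, fun x => Iff.rfl⟩
  haveI : Nonempty μ := ⟨τ0⟩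
  let F : μ → Set Ds := fun τ => τ.1 '' Set.range f0
  obtain ⟨s0, hs1, hs2⟩ := lemmaE hs st Ds.mod f0 A F (fun τ => ElS.image (IsElem.of_equiv τ.1) (ElS.range hf0))
    (fun τ => (Set.range_nonempty f0).image _) (by
      intro τ a ha
      refine ⟨τ.1.symm a, hA ?_, by simp⟩
      rw [← τ.2]; simpa using ha)
  let g : (X → Ds) → (X → Ds) := fun y i => Ds.σ (y i)
  obtain ⟨s, hs00, hss⟩ : ∃ s : ℕ → Ultrafilter (X → Ds), s 0 = s0 ∧ ∀ n, s (n+1) = (s n).map g := 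
    ⟨fun n => Nat.rec s0 (fun _ t => t.map g) n, rfl, fun _ => rfl⟩
  have hs3 : ∀ n, ∀ ψ : L.Formula (X ⊕ Ds), (∀ᶠ x in (s n : Filter (X → Ds)), ψ.Realize (Sum.elim x id)) → ∀ m : μ, ∃ x : X → Ds, 
      (∀ i, x i ∈ F m) ∧ ψ.Realize (Sum.elim x id) := by
    intro n
    induction n with
    | zero => rw [hs00]; exact hs2
    | succ n ih =>
      intro ψ h τ
      have h' : ∀ᶠ x in (s n : Filter (X → Ds)), ψ.Realize (Sum.elim (g x) id) := by rw [hss] at h; exact h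
      have key : ∀ x : X → Ds, ψ.Realize (Sum.elim (g x) id) ↔ (ψ.relabel (Sum.elim Sum.inl (fun d => Sum.inr (Ds.σ.symm d)))).Realize 
          (Sum.elim x id) := by
        intro x
        rw [Formula.realize_relabel]
        refine Iff.trans ?_ (Ds.sigma_elem.formula' _ _)
        apply rziff
        rintro (i | i)
        · rfl
        · simp
      simp only [key] at h'
      obtain ⟨x, hx, hx2⟩ := ih _ h' ⟨Ds.σ.symm.comp τ.1, by
        intro x
        rw [← τ.2 x, ← scA]; simp⟩
      refine ⟨g x, ?_, (key x).2 hx2⟩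
      intro i
      obtain ⟨y, hy, h3⟩ := hx i
      refine ⟨y, hy, ?_⟩
      show _ = Ds.σ (x i)
      rw [← h3]; simp
  let J := Jlim s f0
  let E := UP J Ds
  haveI : Nonempty E := ⟨UP.diag J (Classical.arbitrary Ds)⟩
  let z : ℕ × X → E := fun p => UP.mk J (fun x => x p.1 p.2)
  have hlos : ∀ (v : Ds → Ds) (ρ : ℕ × X → ℕ × X) (φ : L.Formula (Ds ⊕ (ℕ × X))), 
      φ.Realize (Sum.elim (fun d => UP.diag J (v d)) (fun p => z (ρ p))) ↔ 
      ∀ᶠ x in (J : Filter (ℕ → X → Ds)), φ.Realize (Sum.elim v (fun p => x (ρ p).1 (ρ p).2)) := by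
    intro v ρ φ
    have h := UP.los (U := J) φ (Sum.elim (fun d _ => v d) (fun p x => x (ρ p).1 (ρ p).2))
    refine Iff.trans (rziff ?_) (h.trans (Filter.eventually_congr ?_))
    · rintro (d | p) <;> rfl
    · filter_upwards with x
      apply rziff
      rintro (d | p) <;> rfl
  have hfs : ∀ φ : L.Formula (Ds ⊕ (ℕ × X)), φ.Realize (Sum.elim (fun d => UP.diag J d) z) → 
      ∃ x : ℕ → X → Ds, (∀ n i, x n i ∈ Set.range f0) ∧ φ.Realize (Sum.elim id (fun p => x p.1 p.2)) := by
    intro φ hφ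
    have h1 := (hlos id id φ).1 hφ
    obtain ⟨r, hr⟩ := dep_formula.{u, v, w} φ
    have h2 := ((hr Ds id).lim (s := s) (z0 := f0)).1 h1
    exact Jt_fs st Ds.mod s f0 (Set.range f0) (fun x => ⟨x, rfl⟩) (fun n ψ h => by
      obtain ⟨x, hx, hx2⟩ := hs3 n ψ h τ0
      refine ⟨x, fun i => ?_, hx2⟩
      obtain ⟨y, hy, h3⟩ := hx i
      rw [← h3]; exact hy) r φ h2
  obtain ⟨E', _, i, sg, hi, hsg⟩ := aut_lemma (L := L) (Sum.elim (fun d => UP.diag J d) z)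
      (Sum.elim (fun d => UP.diag J (Ds.σ d)) (fun p => z (p.1+1, p.2))) (by
    intro φ hφ
    have h1 := (hlos id id φ).1 hφ
    refine (hlos Ds.σ (fun p => (p.1+1, p.2)) φ).2 ?_
    obtain ⟨r, hr⟩ := dep_formula.{u, v, w} φ
    have h2 := ((hr Ds id).lim (s := s) (z0 := f0)).1 h1
    have h3 : Dep (r+1) (fun x : ℕ → X → Ds => φ.Realize (Sum.elim Ds.σ (fun p => x (p.1+1) p.2))) := by
      intro x x' h
      exact hr Ds Ds.σ (fun n => x (n+1)) (fun n => x' (n+1)) (fun i hi => h (i+1) (by omega))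
    refine (h3.lim (s := s) (z0 := f0)).2 ?_
    refine (Dep.shift (s := s) (z0 := f0) hss r (hr Ds Ds.σ)).2 ?_
    filter_upwards [h2] with x hx
    have hx2 := (Ds.sigma_elem.formula' φ _).2 hx
    refine rz hx2 ?_
    rintro (d | p) <;> rfl)
  haveI : Nonempty E' := ⟨i (UP.diag J (Classical.arbitrary Ds))⟩
  have hE' : E' ⊨ T := ((hi.comp UP.diag_elem).model T).1 Ds.mod
  have hE : E ⊨ T := (UP.diag_elem.model T).1 Ds.mod
  have hdg : IsElem L (UP.diag J : Ds → E) := UP.diag_elem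
  have FS1 : FS L (Set.range z) (UP.diag J '' N1) (UP.diag J '' N) := by
    have hsy := st.nl.symm Ds.mod hN hN0 hFS
    intro p q φ a b ha hb hφ
    rw [← Set.image_union] at hb
    choose a' ha' using ha
    choose b' hb' hb2 using hb
    obtain ⟨x, hx, hx2⟩ := hfs (φ.relabel (Sum.elim (fun j => .inr (a' j)) (fun j => .inl (b' j)))) (by
      rw [Formula.realize_relabel]
      refine rz hφ ?_
      rintro (j | j)
      · exact (ha' j).symm
      · exact (hb2 j).symm)
    rw [Formula.realize_relabel] at hx2
    obtain ⟨c, hc, hc2⟩ := hsy p q φ (fun j => x (a' j).1 (a' j).2) b' (fun j => hx _ _) hb' (by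
      refine rz hx2 ?_
      rintro (j | j) <;> rfl)
    refine ⟨fun j => UP.diag J (c j), fun j => ⟨_, hc j, rfl⟩, ?_⟩
    have := (hdg.formula' φ _).2 hc2
    refine rz this ?_
    rintro (j | j)
    · rfl
    · exact hb2 j
  have FS2 := FS.image hi (st.nl.symm hE (ElS.image hdg hN) (hN0.image _) FS1)
  obtain ⟨D2, hD2⟩ : ∃ D2 : AM.{u, v, w} T, D2 = AM.of E' hE' sg := ⟨_, rfl⟩
  have hk : IsHom (B := AM.of E' hE' sg) (fun d => i (UP.diag J d)) := ⟨hi.comp UP.diag_elem, fun x => (hsg (.inl x)).symm⟩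
  have e1 : ∀ S : Set Ds, i '' (UP.diag J '' S) = (fun d => i (UP.diag J d)) '' S := fun S => Set.image_image _ _ _
  rw [e1, e1] at FS2
  have hcl := orb_close (AM.of E' hE' sg) (S := i '' Set.range z) (by
    rintro x ⟨_, ⟨p, rfl⟩, rfl⟩
    exact ⟨z (p.1+1, p.2), ⟨_, rfl⟩, (hsg (.inr p)).symm⟩) (sc1.image hk) (sc0.image hk) FS2
  have hz0 : ∀ φ : L.Formula (X ⊕ A), φ.Realize (Sum.elim f0 (fun a => a.1)) → 
      φ.Realize (Sum.elim (fun d => z (0, d)) (fun a => UP.diag J a.1)) := by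
    intro φ hφ
    let φ' : L.Formula (Ds ⊕ (ℕ × X)) := φ.relabel (Sum.elim (fun d => .inr (0, d)) (fun a => .inl a.1))
    have h1 : φ'.Realize (Sum.elim (fun d => UP.diag J (id d)) (fun p => z (id p))) := by
      rw [hlos]
      have hd : Dep 1 (fun x : ℕ → X → Ds => φ'.Realize (Sum.elim id (fun p => x (id p).1 (id p).2))) := by
        intro x x' h
        simp only [φ', Formula.realize_relabel]
        apply rziff
        rintro (j | j)
        · exact congrFun (h 0 (by omega)) j
        · rfl
      refine (hd.lim (s := s) (z0 := f0)).2 ?_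
      rw [Jt_succ, Jt_zero, hs00]
      filter_upwards [hs1 φ hφ] with y hy
      simp only [φ', Formula.realize_relabel]
      refine rz hy ?_
      rintro (j | j) <;> simp
    simp only [φ', Formula.realize_relabel] at h1
    refine rz h1 ?_
    rintro (j | j) <;> rfl
  refine ⟨AM.of E' hE' sg, fun d => i (UP.diag J d), fun d => i (z (0, d)), {y | ∃ n, (AM.of E' hE' sg).σ^[n] y ∈ i '' Set.range z}, 
    hk, ?_, ?_, hcl.1, ?_, hcl.2⟩
  · refine hi.comp (g := i) (f := fun d => z (0, d)) ?_
    apply IsElem.of_all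
    intro φ hφ
    have h1 := hz0 (φ.relabel Sum.inl) (by
      rw [Formula.realize_relabel]
      exact (hf0.formula φ id).2 hφ)
    rw [Formula.realize_relabel] at h1
    exact h1
  · intro d hd
    have := hz0 (Term.equal (Term.var (.inl d)) (Term.var (.inr ⟨f0 d, hd⟩))) (by simp [Formula.realize_equal])
    have h2 : z (0, d) = UP.diag J (f0 d) := by simpa [Formula.realize_equal] using this
    exact congrArg i h2
  · rintro _ ⟨d, rfl⟩
    exact ⟨0, z (0, d), ⟨_, rfl⟩, rfl⟩

end ShelahE34
end FirstOrder

namespace FirstOrder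
set_option linter.all false
open Language Structure
universe u v w u' v' w'
namespace ShelahE34
variable {L : Language.{u, v}} {T : L.Theory} {Tmc : (LPlus L).Theory}

/-- state of the closure construction -/
structure CS (T : L.Theory) where
  D : AM.{u, v, w} T
  N : Set D
  N1 : Set D
  Y : Set D
  hNY : N ⊆ Y
  sc0 : SC D N
  sc1 : SC D N1
  scY : SC D Y
  el : ElS L N
  ne : N.Nonempty
  fs : FS L N1 Y N

theorem CS.step (hs : IsSimpleTheory.{u, v, w} T) (st : Stab.{u, v, w} T) (S : CS.{u, v, w} T) :
    ∃ (S2 : CS.{u, v, w} T) (k z : S.D → S2.D), IsHom k ∧ IsElem L z ∧ (∀ y ∈ S.Y, z y = k y) ∧ S2.N = k '' S.N ∧ S2.N1 = k '' S.N1 ∧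
      Set.range z ⊆ S2.Y := by
  obtain ⟨D, N, N1, Y, hNY, sc0, sc1, scY, el, ne, fs⟩ := S
  obtain ⟨Ds, k, f0, hk, hf0, hy, hFS⟩ := extA D ne fs
  have e0 : f0 '' N = k '' N := by
    apply Set.image_congr
    intro a ha
    exact hy a (hNY ha)
  rw [e0] at hFS
  obtain ⟨D2, k2, z, Y2, hk2, hz, hz2, hscY, hzY, hFS2⟩ := extBC hs st Ds hf0 (A := k '' Y) (by
    rintro _ ⟨y, hy1, rfl⟩
    exact ⟨y, hy y hy1⟩) (scY.image hk) (sc1.image hk) (sc0.image hk) (el.image hk.elem) (ne.image _) hFS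
  have hzy : ∀ y ∈ Y, z y = k2 (k y) := by
    intro y h
    rw [hz2 y (by rw [hy y h]; exact ⟨y, h, rfl⟩), hy y h]
  refine ⟨⟨D2, k2 '' (k '' N), k2 '' (k '' N1), Y2, ?_, (sc0.image hk).image hk2, (sc1.image hk).image hk2, hscY, 
    (el.image hk.elem).image hk2.elem, (ne.image _).image _, hFS2⟩, k2 ∘ k, z, hk2.comp hk, hz, hzy, 
    Set.image_image _ _ _, Set.image_image _ _ _, hzY⟩
  rintro _ ⟨_, ⟨y, h, rfl⟩, rfl⟩
  exact hzY ⟨y, hzy y (hNY h)⟩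

theorem CS.closed (hs : IsSimpleTheory.{u, v, w} T) (st : Stab.{u, v, w} T) (S0 : CS.{u, v, w} T) :
    ∃ (E : AM.{u, v, w} T) (j : S0.D → E) (C : Set E), IsHom j ∧ SC E C ∧ ElS L C ∧ j '' S0.Y ⊆ C ∧ FS L (j '' S0.N1) C (j '' S0.N) := by
  choose next k z hk hz hzk hN hN1 hY using CS.step hs st
  let S : ℕ → CS.{u, v, w} T := fun n => Nat.rec S0 (fun _ s => next s) n
  let f : ∀ n, (S n).D → (S (n+1)).D := fun n => k (S n)
  have hf : ∀ n, IsHom (f n) := fun n => hk (S n)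
  have hkY : ∀ n, ∀ y ∈ (S n).Y, f n y ∈ (S (n+1)).Y := by
    intro n y hy
    have : f n y = z (S n) y := (hzk (S n) y hy).symm
    rw [this]
    exact hY (S n) ⟨y, rfl⟩
  obtain ⟨E, _, j, hj, hjf, hjs⟩ := exists_colim (L := L) (G := fun n => (S n).D) f (fun n => (hf n).elem)
  haveI : Nonempty E := ⟨j 0 (Classical.arbitrary (S 0).D)⟩
  have hE : E ⊨ T := ((hj 0).model T).1 (S 0).D.mod
  -- going up
  have up : ∀ (n m : ℕ), n ≤ m → ∀ x : (S n).D, ∃ y : (S m).D, j m y = j n x ∧ j m ((S m).D.σ y) = j n ((S n).D.σ x) ∧ 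
      (x ∈ (S n).Y → y ∈ (S m).Y) := by
    intro n m hnm
    induction m, hnm using Nat.le_induction with
    | base => exact fun x => ⟨x, rfl, rfl, id⟩
    | succ m hm ih =>
      intro x
      obtain ⟨y, h1, h2, h3⟩ := ih x
      refine ⟨f m y, by rw [hjf, h1], ?_, fun h => hkY m y (h3 h)⟩
      rw [← (hf m).comm, hjf, h2]
  -- σ on E
  choose nn xx hx using hjs
  let q : E → E := fun e => j (nn e) ((S (nn e)).D.σ (xx e))
  have hq : ∀ n x, q (j n x) = j n ((S n).D.σ x) := by
    intro n x
    obtain ⟨y1, h1, h2, _⟩ := up (nn (j n x)) (max (nn (j n x)) n) (le_max_left _ _) (xx (j n x))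
    obtain ⟨y2, h3, h4, _⟩ := up n (max (nn (j n x)) n) (le_max_right _ _) x
    have := (hj _).inj ((h1.trans (hx (j n x))).trans h3.symm)
    subst this
    exact h2.symm.trans h4
  have lev : ∀ (p : ℕ) (a : Fin p → E), ∃ n0, ∀ n, n0 ≤ n → ∃ a' : Fin p → (S n).D, ∀ i, j n (a' i) = a i := by
    intro p a
    refine ⟨Finset.univ.sup (fun i => nn (a i)), fun n hn => ?_⟩
    choose a' h1 h2 h3 using fun i => up (nn (a i)) n (le_trans (Finset.le_sup (f := fun i => nn (a i)) (Finset.mem_univ i)) hn) (xx (a i))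
    exact ⟨a', fun i => by rw [h1, hx]⟩
  obtain ⟨sg, hsg⟩ := exists_equiv_of_surj (L := L) (fun e : E => e) q (fun e => ⟨e, rfl⟩) (by
      intro e
      refine ⟨j (nn e) ((S (nn e)).D.σ.symm (xx e)), ?_⟩
      rw [hq]; simp [hx]) (by
    intro φ
    obtain ⟨p, v, ψ, hv, hψ⟩ := finvar.{u, v, w} φ
    rw [hψ, hψ]
    obtain ⟨n, hn⟩ := lev p v
    obtain ⟨a, ha⟩ := hn n le_rfl
    have e1 : ψ.Realize ((fun e => e) ∘ v) ↔ ψ.Realize a := 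
      (rziff (fun i => (ha i).symm)).trans ((hj n).formula' ψ a)
    have e2 : ψ.Realize (q ∘ v) ↔ ψ.Realize (fun i => (S n).D.σ (a i)) := 
      (rziff (fun i => by rw [← hq, ha]; rfl)).trans ((hj n).formula' ψ (fun i => (S n).D.σ (a i)))
    rw [e1, e2]
    exact ((S n).D.sigma_elem.formula' ψ a).symm)
  have hom : ∀ n, IsHom (A := (S n).D) (B := AM.of E hE sg) (j n) := fun n => ⟨hj n, fun x => ((hsg _).trans (hq n x)).symm⟩
  have hNn : ∀ n, j n '' (S n).N = j 0 '' (S 0).N := by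
    intro n
    induction n with
    | zero => rfl
    | succ n ih =>
      rw [← ih]
      rw [show (S (n+1)).N = f n '' (S n).N from hN (S n), Set.image_image]
      apply Set.image_congr
      intro a _; exact hjf n a
  have hN1n : ∀ n, j n '' (S n).N1 = j 0 '' (S 0).N1 := by
    intro n
    induction n with
    | zero => rfl
    | succ n ih =>
      rw [← ih]
      rw [show (S (n+1)).N1 = f n '' (S n).N1 from hN1 (S n), Set.image_image]
      apply Set.image_congr
      intro a _; exact hjf n a
  have levY : ∀ (p : ℕ) (a : Fin p → E), (∀ i, a i ∈ ⋃ n, j n '' (S n).Y) → ∃ n, ∃ a' : Fin p → (S n).D, 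
      ∀ i, j n (a' i) = a i ∧ a' i ∈ (S n).Y := by
    intro p a ha
    simp only [Set.mem_iUnion] at ha
    choose m x hx1 hx2 using ha
    refine ⟨Finset.univ.sup m, ?_⟩
    choose a' h1 h2 h3 using fun i => up (m i) (Finset.univ.sup m) (Finset.le_sup (Finset.mem_univ i)) (x i)
    exact ⟨a', fun i => ⟨by rw [h1, hx2], h3 i (hx1 i)⟩⟩
  refine ⟨AM.of E hE sg, j 0, ⋃ n, j n '' (S n).Y, hom 0, ?_, ?_, ?_, ?_⟩
  · intro x
    have : ∀ n, (AM.of E hE sg).σ x ∈ j n '' (S n).Y ↔ x ∈ j n '' (S n).Y := fun n => ((S n).scY.image (hom n)) x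
    constructor
    · intro h
      rw [Set.mem_iUnion] at h ⊢
      obtain ⟨n, hn⟩ := h
      exact ⟨n, (this n).1 hn⟩
    · intro h
      rw [Set.mem_iUnion] at h ⊢
      obtain ⟨n, hn⟩ := h
      exact ⟨n, (this n).2 hn⟩
  · intro p q φ a b hb hφ
    obtain ⟨n, b', hb'⟩ := levY q b hb
    obtain ⟨a1, ha1⟩ := transfer (L := L) (M := E) (M' := (S n).D) (y := b) (y' := b') 
      (fun ψ h => ((hj n).formula' ψ b').1 (rz h (fun i => (hb' i).1.symm))) φ a hφ
    refine ⟨fun i => j (n+1) (z (S n) (a1 i)), fun i => Set.mem_iUnion.2 ⟨n+1, _, hY (S n) ⟨_, rfl⟩, rfl⟩, ?_⟩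
    have h1 := (((hj (n+1)).comp (hz (S n))).formula' φ _).2 ha1
    refine rz h1 ?_
    rintro (i | i)
    · rfl
    · show j (n+1) (z (S n) (b' i)) = b i
      rw [hzk _ _ (hb' i).2, ← (hb' i).1]
      exact hjf n (b' i)
  · rintro _ ⟨y, hy, rfl⟩
    exact Set.mem_iUnion.2 ⟨0, y, hy, rfl⟩
  · intro p q φ a b ha hb hφ
    have hNsub : j 0 '' (S 0).N ⊆ ⋃ n, j n '' (S n).Y := by
      rintro _ ⟨y, hy, rfl⟩
      exact Set.mem_iUnion.2 ⟨0, y, (S 0).hNY hy, rfl⟩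
    obtain ⟨n, b', hb'⟩ := levY q b (fun i => (hb i).elim id (fun h => hNsub h))
    have := FS.image (hj n) (S n).fs
    obtain ⟨a', ha', h2⟩ := this p q φ a b (by rw [hN1n]; exact ha) (fun i => Or.inl ⟨b' i, (hb' i).2, (hb' i).1⟩) hφ
    rw [hNn] at ha'
    exact ⟨a', ha', h2⟩

end ShelahE34
end FirstOrder

namespace FirstOrder
set_option linter.all false
open Language Structure
universe u v w u' v' w'
namespace ShelahE34
variable {L : Language.{u, v}} {T : L.Theory} {Tmc : (LPlus L).Theory}

theorem Stab.defset' (st : Stab.{u, v, w} T) {V : Type u'} {P : Type v'} [Finite V] [Finite P] (χ : L.Formula (V ⊕ P)) :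
    ∃ (K : ℕ) (S : Type) (_ : Finite S) (δ : S → L.Formula (V ⊕ (Fin K × V))), 
    ∀ (D : Type w) [L.Structure D] [Nonempty D], D ⊨ T → ∀ X : Set (V → D), X.Nonempty → ∀ d : P → D, 
      ∃ s, ∃ x : Fin K → V → D, (∀ i, x i ∈ X) ∧ 
        ∀ y ∈ X, χ.Realize (Sum.elim y d) ↔ (δ s).Realize (Sum.elim y (fun i => x i.1 i.2)) := by
  obtain ⟨m, ⟨eV⟩⟩ := Finite.exists_equiv_fin V
  obtain ⟨n, ⟨eP⟩⟩ := Finite.exists_equiv_fin P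
  obtain ⟨K, S, hS, δ, h⟩ := st.defset (χ.relabel (Sum.map eV eP))
  refine ⟨K, S, hS, fun s => (δ s).relabel (Sum.map eV.symm (Prod.map id eV.symm)), ?_⟩
  intro D _ _ hD X hX d
  obtain ⟨s, x, hx, h1⟩ := h D hD {y | (fun i => y (eV i)) ∈ X} (by
    obtain ⟨y, hy⟩ := hX
    refine ⟨fun i => y (eV.symm i), ?_⟩
    simpa using hy) (fun i => d (eP.symm i))
  refine ⟨s, fun k i => x k (eV i), hx, ?_⟩
  intro y hy
  have := h1 (fun i => y (eV.symm i)) (by simpa using hy)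
  rw [Formula.realize_relabel] at this
  rw [Formula.realize_relabel]
  refine Iff.trans (rziff ?_) (this.trans (rziff ?_))
  · rintro (i | i) <;> simp
  · rintro (i | i) <;> simp

theorem NoLadder.gen (hl : NoLadder.{u, v, w} T) {D : Type w} [L.Structure D] [Nonempty D] (hD : D ⊨ T) 
    {V : Type u'} {P : Type v'} [Finite V] [Finite P] (χ : L.Formula (V ⊕ P)) (x : ℕ → V → D) (y : ℕ → P → D) 
    (h : ∀ i j, i < j → χ.Realize (Sum.elim (x i) (y j)) ∧ ¬ χ.Realize (Sum.elim (x j) (y i))) : False := by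
  obtain ⟨m, ⟨eV⟩⟩ := Finite.exists_equiv_fin V
  obtain ⟨n, ⟨eP⟩⟩ := Finite.exists_equiv_fin P
  refine hl D hD m n (χ.relabel (Sum.map eV eP)) (fun k i => x k (eV.symm i)) (fun k i => y k (eP.symm i)) ?_
  intro i j hij
  have e : ∀ i j, (Sum.elim (fun a => x i (eV.symm a)) (fun a => y j (eP.symm a))) ∘ (Sum.map eV eP) = Sum.elim (x i) (y j) := by
    intro i j; ext (a | a) <;> simp
  rw [Formula.realize_relabel, Formula.realize_relabel, e, e]
  exact h i j hij

/-- base configuration -/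
structure Cfg (T : L.Theory) where
  N : AM.{u, v, w} T
  N1 : AM.{u, v, w} T
  C : AM.{u, v, w} T
  D : AM.{u, v, w} T
  i1 : N → N1
  iC : N → C
  d1 : N1 → D
  dC : C → D
  hi1 : IsHom i1
  hiC : IsHom iC
  hd1 : IsHom d1
  hdC : IsHom dC
  comm : ∀ n, d1 (i1 n) = dC (iC n)
  fs : FS L (Set.range d1) (Set.range dC) (Set.range fun n => d1 (i1 n))

/-- extension -/
structure CExt (X : Cfg.{u, v, w} T) where
  B : AM.{u, v, w} T
  G : AM.{u, v, w} T
  β : X.N → B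
  b : B → G
  c : X.C → G
  hβ : IsHom β
  hb : IsHom b
  hc : IsHom c
  comm : ∀ n, b (β n) = c (X.iC n)
  fs : FS L (Set.range b) (Set.range c) (Set.range fun n => c (X.iC n))

/-- four sorted assignment -/
def q4 {M : Type w} {a b c d : Type*} (x : a → M) (y : b → M) (z : c → M) (t : d → M) : (a ⊕ b) ⊕ (c ⊕ d) → M :=
  Sum.elim (Sum.elim x y) (Sum.elim z t)

theorem Cfg.claimA (X : Cfg.{u, v, w} T) (st : Stab.{u, v, w} T) {n : ℕ} (χ : L.Formula ((Fin n ⊕ Fin n) ⊕ (Fin n ⊕ Fin n))) :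
    ∃ (P : Type) (_ : Finite P) (S : Type) (_ : Finite S) (ρ : S → L.Formula (Fin n ⊕ P)),
      ∀ (c : Fin n → X.C) (e : Fin n → X.N1), (∀ (γ : Fin n → X.C) (w : Fin n → X.N1), ¬ χ.Realize (q4 (fun i => X.dC (γ i)) (fun i => X.d1 (w i)) (fun i => X.dC (c i)) (fun i => X.d1 (e i)))) → 
      ∀ γ : Fin n → X.C, ∃ (s : S) (ν : P → X.N), ¬ (ρ s).Realize (Sum.elim e (fun i => X.i1 (ν i))) ∧
        ∀ w y : Fin n → X.N, χ.Realize (q4 γ (fun i => X.iC (w i)) c (fun i => X.iC (y i))) → (ρ s).Realize (Sum.elim y ν) := by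
  let χ1 : L.Formula ((Fin n ⊕ Fin n) ⊕ (Fin n ⊕ Fin n)) := χ.relabel 
    (Sum.elim (Sum.elim (fun i => .inr (.inl i)) (fun i => .inl (.inl i))) (Sum.elim (fun i => .inr (.inr i)) (fun i => .inl (.inr i))))
  have hχ1 : ∀ (M : Type w) [L.Structure M] (γ w c y : Fin n → M), χ1.Realize (Sum.elim (Sum.elim w y) (Sum.elim γ c)) ↔ χ.Realize (q4 γ w c y) := by
    intro M _ γ w c y
    rw [Formula.realize_relabel]
    apply rziff
    rintro ((i | i) | (i | i)) <;> rfl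
  obtain ⟨K, S, hS, δ, h⟩ := st.defset' χ1
  have hρ : ∀ s, ∃ ρ : L.Formula (Fin n ⊕ (Fin K × (Fin n ⊕ Fin n))), ∀ (M : Type w) [L.Structure M] (v : _ → M), ρ.Realize v ↔ 
     ∃ w : Fin n → M, (δ s).Realize (Sum.elim (Sum.elim w (fun i => v (.inl i))) (fun i => v (.inr i))) := by
    intro s
    refine UD.ex (L := L) (Q := fun M _ (v : (Fin n ⊕ (Fin K × (Fin n ⊕ Fin n))) ⊕ Fin n → M) => (δ s).Realize (Sum.elim (Sum.elim (fun i => v (.inr i)) (fun i => v (.inl (.inl i)))) (fun i => v (.inl (.inr i))))) ?_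
    refine (UD.formc (δ s) (Sum.elim (Sum.elim (fun i => .inr i) (fun i => .inl (.inl i))) (fun i => .inl (.inr i)))).congr (fun D _ v => ?_)
    apply rziff
    rintro ((i | i) | i) <;> rfl
  choose ρ hρ using hρ
  refine ⟨_, inferInstance, S, hS, ρ, ?_⟩
  intro c e hcon γ
  haveI := X.D.mod
  obtain ⟨s, x, hx, h1⟩ := h X.D X.D.mod {z | ∃ z' : Fin n ⊕ Fin n → X.N, z = fun i => X.d1 (X.i1 (z' i))} 
    ⟨_, fun _ => Classical.arbitrary _, rfl⟩ (Sum.elim (fun i => X.dC (γ i)) (fun i => X.dC (c i)))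
  choose x' hx' using hx
  -- extend to N1
  have h2 : ∀ z : Fin n ⊕ Fin n → X.N1, χ1.Realize (Sum.elim (fun i => X.d1 (z i)) (Sum.elim (fun i => X.dC (γ i)) (fun i => X.dC (c i)))) ↔
      (δ s).Realize (Sum.elim (fun i => X.d1 (z i)) (fun i => X.d1 (X.i1 (x' i.1 i.2)))) := by
    intro z
    by_contra hne
    let ψ : L.Formula ((Fin n ⊕ Fin n) ⊕ ((Fin n ⊕ Fin n) ⊕ (Fin K × (Fin n ⊕ Fin n)))) := 
      ((χ1.relabel (Sum.elim (fun i => .inl i) (fun i => .inr (.inl i)))).iff 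
        ((δ s).relabel (Sum.elim (fun i => .inl i) (fun i => .inr (.inr i))))).not
    have hψ : ∀ (v : Fin n ⊕ Fin n → X.D) a b, ψ.Realize (Sum.elim v (Sum.elim a b)) ↔ ¬ (χ1.Realize (Sum.elim v a) ↔ (δ s).Realize (Sum.elim v b)) := by
      intro v a b
      simp only [ψ, Formula.realize_not, Formula.realize_iff, Formula.realize_relabel]
      refine not_congr (iff_congr (rziff ?_) (rziff ?_)) <;> rintro (i | i) <;> rfl
    obtain ⟨z', hz', h3⟩ := X.fs.formula ⟨_, Classical.arbitrary _, rfl⟩ ψ _ _ (fun i => ⟨_, rfl⟩) (by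
      rintro ((i | i) | i)
      · exact Or.inl ⟨_, rfl⟩
      · exact Or.inl ⟨_, rfl⟩
      · exact Or.inr ⟨_, rfl⟩) ((hψ _ _ _).2 hne)
    choose z'' hz'' using hz'
    refine (hψ _ _ _).1 h3 ((h1 z' ⟨z'', funext fun i => (hz'' i).symm⟩).trans (rziff ?_))
    rintro (i | i)
    · rfl
    · simp [hx']
  refine ⟨s, fun i => x' i.1 i.2, ?_, ?_⟩
  · intro hr
    rw [hρ] at hr
    obtain ⟨w, hw⟩ := hr
    apply hcon γ w
    rw [← hχ1]
    have := (h2 (Sum.elim w e)).2 (by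
      rw [← X.hd1.elem.formula] at hw
      refine rz hw ?_
      rintro ((i | i) | i) <;> rfl)
    refine rz this ?_
    rintro ((i | i) | (i | i)) <;> rfl
  · intro w y hw
    rw [hρ]
    refine ⟨w, ?_⟩
    rw [← (X.hd1.comp X.hi1).elem.formula]
    rw [← X.hdC.elem.formula] at hw
    have := (h2 (fun i => X.i1 (Sum.elim w y i))).1 (by
      have e : X.dC ∘ q4 γ (fun i => X.iC (w i)) c (fun i => X.iC (y i)) = q4 (fun i => X.dC (γ i)) (fun i => X.d1 (X.i1 (w i))) (fun i => X.dC (c i)) (fun i => X.d1 (X.i1 (y i))) := by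
        ext ((i | i) | (i | i)) <;> simp [q4, X.comm]
      rw [e, ← hχ1] at hw
      refine rz hw ?_
      rintro ((i | i) | (i | i)) <;> rfl)
    refine rz this ?_
    rintro ((i | i) | i) <;> rfl

end ShelahE34
end FirstOrder

namespace FirstOrder
set_option linter.all false
open Language Structure
universe u v w u' v' w'
namespace ShelahE34
variable {L : Language.{u, v}} {T : L.Theory} {Tmc : (LPlus L).Theory}

/-- generic ultrafilter -/
structure Gen (X : Cfg.{u, v, w} T) (W : Ultrafilter (X.N1 → X.N)) : Prop where
  form : ∀ φ : (LPlus L).Formula X.N1, φ.Realize (fun x => x) → ∀ᶠ g : X.N1 → X.N in (W : Filter _), φ.Realize g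
  fix : ∀ n, ∀ᶠ g : X.N1 → X.N in (W : Filter _), g (X.i1 n) = n

theorem Gen.formL {X : Cfg.{u, v, w} T} {W : Ultrafilter (X.N1 → X.N)} (hW : Gen X W) {α β : Type u'} [Finite β] (φ : L.Formula (α ⊕ β)) 
    (e : α → X.N1) (n : β → X.N) (h : φ.Realize (Sum.elim e (fun i => X.i1 (n i)))) : ∀ᶠ g : X.N1 → X.N in (W : Filter _), φ.Realize (Sum.elim (fun i => g (e i)) n) := by
  have h1 := hW.form (LHom.sumInl.onFormula (φ.relabel (Sum.elim e (fun i => X.i1 (n i))))) (by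
    rw [red_realize, Formula.realize_relabel]; exact h)
  have h2 : ∀ᶠ g : X.N1 → X.N in (W : Filter _), ∀ i, g (X.i1 (n i)) = n i := by
    rw [Filter.eventually_all]; exact fun i => hW.fix _
  filter_upwards [h1, h2] with g h1 h2
  rw [red_realize, Formula.realize_relabel] at h1
  refine rz h1 ?_
  rintro (i | i)
  · rfl
  · simp [h2]

theorem CExt.claimQ {X : Cfg.{u, v, w} T} (Y : CExt X) (st : Stab.{u, v, w} T) {W : Ultrafilter (X.N1 → X.N)} (hW : Gen X W)
    {n : ℕ} (χ : L.Formula ((Fin n ⊕ Fin n) ⊕ (Fin n ⊕ Fin n))) (γ : Fin n → Y.G) (b' : Fin n → (X.N1 → X.N) → Y.B)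
    (c : Fin n → X.C) (e : Fin n → X.N1) 
    (h : ∀ᶠ g : X.N1 → X.N in (W : Filter _), χ.Realize (q4 γ (fun i => Y.b (b' i g)) (fun i => Y.c (c i)) (fun i => Y.b (Y.β (g (e i)))))) :
    ∃ (γ' : Fin n → X.C) (w : Fin n → X.N1), χ.Realize (q4 (fun i => X.dC (γ' i)) (fun i => X.d1 (w i)) (fun i => X.dC (c i)) (fun i => X.d1 (e i))) := by
  classical
  by_contra hcon
  push Not at hcon
  obtain ⟨P, _, S, _, ρ, hρ⟩ := X.claimA st χ
  have hA := hρ c e hcon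
  obtain ⟨f, hf, hr⟩ := exists_seq_of_forall_finset_exists (α := (Fin n → X.N) × (Fin n → Y.B) × S × (P → X.N))
    (fun x => χ.Realize (q4 γ (fun i => Y.b (x.2.1 i)) (fun i => Y.c (c i)) (fun i => Y.b (Y.β (x.1 i)))) ∧ 
      ¬ (ρ x.2.2.1).Realize (Sum.elim e (fun i => X.i1 (x.2.2.2 i))))
    (fun x y => (ρ y.2.2.1).Realize (Sum.elim x.1 y.2.2.2) ∧ ¬ (ρ x.2.2.1).Realize (Sum.elim y.1 x.2.2.2)) (by
      intro F hF
      have h1 : ∀ᶠ g : X.N1 → X.N in (W : Filter _), ∀ x : F, ¬ (ρ x.1.2.2.1).Realize (Sum.elim (fun i => g (e i)) x.1.2.2.2) := by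
        rw [Filter.eventually_all]
        intro x
        exact hW.formL (ρ x.1.2.2.1).not e x.1.2.2.2 (hF x.1 x.2).2
      obtain ⟨g, hg1, hg2⟩ := (h.and h1).exists
      -- index of the new family
      let yy : Option F → Fin n → X.N := fun o => o.elim (fun i => g (e i)) (fun x => x.1.1)
      let bb : Option F → Fin n → Y.B := fun o => o.elim (fun i => b' i g) (fun x => x.1.2.1)
      have h2 : ∀ o, χ.Realize (q4 γ (fun i => Y.b (bb o i)) (fun i => Y.c (c i)) (fun i => Y.b (Y.β (yy o i)))) := by
        rintro (_ | x)
        · exact hg1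
        · exact (hF x.1 x.2).1
      have u0 : ∀ o, UD.{u, v, w} L (fun M _ (v : (Fin n ⊕ (Option F × Fin n)) ⊕ (Fin n ⊕ (Option F × Fin n)) → M) =>
          χ.Realize (q4 (fun i => v (.inl (.inl i))) (fun i => v (.inl (.inr (o, i)))) (fun i => v (.inr (.inl i))) (fun i => v (.inr (.inr (o, i)))))) := by
        intro o
        refine (UD.formc χ (q4 (fun i => .inl (.inl i)) (fun i => .inl (.inr (o, i))) (fun i => .inr (.inl i)) (fun i => .inr (.inr (o, i))))).congr (fun D _ v => ?_)
        apply rziff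
        rintro ((i | i) | (i | i)) <;> rfl
      have u1 : UD.{u, v, w} L (fun M _ (v : (Option F × Fin n) ⊕ (Fin n ⊕ (Option F × Fin n)) → M) => ∃ z : Fin n → M, ∀ o,
          χ.Realize (q4 z (fun i => v (.inl (o, i))) (fun i => v (.inr (.inl i))) (fun i => v (.inr (.inr (o, i)))))) := by
        refine UD.ex (L := L) (Q := fun M _ (v : ((Option F × Fin n) ⊕ (Fin n ⊕ (Option F × Fin n))) ⊕ Fin n → M) =>
          ∀ o, χ.Realize (q4 (fun i => v (.inr i)) (fun i => v (.inl (.inl (o, i)))) (fun i => v (.inl (.inr (.inl i)))) (fun i => v (.inl (.inr (.inr (o, i))))))) ?_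
        refine UD.all fun o => ?_
        exact (u0 o).comp (Sum.elim (Sum.elim (fun i => (Sum.inr i : ((Option F × Fin n) ⊕ (Fin n ⊕ (Option F × Fin n))) ⊕ Fin n)) (fun i => .inl (.inl i))) (Sum.elim (fun i => .inl (.inr (.inl i))) (fun i => .inl (.inr (.inr i)))))
      obtain ⟨m, hm, z, hz⟩ := Y.fs.ud ⟨_, Classical.arbitrary _, rfl⟩ u1 (fun x => Y.b (bb x.1 x.2)) (Sum.elim (fun i => Y.c (c i)) (fun x => Y.b (Y.β (yy x.1 x.2))))
        (fun x => ⟨_, rfl⟩) (by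
          rintro (i | i)
          · exact Or.inl ⟨_, rfl⟩
          · exact Or.inr ⟨_, (Y.comm _).symm⟩) ⟨γ, h2⟩
      choose m' hm' using hm
      have hz' : ∀ o, χ.Realize (q4 z (fun i => Y.c (X.iC (m' (o, i)))) (fun i => Y.c (c i)) (fun i => Y.c (X.iC (yy o i)))) := by
        intro o
        refine rz (hz o) ?_
        rintro ((i | i) | (i | i)) <;> simp [q4, hm', Y.comm]
      have u2 : UD.{u, v, w} L (fun M _ (v : Fin n ⊕ ((Option F × Fin n) ⊕ (Fin n ⊕ (Option F × Fin n))) → M) => ∀ o,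
          χ.Realize (q4 (fun i => v (.inl i)) (fun i => v (.inr (.inl (o, i)))) (fun i => v (.inr (.inr (.inl i)))) (fun i => v (.inr (.inr (.inr (o, i))))))) := by
        refine UD.all fun o => ?_
        exact (u0 o).comp (Sum.elim (Sum.elim (fun i => (Sum.inl i : Fin n ⊕ ((Option F × Fin n) ⊕ (Fin n ⊕ (Option F × Fin n))))) (fun i => .inr (.inl i))) (Sum.elim (fun i => .inr (.inr (.inl i))) (fun i => .inr (.inr (.inr i)))))
      obtain ⟨z', hz1, hz2⟩ := (ElS.range Y.hc.elem).ud ⟨_, Classical.arbitrary _, rfl⟩ u2 z (Sum.elim (fun x => Y.c (X.iC (m' x))) (Sum.elim (fun i => Y.c (c i)) (fun x => Y.c (X.iC (yy x.1 x.2)))))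
        (by rintro (i | i | i) <;> exact ⟨_, rfl⟩) hz'
      choose γ' hγ' using hz1
      have h3 : ∀ o, χ.Realize (q4 γ' (fun i => X.iC (m' (o, i))) c (fun i => X.iC (yy o i))) := by
        intro o
        rw [← Y.hc.elem.formula]
        refine rz (hz2 o) ?_
        rintro ((i | i) | (i | i)) <;> simp [q4, hγ']
      obtain ⟨s, ν, h4, h5⟩ := hA γ'
      exact ⟨(fun i => g (e i), fun i => b' i g, s, ν), ⟨hg1, h4⟩, fun x hx => ⟨h5 _ _ (h3 (some ⟨x, hx⟩)), hg2 ⟨x, hx⟩⟩⟩)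
  obtain ⟨s, hs⟩ := Finite.exists_infinite_fiber (fun i => (f i).2.2.1)
  haveI : Infinite ((fun i => (f i).2.2.1) ⁻¹' {s}) := hs
  let j := Nat.orderEmbeddingOfSet ((fun i => (f i).2.2.1) ⁻¹' {s})
  have hj : ∀ i, (f (j i)).2.2.1 = s := fun i => (Nat.Subtype.ofNat ((fun i => (f i).2.2.1) ⁻¹' {s}) i).2
  refine st.nl.gen X.N.mod (ρ s) (fun i => (f (j i)).1) (fun i => (f (j i)).2.2.2) ?_
  intro i i' hi
  have := hr (j i) (j i') (j.lt_iff_lt.2 hi)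
  rwa [hj, hj] at this

end ShelahE34
end FirstOrder

namespace FirstOrder
set_option linter.all false
open Language Structure
universe u v w u' v' w'
namespace ShelahE34
variable {L : Language.{u, v}} {T : L.Theory} {Tmc : (LPlus L).Theory}

/-- map of ultrapowers -/
noncomputable def AM.upMap {A B : AM.{u, v, w} T} (f : A → B) {I : Type w} (U : Ultrafilter I) (x : A.up U) : B.up U :=
  B.mk' U fun i => f ((UP.out x : I → A) i)

theorem AM.upMap_mk {A B : AM.{u, v, w} T} (f : A → B) {I : Type w} (U : Ultrafilter I) (x : I → A) :
    AM.upMap f U (A.mk' U x) = B.mk' U fun i => f (x i) := by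
  unfold AM.upMap
  rw [AM.mk'_eq]
  have : ∀ᶠ i in (U : Filter I), UP.out (A.mk' U x) i = x i := by
    rw [← UP.mk_eq]; exact UP.mk_out _
  filter_upwards [this] with i hi
  rw [hi]

/-- points of H -/
noncomputable def CExt.pH {X : Cfg.{u, v, w} T} (Y : CExt X) (W : Ultrafilter (X.N1 → X.N)) : 
    (Y.G ⊕ Y.B.up W) ⊕ (X.C ⊕ X.N1) → Y.G.up W :=
  q4 (Y.G.diag W) (AM.upMap Y.b W) (fun c => Y.G.diag W (Y.c c)) (fun e => Y.G.mk' W fun g => Y.b (Y.β (g e)))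

/-- representatives -/
noncomputable def CExt.pR {X : Cfg.{u, v, w} T} (Y : CExt X) (W : Ultrafilter (X.N1 → X.N)) (g : X.N1 → X.N) : 
    (Y.G ⊕ Y.B.up W) ⊕ (X.C ⊕ X.N1) → Y.G :=
  q4 (fun x => x) (fun x => Y.b ((UP.out x : _ → Y.B) g)) Y.c (fun e => Y.b (Y.β (g e)))

theorem CExt.pH_eq {X : Cfg.{u, v, w} T} (Y : CExt X) (W : Ultrafilter (X.N1 → X.N)) :
    Y.pH W = fun ξ => Y.G.mk' W fun g => Y.pR W g ξ := by
  ext ((i | i) | (i | i)) <;> rfl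

theorem CExt.claimQ' {X : Cfg.{u, v, w} T} (Y : CExt X) (st : Stab.{u, v, w} T) {W : Ultrafilter (X.N1 → X.N)} (hW : Gen X W)
    (φ : L.Formula ((Y.G ⊕ Y.B.up W) ⊕ (X.C ⊕ X.N1))) (h : φ.Realize (Y.pH W)) :
    ∃ zw : (Y.G → X.C) × (Y.B.up W → X.N1), φ.Realize (q4 (fun x => X.dC (zw.1 x)) (fun x => X.d1 (zw.2 x)) X.dC X.d1) := by
  classical
  obtain ⟨n, f, ψ, hf, hψ⟩ := finvar.{u, v, w} φ
  rw [CExt.pH_eq, AM.los] at h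
  let srt : Fin n → ((Y.G ⊕ Y.B.up W) ⊕ (X.C ⊕ X.N1)) → ((Fin n ⊕ Fin n) ⊕ (Fin n ⊕ Fin n)) := fun i => 
    Sum.elim (Sum.elim (fun _ => .inl (.inl i)) (fun _ => .inl (.inr i))) (Sum.elim (fun _ => .inr (.inl i)) (fun _ => .inr (.inr i)))
  let χ := ψ.relabel (fun i => srt i (f i))
  let dG : Y.G := Classical.arbitrary _
  let dB : Y.B.up W := Classical.arbitrary _
  let dC : X.C := Classical.arbitrary _
  let dN : X.N1 := Classical.arbitrary _
  obtain ⟨γ', w, h1⟩ := Y.claimQ st hW χ (fun i => Sum.elim (Sum.elim (fun x => x) (fun _ => dG)) (fun _ => dG) (f i))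
    (fun i => (UP.out (Sum.elim (Sum.elim (fun _ => dB) (fun x => x)) (fun _ => dB) (f i)) : _ → Y.B))
    (fun i => Sum.elim (fun _ => dC) (Sum.elim (fun x => x) (fun _ => dC)) (f i))
    (fun i => Sum.elim (fun _ => dN) (Sum.elim (fun _ => dN) (fun x => x)) (f i)) (by
      filter_upwards [h] with g hg
      rw [Formula.realize_relabel]
      refine rz ((hψ _ _).1 hg) ?_
      intro i
      simp only [Function.comp, srt]
      rcases hi : f i with (x | x) | (x | x) <;> simp [q4, CExt.pR, hi] <;> rfl)
  refine ⟨(fun x => if h : ∃ i, f i = .inl (.inl x) then γ' h.choose else dC, 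
    fun x => if h : ∃ i, f i = .inl (.inr x) then w h.choose else dN), ?_⟩
  rw [hψ]
  rw [Formula.realize_relabel] at h1
  refine rz h1 ?_
  intro i
  simp only [Function.comp, srt]
  rcases hi : f i with (x | x) | (x | x)
  · have hx : ∃ i, f i = .inl (.inl x) := ⟨i, hi⟩
    have : hx.choose = i := hf (hx.choose_spec.trans hi.symm)
    simp [q4, hx, this]
  · have hx : ∃ i, f i = .inl (.inr x) := ⟨i, hi⟩
    have : hx.choose = i := hf (hx.choose_spec.trans hi.symm)
    simp [q4, hx, this]
  · simp [q4, hi]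
  · simp [q4, hi]

theorem CExt.exZ {X : Cfg.{u, v, w} T} (Y : CExt X) (st : Stab.{u, v, w} T) {W : Ultrafilter (X.N1 → X.N)} (hW : Gen X W) :
    ∃ Z : Ultrafilter ((Y.G → X.C) × (Y.B.up W → X.N1)), ∀ φ : L.Formula ((Y.G ⊕ Y.B.up W) ⊕ (X.C ⊕ X.N1)), φ.Realize (Y.pH W) ↔
      ∀ᶠ zw : (Y.G → X.C) × (Y.B.up W → X.N1) in (Z : Filter _), φ.Realize (q4 (fun x => X.dC (zw.1 x)) (fun x => X.d1 (zw.2 x)) X.dC X.d1) := by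
  obtain ⟨Z, hZ⟩ := exists_uf_formula (L := L) (Y.pH W) (I := (Y.G → X.C) × (Y.B.up W → X.N1)) 
    (fun zw φ => φ.Realize (q4 (fun x => X.dC (zw.1 x)) (fun x => X.d1 (zw.2 x)) X.dC X.d1)) 
    (fun i φ ψ h => Formula.realize_inf.1 h) (Y.claimQ' st hW)
  refine ⟨Z, fun φ => ⟨hZ φ, fun h => ?_⟩⟩
  by_contra hn
  have := hZ φ.not hn
  obtain ⟨x, h1, h2⟩ := (h.and this).exists
  exact h2 h1

end ShelahE34
end FirstOrder

namespace FirstOrder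
set_option linter.all false
open Language Structure
universe u v w u' v' w'
namespace ShelahE34
variable {L : Language.{u, v}} {T : L.Theory} {Tmc : (LPlus L).Theory}

theorem CExt.pH_sigma {X : Cfg.{u, v, w} T} (Y : CExt X) {W : Ultrafilter (X.N1 → X.N)} (hW : Gen X W) 
    (ξ : (Y.G ⊕ Y.B.up W) ⊕ (X.C ⊕ X.N1)) : (Y.G.up W).σ (Y.pH W ξ) = Y.pH W (Sum.map (Sum.map Y.G.σ (Y.B.up W).σ) (Sum.map X.C.σ X.N1.σ) ξ) := by
  rcases ξ with (x | x) | (x | x)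
  · rfl
  · obtain ⟨y, rfl⟩ := Y.B.up_surj W x
    show (Y.G.up W).σ (AM.upMap Y.b W (Y.B.mk' W y)) = AM.upMap Y.b W ((Y.B.up W).σ (Y.B.mk' W y))
    rw [AM.up_sigma, AM.upMap_mk, AM.upMap_mk, AM.up_sigma]
    simp only [Y.hb.comm]
  · show (Y.G.up W).σ (Y.G.diag W (Y.c x)) = Y.G.diag W (Y.c (X.C.σ x))
    rw [Y.hc.comm]; rfl
  · show (Y.G.up W).σ (Y.G.mk' W fun g => Y.b (Y.β (g x))) = Y.G.mk' W fun g => Y.b (Y.β (g (X.N1.σ x)))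
    rw [AM.up_sigma, AM.mk'_eq]
    have := hW.form (Term.equal (sigmaTerm (Term.var x)) (Term.var (X.N1.σ x))) (by
      rw [Formula.realize_equal, AM.realize_sigmaTerm]; rfl)
    filter_upwards [this] with g hg
    rw [Formula.realize_equal, AM.realize_sigmaTerm] at hg
    simp only [Term.realize_var] at hg
    rw [← hg, Y.hβ.comm, Y.hb.comm]

theorem CExt.pE_sigma {X : Cfg.{u, v, w} T} (Y : CExt X) (st : Stab.{u, v, w} T) {W : Ultrafilter (X.N1 → X.N)} (hW : Gen X W)
    (Z : Ultrafilter ((Y.G → X.C) × (Y.B.up W → X.N1))) (hZ : ∀ φ : L.Formula ((Y.G ⊕ Y.B.up W) ⊕ (X.C ⊕ X.N1)), φ.Realize (Y.pH W) ↔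
      ∀ᶠ zw : (Y.G → X.C) × (Y.B.up W → X.N1) in (Z : Filter _), φ.Realize (q4 (fun x => X.dC (zw.1 x)) (fun x => X.d1 (zw.2 x)) X.dC X.d1))
    (φ : L.Formula ((Y.G ⊕ Y.B.up W) ⊕ X.D)) 
    (h : ∀ᶠ zw : (Y.G → X.C) × (Y.B.up W → X.N1) in (Z : Filter _), φ.Realize (Sum.elim (Sum.elim (fun x => X.dC (zw.1 x)) (fun x => X.d1 (zw.2 x))) (fun x => x))) :
    ∀ᶠ zw : (Y.G → X.C) × (Y.B.up W → X.N1) in (Z : Filter _), φ.Realize (Sum.elim (Sum.elim (fun x => X.dC (zw.1 (Y.G.σ x))) (fun x => X.d1 (zw.2 ((Y.B.up W).σ x)))) (fun x => X.D.σ x)) := by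
  obtain ⟨p, q, f, g, χ, hf, hg, hχ⟩ := finvars.{u, v, w} φ
  obtain ⟨K, S, hS, δ, hδ⟩ := st.defset' χ
  let pt : (Y.G → X.C) → (Y.B.up W → X.N1) → Fin p → X.D := fun z w i => Sum.elim (fun x => X.dC (z x)) (fun x => X.d1 (w x)) (f i)
  obtain ⟨s, x, hx, h1⟩ := hδ X.D X.D.mod {y | ∃ z w, y = pt z w} ⟨_, fun _ => Classical.arbitrary _, fun _ => Classical.arbitrary _, rfl⟩
    (fun i => g i)
  choose z w hzw using hx
  obtain rfl : x = fun k => pt (z k) (w k) := funext hzw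
  let θ : L.Formula ((Y.G ⊕ Y.B.up W) ⊕ (X.C ⊕ X.N1)) := (δ s).relabel (Sum.elim (fun i => .inl (f i)) (fun k => .inr (Sum.map (z k.1) (w k.1) (f k.2))))
  have hθ1 : ∀ zw : (Y.G → X.C) × (Y.B.up W → X.N1), φ.Realize (Sum.elim (Sum.elim (fun x => X.dC (zw.1 x)) (fun x => X.d1 (zw.2 x))) (fun x => x)) ↔ 
     θ.Realize (q4 (fun x => X.dC (zw.1 x)) (fun x => X.d1 (zw.2 x)) X.dC X.d1) := by
    intro zw
    rw [hχ, Formula.realize_relabel]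
    refine Iff.trans (Iff.trans (rziff ?_) (h1 (pt zw.1 zw.2) ⟨_, _, rfl⟩)) (rziff ?_)
    · rintro (i | i) <;> rfl
    · rintro (i | ⟨k, i⟩)
      · rfl
      · simp only [Sum.elim_inr, Function.comp, q4, pt]
        rcases f i with y | y <;> rfl
  have h2 : θ.Realize (Y.pH W) := by
    rw [hZ]
    filter_upwards [h] with zw hzw
    exact (hθ1 zw).1 hzw
  rw [← (Y.G.up W).sigma_elem.formula'] at h2
  simp only [Y.pH_sigma hW] at h2
  let s4 : (Y.G ⊕ Y.B.up W) ⊕ (X.C ⊕ X.N1) → (Y.G ⊕ Y.B.up W) ⊕ (X.C ⊕ X.N1) := Sum.map (Sum.map Y.G.σ (Y.B.up W).σ) (Sum.map X.C.σ X.N1.σ)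
  have h3 : (θ.relabel s4).Realize (Y.pH W) := by
    rw [Formula.realize_relabel]; exact h2
  rw [hZ] at h3
  filter_upwards [h3] with zw h3
  -- apply σ⁻¹
  have h4 := hθ1 (fun x => X.C.σ.symm (zw.1 (Y.G.σ x)), fun x => X.N1.σ.symm (zw.2 ((Y.B.up W).σ x)))
  have h5 := h4.2 (by
    rw [← X.D.sigma_elem.formula]
    rw [Formula.realize_relabel] at h3
    refine rz h3 ?_
    rintro ((i | i) | (i | i))
    · show X.dC (zw.1 (Y.G.σ i)) = X.D.σ (X.dC (X.C.σ.symm (zw.1 (Y.G.σ i))))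
      rw [← X.hdC.comm]; simp
    · show X.d1 (zw.2 ((Y.B.up W).σ i)) = X.D.σ (X.d1 (X.N1.σ.symm (zw.2 ((Y.B.up W).σ i))))
      rw [← X.hd1.comm]; simp
    · show X.dC (X.C.σ i) = X.D.σ (X.dC i)
      rw [← X.hdC.comm]
    · show X.d1 (X.N1.σ i) = X.D.σ (X.d1 i)
      rw [← X.hd1.comm])
  rw [← X.D.sigma_elem.formula] at h5
  refine rz h5 ?_
  rintro ((i | i) | i)
  · show X.D.σ (X.dC (X.C.σ.symm (zw.1 (Y.G.σ i)))) = X.dC (zw.1 (Y.G.σ i))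
    rw [← X.hdC.comm]; simp
  · show X.D.σ (X.d1 (X.N1.σ.symm (zw.2 ((Y.B.up W).σ i)))) = X.d1 (zw.2 ((Y.B.up W).σ i))
    rw [← X.hd1.comm]; simp
  · rfl

theorem CExt.step {X : Cfg.{u, v, w} T} (Y : CExt X) (st : Stab.{u, v, w} T) {W : Ultrafilter (X.N1 → X.N)} (hW : Gen X W) :
    ∃ (K : AM.{u, v, w} T) (kG : Y.G → K) (kB : Y.B.up W → K) (kD : X.D → K), IsHom kG ∧ IsHom kB ∧ IsHom kD ∧
      (∀ x, kG (Y.c x) = kD (X.dC x)) ∧ (∀ e, kD (X.d1 e) = kB (Y.B.mk' W fun g => Y.β (g e))) ∧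
      (∀ x, kB (Y.B.diag W x) = kG (Y.b x)) ∧
      FS L (Set.range kB) (Set.range fun x => kG (Y.c x)) (Set.range fun n => kG (Y.c (X.iC n))) := by
  obtain ⟨Z, hZ⟩ := Y.exZ st hW
  let E := X.D.up Z
  let uu : Y.G → E := fun x => X.D.mk' Z fun zw => X.dC (zw.1 x)
  let vv : Y.B.up W → E := fun x => X.D.mk' Z fun zw => X.d1 (zw.2 x)
  let p : (Y.G ⊕ Y.B.up W) ⊕ X.D → E := Sum.elim (Sum.elim uu vv) (X.D.diag Z)
  let q : (Y.G ⊕ Y.B.up W) ⊕ X.D → E := Sum.elim (Sum.elim (fun x => uu (Y.G.σ x)) (fun x => vv ((Y.B.up W).σ x))) (fun x => X.D.diag Z (X.D.σ x))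
  have hpq : ∀ φ : L.Formula ((Y.G ⊕ Y.B.up W) ⊕ X.D), φ.Realize p → φ.Realize q := by
    intro φ hφ
    have hφ' : φ.Realize (fun ξ => X.D.mk' Z fun zw => Sum.elim (Sum.elim (fun x => X.dC (zw.1 x)) (fun x => X.d1 (zw.2 x))) (fun x => x) ξ) := by
      refine rz hφ ?_
      rintro ((i | i) | i) <;> rfl
    rw [AM.los] at hφ'
    have := Y.pE_sigma st hW Z hZ φ hφ'
    rw [← AM.los] at this
    refine rz this ?_
    rintro ((i | i) | i) <;> rfl
  obtain ⟨E', _, i, s, hi, hs⟩ := aut_lemma p q hpq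
  haveI : Nonempty E' := ⟨i (Classical.arbitrary _)⟩
  let K : AM.{u, v, w} T := AM.of E' ((hi.model T).1 E.mod) s
  have hE : ∀ φ : L.Formula ((Y.G ⊕ Y.B.up W) ⊕ (X.C ⊕ X.N1)), φ.Realize (Y.pH W) ↔ 
      φ.Realize (M := K) (q4 (fun x => i (uu x)) (fun x => i (vv x)) (fun x => i (X.D.diag Z (X.dC x))) (fun x => i (X.D.diag Z (X.d1 x)))) := by
    intro φ
    rw [hZ, ← AM.los]
    refine Iff.trans (hi.formula' φ _).symm ?_
    apply rziff
    rintro ((i | i) | (i | i)) <;> rfl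
  have hEeq : ∀ ξ ξ', Y.pH W ξ = Y.pH W ξ' → q4 (M := K) (fun x => i (uu x)) (fun x => i (vv x)) (fun x => i (X.D.diag Z (X.dC x))) (fun x => i (X.D.diag Z (X.d1 x))) ξ = 
     q4 (M := K) (fun x => i (uu x)) (fun x => i (vv x)) (fun x => i (X.D.diag Z (X.dC x))) (fun x => i (X.D.diag Z (X.d1 x))) ξ' := by
    intro ξ ξ' h
    have := (hE (Term.equal (Term.var ξ) (Term.var ξ'))).1 ((realize_eq_of_vars _ _ _).2 h)
    exact (realize_eq_of_vars _ _ _).1 this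
  have hbB : IsElem L (AM.upMap Y.b W) := by
    intro n φ x
    choose y hy using fun i => Y.B.up_surj W (x i)
    obtain rfl : (fun i => Y.B.mk' W (y i)) = x := funext hy
    rw [AM.los]
    have : (AM.upMap Y.b W ∘ fun i => Y.B.mk' W (y i)) = fun i => Y.G.mk' W (fun g => Y.b (y i g)) := by
      ext i; exact AM.upMap_mk _ _ _
    rw [this, AM.los]
    apply Filter.eventually_congr
    filter_upwards with g
    exact Y.hb.elem.formula' φ (fun a => y a g)
  refine ⟨K, fun x => i (uu x), fun x => i (vv x), fun x => i (X.D.diag Z x), ⟨?_, ?_⟩, ⟨?_, ?_⟩, ⟨?_, ?_⟩, ?_, ?_, ?_, ?_⟩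
  · intro n φ x
    have := hE (φ.relabel fun i => .inl (.inl (x i)))
    rw [Formula.realize_relabel, Formula.realize_relabel] at this
    refine Iff.trans (rziff ?_) (this.symm.trans ((rziff ?_).trans ((IsHom.of_elem (Y.G.diag_elem W)).elem.formula φ x)))
    · intro a; rfl
    · intro a; rfl
  · intro x; exact (hs (.inl (.inl x))).symm
  · intro n φ x
    have := hE (φ.relabel fun i => .inl (.inr (x i)))
    rw [Formula.realize_relabel, Formula.realize_relabel] at this
    refine Iff.trans (rziff ?_) (this.symm.trans ((rziff ?_).trans (hbB.formula φ x)))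
    · intro a; rfl
    · intro a; rfl
  · intro x; exact (hs (.inl (.inr x))).symm
  · exact hi.comp (IsHom.of_elem (X.D.diag_elem Z)).elem
  · intro x; exact (hs (.inr x)).symm
  · intro x; exact hEeq (.inl (.inl (Y.c x))) (.inr (.inl x)) rfl
  · intro x; exact hEeq (.inr (.inr x)) (.inl (.inr _)) (AM.upMap_mk _ _ _).symm
  · intro x; exact hEeq (.inl (.inr _)) (.inl (.inl (Y.b x))) (AM.upMap_mk _ _ _)
  · intro m n φ a b ha hb hφ
    choose a' ha' using ha
    have hb2 : ∀ j, ∃ x, i (uu (Y.c x)) = b j := by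
      intro j
      rcases hb j with ⟨x, hx⟩ | ⟨x, hx⟩
      · exact ⟨x, hx⟩
      · exact ⟨_, hx⟩
    choose b' hb' using hb2
    obtain rfl : (fun j => i (vv (a' j))) = a := funext ha'
    obtain rfl : (fun j => i (uu (Y.c (b' j)))) = b := funext hb'
    have h1 := (hE (φ.relabel (Sum.elim (fun j => .inl (.inr (a' j))) (fun j => .inl (.inl (Y.c (b' j))))))).2 (by
      rw [Formula.realize_relabel]
      refine rz hφ ?_
      rintro (j | j) <;> rfl)
    rw [Y.pH_eq, AM.los] at h1
    obtain ⟨g, hg⟩ := h1.exists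
    rw [Formula.realize_relabel] at hg
    obtain ⟨d, hd, h2⟩ := Y.fs m n φ (fun j => Y.b ((UP.out (a' j) : _ → Y.B) g)) (fun j => Y.c (b' j)) (fun j => ⟨_, rfl⟩) (fun j => Or.inl ⟨_, rfl⟩) (by
      refine rz hg ?_
      rintro (j | j) <;> rfl)
    choose d' hd' using hd
    obtain rfl : (fun j => Y.c (X.iC (d' j))) = d := funext hd'
    refine ⟨fun j => i (uu (Y.c (X.iC (d' j)))), fun j => ⟨_, rfl⟩, ?_⟩
    rw [← (IsHom.of_elem (Y.G.diag_elem W)).elem.formula] at h2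
    have h3 := (hE (φ.relabel (Sum.elim (fun j => .inl (.inl (Y.c (X.iC (d' j))))) (fun j => .inl (.inl (Y.c (b' j))))))).1 (by
      rw [Formula.realize_relabel]
      refine rz h2 ?_
      rintro (j | j) <;> rfl)
    rw [Formula.realize_relabel] at h3
    refine rz h3 ?_
    rintro (j | j) <;> rfl

end ShelahE34
end FirstOrder

namespace FirstOrder
set_option linter.all false
open Language Structure
universe u v w u' v' w'
namespace ShelahE34
variable {L : Language.{u, v}} {T : L.Theory} {Tmc : (LPlus L).Theory}

/-- loop invariant -/
structure Loop (X : Cfg.{u, v, w} T) {ny : ℕ} (a : Fin ny → X.N1) (R : Set (Fin ny → X.N)) (m : ℕ) where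
  Y : CExt X
  el : IsElem (LPlus L) Y.β
  s : Fin m → Fin ny → Y.B
  hD : ∀ i, ∃ f : X.D → Y.G, IsHom f ∧ (∀ x, f (X.dC x) = Y.c x) ∧ ∀ j, f (X.d1 (a j)) = Y.b (s i j)
  nr : ∀ i, ∀ r ∈ R, s i ≠ fun j => Y.β (r j)
  P : ∀ θ : (LPlus L).Formula ((Fin m × Fin ny) ⊕ X.N), θ.Realize (Sum.elim (fun i => s i.1 i.2) Y.β) →
    ∃ r : Fin m → Fin ny → X.N, Function.Injective r ∧ (∀ i, r i ∈ R) ∧ θ.Realize (Sum.elim (fun i => r i.1 i.2) (fun n => n))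

theorem Loop.zero (X : Cfg.{u, v, w} T) {ny : ℕ} (a : Fin ny → X.N1) (R : Set (Fin ny → X.N)) : Nonempty (Loop X a R 0) := by
  refine ⟨⟨⟨X.N, X.C, fun n => n, X.iC, fun n => n, IsHom.ident, X.hiC, IsHom.ident, fun _ => rfl, ?_⟩, 
    IsElem.ident, fun i => i.elim0, fun i => i.elim0, fun i => i.elim0, ?_⟩⟩
  · intro p q φ a b ha hb hφ
    exact ⟨a, ha, hφ⟩
  · intro θ hθ
    refine ⟨fun i => i.elim0, fun i => i.elim0, fun i => i.elim0, rz hθ ?_⟩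
    rintro (⟨i, j⟩ | i)
    · exact i.elim0
    · rfl

theorem Loop.succ (st : Stab.{u, v, w} T) {X : Cfg.{u, v, w} T} {W : Ultrafilter (X.N1 → X.N)} (hW : Gen X W) {ny : ℕ} 
    {a : Fin ny → X.N1} {R : Set (Fin ny → X.N)}
    (hR : ∀ᶠ g : X.N1 → X.N in (W : Filter _), (fun i => g (a i)) ∈ R) (haR : ∀ r ∈ R, (fun i => X.i1 (r i)) ≠ a) {m : ℕ} (Λ : Loop X a R m) :
    Nonempty (Loop X a R (m+1)) := by
  classical
  obtain ⟨Y, el, s, hD, nr, P⟩ := Λ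
  obtain ⟨K, kG, kB, kD, hG, hB, hDD, e1, e2, e3, fs⟩ := Y.step st hW
  have elb : IsElem (LPlus L) (fun n => Y.B.diag W (Y.β n)) := (Y.B.diag_elem W).comp el
  let Y' : CExt X := ⟨Y.B.up W, K, fun n => Y.B.diag W (Y.β n), kB, fun x => kG (Y.c x), IsHom.of_elem elb, hB, hG.comp Y.hc,
    fun n => by rw [e3, Y.comm], fs⟩
  let s' : Fin (m+1) → Fin ny → Y.B.up W := Fin.lastCases (motive := fun _ => Fin ny → Y.B.up W) (fun j => Y.B.mk' W fun g => Y.β (g (a j))) (fun i j => Y.B.diag W (s i j))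
  have hs1 : ∀ j, s' (Fin.last m) j = Y.B.mk' W fun g => Y.β (g (a j)) := fun j => by simp [s']
  have hs2 : ∀ i j, s' (Fin.castSucc i) j = Y.B.diag W (s i j) := fun i j => by simp [s']
  refine ⟨⟨Y', elb, s', ?_, ?_, ?_⟩⟩
  · intro i
    refine Fin.lastCases ?_ (fun i => ?_) i
    · refine ⟨kD, hDD, fun x => (e1 x).symm, fun j => ?_⟩
      rw [hs1]; exact e2 _
    · obtain ⟨f, hf, h1, h2⟩ := hD i
      refine ⟨fun x => kG (f x), hG.comp hf, fun x => ?_, fun j => ?_⟩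
      · show kG (f (X.dC x)) = kG (Y.c x)
        rw [h1]
      · show kG (f _) = kB (s' _ j)
        rw [h2, hs2, e3]
  · intro i r hr
    refine Fin.lastCases ?_ (fun i => ?_) i
    · intro h
      have h1 : ∀ᶠ g : X.N1 → X.N in (W : Filter _), ∀ j, Y.β (g (a j)) = Y.β (r j) := by
        rw [Filter.eventually_all]
        intro j
        rw [← AM.mk'_eq]
        exact (hs1 j).symm.trans (congrFun h j)
      apply haR r hr
      ext j
      by_contra hne
      have h2 := hW.form ((Term.equal (Term.var (X.i1 (r j))) (Term.var (a j))).not) (by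
        rw [Formula.realize_not, Formula.realize_equal]; exact hne)
      obtain ⟨g, h1, h2, h3⟩ := (h1.and (h2.and (hW.fix (r j)))).exists
      rw [Formula.realize_not, Formula.realize_equal] at h2
      apply h2
      simp only [Term.realize_var]
      rw [h3]
      exact (el.inj (h1 j)).symm
    · intro h
      apply nr i r hr
      ext j
      have := congrFun h j
      rw [hs2] at this
      exact (Y.B.diag_elem W).inj this
  · intro θ hθ
    have h1 : ∀ᶠ g : X.N1 → X.N in (W : Filter _), θ.Realize (Sum.elim (fun i => Fin.lastCases (motive := fun _ => Fin ny → Y.B) (fun j => Y.β (g (a j))) s i.1 i.2) Y.β) := by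
      have : θ.Realize (fun ξ => Y.B.mk' W fun g => (Sum.elim (fun i => Fin.lastCases (motive := fun _ => Fin ny → Y.B) (fun j => Y.β (g (a j))) s i.1 i.2) Y.β) ξ) := by
        refine rz hθ ?_
        rintro (⟨i, j⟩ | i)
        · refine Fin.lastCases ?_ (fun i => ?_) i
          · simp only [Sum.elim_inl, hs1, Fin.lastCases_last]
          · simp only [Sum.elim_inl, hs2, Fin.lastCases_castSucc]; rfl
        · rfl
      rwa [AM.los_plus] at this
    obtain ⟨g, h1, h2⟩ := (h1.and hR).exists
    let r0 : Fin ny → X.N := fun j => g (a j)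
    have ud : UD.{_, _, w} (LPlus L) (fun M _ (v : (Fin m × Fin ny) ⊕ X.N → M) => 
        θ.Realize (Sum.elim (fun i => Fin.lastCases (motive := fun _ => Fin ny → M) (fun j => v (.inr (r0 j))) (fun i j => v (.inl (i, j))) i.1 i.2) (fun n => v (.inr n))) ∧
        ∀ i, ¬ ∀ j, v (.inl (i, j)) = v (.inr (r0 j))) := by
      refine UD.and ?_ (UD.all fun i => UD.not (UD.all fun j => ?_))
      · refine (UD.formc θ (Sum.elim (fun i => Fin.lastCases (motive := fun _ => Fin ny → (Fin m × Fin ny) ⊕ X.N) (fun j => .inr (r0 j)) (fun i j => .inl (i, j)) i.1 i.2) (fun n => .inr n))).congr (fun D _ v => ?_)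
        apply rziff
        rintro (⟨i, j⟩ | i)
        · refine Fin.lastCases ?_ (fun i => ?_) i <;> simp
        · rfl
      · exact ⟨Term.equal (Term.var (.inl (i, j))) (Term.var (.inr (r0 j))), fun D _ v => realize_eq_of_vars _ _ _⟩
    obtain ⟨ψ, hψ⟩ := ud
    obtain ⟨r, hr1, hr2, hr3⟩ := P ψ (by
      rw [hψ]
      refine ⟨rz h1 ?_, ?_⟩
      · rintro (⟨i, j⟩ | i)
        · refine Fin.lastCases ?_ (fun i => ?_) i <;> simp [r0]
        · rfl
      · intro i hi
        exact nr i r0 h2 (funext hi))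
    rw [hψ] at hr3
    refine ⟨Fin.lastCases (motive := fun _ => Fin ny → X.N) r0 r, ?_, ?_, ?_⟩
    · intro i i'
      refine Fin.lastCases ?_ (fun i => ?_) i <;> refine Fin.lastCases ?_ (fun i' => ?_) i'
      · simp
      · simp only [Fin.lastCases_last, Fin.lastCases_castSucc]
        intro h
        exact absurd (fun j => (congrFun h j).symm) (hr3.2 i')
      · simp only [Fin.lastCases_last, Fin.lastCases_castSucc]
        intro h
        exact absurd (fun j => (congrFun h j)) (hr3.2 i)
      · simp only [Fin.lastCases_castSucc]
        intro h
        rw [hr1 h]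
    · intro i
      refine Fin.lastCases ?_ (fun i => ?_) i
      · simpa using h2
      · simpa using hr2 i
    · refine rz hr3.1 ?_
      rintro (⟨i, j⟩ | i)
      · refine Fin.lastCases ?_ (fun i => ?_) i <;> simp
      · rfl

theorem amalgamation (h : MC.{u, v, w} T Tmc) (st : Stab.{u, v, w} T) (X : Cfg.{u, v, w} T) {W : Ultrafilter (X.N1 → X.N)} (hW : Gen X W)
    (hN : X.N ⊨ Tmc) {nx ny : ℕ} (φ : (LPlus L).Formula (Fin nx ⊕ Fin ny)) (a : Fin ny → X.N1) (R : Set (Fin ny → X.N))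
    (hR : ∀ᶠ g : X.N1 → X.N in (W : Filter _), (fun i => g (a i)) ∈ R) (haR : ∀ r ∈ R, (fun i => X.i1 (r i)) ≠ a) 
    (c : Fin nx → X.C) (D' : AM.{u, v, w} T) (f : X.D → D') (hf : IsHom f) (hD' : D' ⊨ Tmc) 
    (hφ : φ.Realize (Sum.elim (fun i => f (X.dC (c i))) (fun i => f (X.d1 (a i))))) (k : ℕ) : 
    ∃ r : Fin k → Fin ny → X.N, Function.Injective r ∧ (∀ i, r i ∈ R) ∧ ∃ x : Fin nx → X.N, ∀ i, φ.Realize (Sum.elim x (r i)) := by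
  have hk : Nonempty (Loop X a R k) := by
    induction k with
    | zero => exact Loop.zero X a R
    | succ m ih => obtain ⟨Λ⟩ := ih; exact Λ.succ st hW hR haR
  obtain ⟨⟨Y, el, s, hD, nr, P⟩⟩ := hk
  obtain ⟨K, j, hK, hj⟩ := h.ext Y.G
  have hB : Y.B ⊨ Tmc := (el.model Tmc).1 hN
  have hjb : IsElem (LPlus L) (j ∘ Y.b) := h.elem (hj.comp Y.hb) hB hK
  have h1 : ∀ i, φ.Realize (Sum.elim (fun l => j (Y.c (c l))) (fun l => j (Y.b (s i l)))) := by
    intro i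
    obtain ⟨f', hf', e1, e2⟩ := hD i
    have := (h.same hf (hj.comp hf') hD' hK (φ.relabel (Sum.elim (fun l => X.dC (c l)) (fun l => X.d1 (a l))))).1 (by
      rw [Formula.realize_relabel]
      refine rz hφ ?_
      rintro (i | i) <;> rfl)
    rw [Formula.realize_relabel] at this
    refine rz this ?_
    rintro (i | i) <;> simp [e1, e2]
  have ud : UD.{_, _, w} (LPlus L) (fun M _ (v : (Fin k × Fin ny) ⊕ X.N → M) => ∃ x : Fin nx → M, ∀ i, φ.Realize (Sum.elim x (fun l => v (.inl (i, l))))) := by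
    refine UD.ex (L := LPlus L) (Q := fun M _ (v : ((Fin k × Fin ny) ⊕ X.N) ⊕ Fin nx → M) => ∀ i, φ.Realize (Sum.elim (fun l => v (.inr l)) (fun l => v (.inl (.inl (i, l)))))) ?_
    refine UD.all fun i => ?_
    refine (UD.formc φ (Sum.elim (fun l => .inr l) (fun l => .inl (.inl (i, l))))).congr (fun D _ v => ?_)
    apply rziff
    rintro (i | i) <;> rfl
  obtain ⟨ψ, hψ⟩ := ud
  obtain ⟨r, hr1, hr2, hr3⟩ := P ψ (by
    rw [← hjb.formula]
    rw [hψ]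
    exact ⟨fun l => j (Y.c (c l)), h1⟩)
  rw [hψ] at hr3
  exact ⟨r, hr1, hr2, hr3⟩

end ShelahE34
end FirstOrder

namespace FirstOrder
set_option linter.all false
open Language Structure
universe u v w u' v' w'
namespace ShelahE34
variable {L : Language.{u, v}} {T : L.Theory} {Tmc : (LPlus L).Theory}

theorem ElS.tv {D : Type w} [L.Structure D] {S : Set D} (h : ElS L S) :
    ∀ (n : ℕ) (φ : L.Formula (Fin n ⊕ Unit)) (x : Fin n → D) (d : D), (∀ i, x i ∈ S) →
      φ.Realize (Sum.elim x fun _ => d) → ∃ s ∈ S, φ.Realize (Sum.elim x fun _ => s) := by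
  intro n φ x d hx hφ
  have e : ∀ d : D, (φ.relabel (Sum.elim (fun i => Sum.inr i) (fun _ => Sum.inl 0) : Fin n ⊕ Unit → Fin 1 ⊕ Fin n)).Realize (Sum.elim (fun _ => d) x) ↔ φ.Realize (Sum.elim x fun _ => d) := by
    intro d
    rw [Formula.realize_relabel]
    apply iff_of_eq; congr 1; funext i
    rcases i with i | i <;> rfl
  obtain ⟨a, ha, h1⟩ := h 1 n (φ.relabel (Sum.elim (fun i => Sum.inr i) (fun _ => Sum.inl 0))) (fun _ => d) x hx ((e d).2 hφ)
  refine ⟨a 0, ha 0, (e _).1 ?_⟩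
  convert h1 using 2
  funext i; rw [Subsingleton.elim i 0]

/-- elementary subsets in the big language are submodels -/
theorem AM.sub_plus (D : AM.{u, v, w} T) (S : Set D) (hS : ElS (LPlus L) S) (hne : S.Nonempty) :
    ∃ (A : AM.{u, v, w} T) (ι : A → D), IsElem (LPlus L) ι ∧ Set.range ι = S := by
  obtain ⟨C, sC, ι, hι, hr⟩ := exists_elem_sub (L := LPlus L) S hS.tv
  obtain ⟨s, hs⟩ := hne
  rw [← hr] at hs
  obtain ⟨c, rfl⟩ := hs
  haveI : Nonempty C := ⟨c⟩
  obtain ⟨A, e, _⟩ := AM.of_model (T := T) C ((hι.model _).2 D.taut)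
  refine ⟨A, ι ∘ e, hι.comp (IsElem.of_equiv e), ?_⟩
  rw [Set.range_comp, e.surjective.range_eq, Set.image_univ, hr]

theorem AM.sub_sc (D : AM.{u, v, w} T) (S : Set D) (hS : ElS L S) (hne : S.Nonempty) (sc : SC D S) :
    ∃ (A : AM.{u, v, w} T) (ι : A → D), IsHom ι ∧ Set.range ι = S := by
  obtain ⟨C, sC, ι, hι, hr⟩ := exists_elem_sub (L := L) S hS.tv
  obtain ⟨s, hs⟩ := hne
  have hs' := hs
  rw [← hr] at hs
  obtain ⟨c, rfl⟩ := hs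
  haveI : Nonempty C := ⟨c⟩
  have h1 : ∀ x : C, ∃ y : C, ι y = D.σ (ι x) := by
    intro x
    have : D.σ (ι x) ∈ Set.range ι := by
      rw [hr, sc, ← hr]; exact ⟨x, rfl⟩
    exact this
  have h2 : ∀ x : C, ∃ y : C, D.σ (ι y) = (ι x) := by
    intro x
    have : D.σ.symm (ι x) ∈ Set.range ι := by
      rw [hr, ← sc, ← hr]; exact ⟨x, by simp⟩
    obtain ⟨y, hy⟩ := this
    exact ⟨y, by rw [hy]; simp⟩
  choose f hf using h1
  choose g hg using h2
  have hfe : IsElem L f := by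
    refine IsElem.of_comp hι ?_
    have : ι ∘ f = D.σ ∘ ι := funext hf
    rw [this]
    exact (IsElem.of_equiv D.σ).comp hι
  refine ⟨AM.of C ((hι.model T).2 D.mod) ⟨⟨f, g, ?_, ?_⟩, ?_, ?_⟩, ι, ⟨hι, hf⟩, hr⟩
  · intro x
    apply hι.inj
    apply D.σ.injective
    rw [hg, hf]
  · intro x
    apply hι.inj
    rw [hf, hg]
  · intro n F x; exact hfe.funMap F x
  · intro n F x; exact hfe.relMap F x

theorem SC.range {A D : AM.{u, v, w} T} {ι : A → D} (h : IsHom ι) : SC D (Set.range ι) := by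
  intro x
  constructor
  · rintro ⟨y, hy⟩
    refine ⟨A.σ.symm y, D.σ.injective ?_⟩
    rw [← h.comm]; simpa using hy
  · rintro ⟨y, rfl⟩
    exact ⟨A.σ y, h.comm y⟩

/-- factorization -/
theorem IsHom.factor {A B D : AM.{u, v, w} T} {f : A → D} {g : B → D} (hf : IsHom f) (hg : IsHom g)
    (h : Set.range f ⊆ Set.range g) : ∃ k : A → B, IsHom k ∧ ∀ x, g (k x) = f x := by
  choose k hk using fun x => h ⟨x, rfl⟩
  refine ⟨k, ⟨IsElem.of_comp hg.elem ?_, fun x => hg.elem.inj ?_⟩, hk⟩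
  · have : g ∘ k = f := funext hk
    rw [this]; exact hf.elem
  · rw [hk, hg.comm, hk, hf.comm]

/-- chains -/
structure Chain (D : AM.{u, v, w} T) {nx ny : ℕ} (φ : (LPlus L).Formula (Fin nx ⊕ Fin ny)) (k : ℕ)
    (N : ℕ → Set D) (a : ℕ → Fin ny → D) (R : ℕ → Set (Fin ny → D)) : Prop where
  mono : ∀ n, N n ⊆ N (n+1)
  el : ∀ n, ElS (LPlus L) (N n)
  ne : (N 0).Nonempty
  ha : ∀ n i, a n i ∈ N (n+1)
  hR : ∀ n, ∀ r ∈ R n, ∀ i, r i ∈ N n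
  inc : ∀ n (r : Fin k → Fin ny → D), Function.Injective r → (∀ i, r i ∈ R n) → ∀ x : Fin nx → D, ∃ i, ¬ φ.Realize (Sum.elim x (r i))
  nin : ∀ n, a n ∉ R n
  lev : ∀ n (p q : ℕ) (ψ : (LPlus L).Formula (Fin p ⊕ Fin q)) (b : Fin p → D) (m : Fin q → D) (e : Fin ny → Fin p),
    (∀ i, b i ∈ N (n+1)) → (∀ i, m i ∈ N n) → (∀ i, b (e i) = a n i) → ψ.Realize (Sum.elim b m) →
    ∃ b' : Fin p → D, (∀ i, b' i ∈ N n) ∧ (fun i => b' (e i)) ∈ R n ∧ ψ.Realize (Sum.elim b' m)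

theorem ElS.plus_image {D E : AM.{u, v, w} T} {f : D → E} (hf : IsElem (LPlus L) f) {S : Set D} (h : ElS (LPlus L) S) :
    ElS (LPlus L) (f '' S) := ElS.image hf h

theorem realize_elim {M N : Type*} [L.Structure M] [L.Structure N] {f : M → N} (hf : IsElem L f) {α β : Type*}
    (φ : L.Formula (α ⊕ β)) (x : α → M) (y : β → M) :
    φ.Realize (Sum.elim (fun i => f (x i)) (fun i => f (y i))) ↔ φ.Realize (Sum.elim x y) := by
  rw [← hf.formula']
  apply iff_of_eq; congr 1; funext i; rcases i with i | i <;> rfl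

theorem Chain.image {D E : AM.{u, v, w} T} {f : D → E} (hf : IsElem (LPlus L) f) {nx ny : ℕ}
    {φ : (LPlus L).Formula (Fin nx ⊕ Fin ny)} {k : ℕ} {N : ℕ → Set D} {a : ℕ → Fin ny → D} {R : ℕ → Set (Fin ny → D)}
    (h : Chain D φ k N a R) : Chain E φ k (fun n => f '' N n) (fun n i => f (a n i)) (fun n => (fun r i => f (r i)) '' R n) := by
  refine ⟨fun n => Set.image_mono (h.mono n), fun n => (h.el n).plus_image hf, h.ne.image f, fun n i => ⟨_, h.ha n i, rfl⟩, ?_, ?_, ?_, ?_⟩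
  · rintro n _ ⟨r, hr, rfl⟩ i
    exact ⟨_, h.hR n r hr i, rfl⟩
  · intro n r hr hr1 x
    choose r' hr' hr2 using hr1
    by_contra hcon
    push Not at hcon
    obtain ⟨x', hx'⟩ := transfer (L := LPlus L) (M := E) (M' := D) (X := Fin nx) (Y := Fin k × Fin ny)
      (y := fun z => f (r' z.1 z.2)) (y' := fun z => r' z.1 z.2) (fun ψ hψ => (hf.formula' ψ _).1 hψ) 
      (BoundedFormula.iInf (fun i : Fin k => φ.relabel (Sum.map id (fun j => (i, j))))) x (by
        simp only [Formula.Realize, BoundedFormula.realize_iInf]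
        intro i
        have := hcon i
        rw [← hr2] at this
        refine Formula.realize_relabel.2 ?_
        convert this using 2
        funext z; rcases z with z | z <;> rfl)
    simp only [Formula.Realize, BoundedFormula.realize_iInf] at hx'
    obtain ⟨i, hi⟩ := h.inc n r' (by
      intro i j hij
      apply hr
      rw [← hr2, ← hr2, hij]) hr' x'
    apply hi
    have := Formula.realize_relabel.1 (hx' i)
    convert this using 2
    funext z; rcases z with z | z <;> rfl
  · rintro n ⟨r, hr, h1⟩
    have : r = a n := by
      funext i
      exact hf.inj (congrFun h1 i)
    exact h.nin n (this ▸ hr)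
  · intro n p q ψ b m e hb hm he hψ
    choose b1 hb1 hb2 using hb
    choose m1 hm1 hm2 using hm
    obtain rfl : (fun i => f (b1 i)) = b := funext hb2
    obtain rfl : (fun i => f (m1 i)) = m := funext hm2
    obtain ⟨b', h1, h2, h3⟩ := h.lev n p q ψ b1 m1 e hb1 hm1 (fun i => hf.inj (he i)) ((realize_elim hf ψ _ _).1 hψ)
    exact ⟨fun i => f (b' i), fun i => ⟨_, h1 i, rfl⟩, ⟨_, h2, rfl⟩, (realize_elim hf ψ _ _).2 h3⟩

end ShelahE34
end FirstOrder

namespace FirstOrder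
set_option linter.all false
open Language Structure
universe u v w u' v' w'
namespace ShelahE34
variable {L : Language.{u, v}} {T : L.Theory} {Tmc : (LPlus L).Theory}

/-- limit configurations -/
structure Lim (D : AM.{u, v, w} T) {nx ny : ℕ} (φ : (LPlus L).Formula (Fin nx ⊕ Fin ny)) (k : ℕ)
    (N N1 : Set D) (a : Fin ny → D) (R : Set (Fin ny → D)) (c : Fin nx → D) : Prop where
  mono : N ⊆ N1
  el : ElS (LPlus L) N
  el1 : ElS (LPlus L) N1
  ne : N.Nonempty
  ha : ∀ i, a i ∈ N1
  hR : ∀ r ∈ R, ∀ i, r i ∈ N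
  inc : ∀ (r : Fin k → Fin ny → D), Function.Injective r → (∀ i, r i ∈ R) → ∀ x : Fin nx → D, ∃ i, ¬ φ.Realize (Sum.elim x (r i))
  nin : a ∉ R
  lev : ∀ (p q : ℕ) (ψ : (LPlus L).Formula (Fin p ⊕ Fin q)) (b : Fin p → D) (m : Fin q → D) (e : Fin ny → Fin p),
    (∀ i, b i ∈ N1) → (∀ i, m i ∈ N) → (∀ i, b (e i) = a i) → ψ.Realize (Sum.elim b m) →
    ∃ b' : Fin p → D, (∀ i, b' i ∈ N) ∧ (fun i => b' (e i)) ∈ R ∧ ψ.Realize (Sum.elim b' m)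
  hc : φ.Realize (Sum.elim c a)
  fs : FS L N1 (N ∪ {y | ∃ n i, y = D.σ^[n] (c i)}) N

theorem AM.los_plus' (A : AM.{u, v, w} T) {I : Type w} (U : Ultrafilter I) {α β : Type*}
    (φ : (LPlus L).Formula (α ⊕ β)) (x : α → I → A) (y : β → I → A) :
    φ.Realize (Sum.elim (fun a => A.mk' U (x a)) (fun a => A.mk' U (y a))) ↔
      ∀ᶠ i in (U : Filter I), φ.Realize (Sum.elim (fun a => x a i) (fun a => y a i)) := by
  have := A.los_plus U φ (Sum.elim x y)
  have e1 : (Sum.elim (fun a => A.mk' U (x a)) (fun a => A.mk' U (y a))) = fun z => A.mk' U (Sum.elim x y z) := by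
    funext z; rcases z with z | z <;> rfl
  have e2 : ∀ i, (Sum.elim (fun a => x a i) (fun a => y a i)) = fun z => Sum.elim x y z i := by
    intro i; funext z; rcases z with z | z <;> rfl
  rw [e1, this]
  simp only [e2]

theorem AM.los' (A : AM.{u, v, w} T) {I : Type w} (U : Ultrafilter I) {α β : Type*}
    (φ : L.Formula (α ⊕ β)) (x : α → I → A) (y : β → I → A) :
    φ.Realize (Sum.elim (fun a => A.mk' U (x a)) (fun a => A.mk' U (y a))) ↔
      ∀ᶠ i in (U : Filter I), φ.Realize (Sum.elim (fun a => x a i) (fun a => y a i)) := by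
  have := A.los U φ (Sum.elim x y)
  have e1 : (Sum.elim (fun a => A.mk' U (x a)) (fun a => A.mk' U (y a))) = fun z => A.mk' U (Sum.elim x y z) := by
    funext z; rcases z with z | z <;> rfl
  have e2 : ∀ i, (Sum.elim (fun a => x a i) (fun a => y a i)) = fun z => Sum.elim x y z i := by
    intro i; funext z; rcases z with z | z <;> rfl
  rw [e1, this]
  simp only [e2]

/-- product of sets -/
def prodSet (D : AM.{u, v, w} T) {I : Type w} (V : Ultrafilter I) (N : I → Set D) : Set (D.up V) :=
  {y | ∃ x : I → D, (∀ n, x n ∈ N n) ∧ D.mk' V x = y}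

theorem prodSet.el (D : AM.{u, v, w} T) {I : Type w} (V : Ultrafilter I) (N : I → Set D) 
    (h : ∀ n, ElS (LPlus L) (N n)) (hne : ∀ n, (N n).Nonempty) : ElS (LPlus L) (prodSet D V N) := by
  intro p q φ a b hb hφ
  choose b1 hb1 hb2 using hb
  choose a1 ha1 using fun i => D.up_surj V (a i)
  obtain rfl : (fun i => D.mk' V (b1 i)) = b := funext hb2
  obtain rfl : (fun i => D.mk' V (a1 i)) = a := funext ha1
  rw [D.los_plus'] at hφ
  have key : ∀ n, ∃ a' : Fin p → D, (∀ i, a' i ∈ N n) ∧ (φ.Realize (Sum.elim (fun i => a1 i n) (fun i => b1 i n)) → 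
    φ.Realize (Sum.elim a' (fun i => b1 i n))) := by
    intro n
    by_cases hh : φ.Realize (Sum.elim (fun i => a1 i n) (fun i => b1 i n))
    · obtain ⟨a', h1, h2⟩ := h n p q φ _ _ (fun i => hb1 i n) hh
      exact ⟨a', h1, fun _ => h2⟩
    · obtain ⟨z, hz⟩ := hne n
      exact ⟨fun _ => z, fun _ => hz, fun h => absurd h hh⟩
  choose a' h1 h2 using key
  refine ⟨fun i => D.mk' V fun n => a' n i, fun i => ⟨_, fun n => h1 n i, rfl⟩, ?_⟩
  rw [D.los_plus']
  exact hφ.mono fun n hn => h2 n hn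

theorem AM.up_iter (D : AM.{u, v, w} T) {I : Type w} (V : Ultrafilter I) (d : D) (n : ℕ) :
    (D.up V).σ^[n] (D.diag V d) = D.diag V (D.σ^[n] d) := by
  induction n with
  | zero => rfl
  | succ n ih => 
    rw [Function.iterate_succ_apply', Function.iterate_succ_apply', ih]
    rfl

theorem Chain.mono' {D : AM.{u, v, w} T} {nx ny : ℕ} {φ : (LPlus L).Formula (Fin nx ⊕ Fin ny)} {k : ℕ}
    {N : ℕ → Set D} {a : ℕ → Fin ny → D} {R : ℕ → Set (Fin ny → D)} (h : Chain D φ k N a R) {m n : ℕ} (hmn : m ≤ n) :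
    N m ⊆ N n := by
  induction n, hmn using Nat.le_induction with
  | base => exact subset_rfl
  | succ n _ ih => exact ih.trans (h.mono n)

theorem Chain.ne' {D : AM.{u, v, w} T} {nx ny : ℕ} {φ : (LPlus L).Formula (Fin nx ⊕ Fin ny)} {k : ℕ}
    {N : ℕ → Set D} {a : ℕ → Fin ny → D} {R : ℕ → Set (Fin ny → D)} (h : Chain D φ k N a R) (n : ℕ) :
    (N n).Nonempty := h.ne.mono (h.mono' (Nat.zero_le n))

theorem Chain.Rne {D : AM.{u, v, w} T} {nx ny : ℕ} {φ : (LPlus L).Formula (Fin nx ⊕ Fin ny)} {k : ℕ}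
    {N : ℕ → Set D} {a : ℕ → Fin ny → D} {R : ℕ → Set (Fin ny → D)} (h : Chain D φ k N a R) (n : ℕ) :
    (R n).Nonempty := by
  obtain ⟨b', h1, h2, h3⟩ := h.lev n ny 0 ⊤ (a n) Fin.elim0 id (h.ha n) (fun i => i.elim0) (fun i => rfl) (by simp [Formula.Realize])
  exact ⟨_, h2⟩

theorem Chain.fs {D : AM.{u, v, w} T} {nx ny : ℕ} {φ : (LPlus L).Formula (Fin nx ⊕ Fin ny)} {k : ℕ}
    {N : ℕ → Set D} {a : ℕ → Fin ny → D} {R : ℕ → Set (Fin ny → D)} (h : Chain D φ k N a R) (st : Stab.{u, v, w} T)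
    (V : Ultrafilter (ULift.{w} ℕ)) (hV : ∀ n, ∀ᶠ m in (V : Filter (ULift.{w} ℕ)), n ≤ m.down) :
    FS L (prodSet D V fun n => N (n.down + 1)) (Set.range (D.diag V)) (prodSet D V fun n => N n.down) := by
  intro p q ψ b m hb hm hψ
  choose b1 hb1 hb2 using hb
  obtain rfl : (fun i => D.mk' V (b1 i)) = b := funext hb2
  have hm' : ∀ i, ∃ (f : ULift.{w} ℕ → D) (d : D), D.mk' V f = m i ∧ ((∀ n, f n = d) ∨ ∀ n, f n ∈ N n.down) := by
    intro i
    rcases hm i with ⟨d, hd⟩ | ⟨f, hf, h1⟩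
    · exact ⟨fun _ => d, d, hd, Or.inl fun _ => rfl⟩
    · exact ⟨f, Classical.choice D.ne, h1, Or.inr hf⟩
  choose f d hf hfd using hm'
  obtain rfl : (fun i => D.mk' V (f i)) = m := funext hf
  classical
  let c : Fin q → Prop := fun i => ∀ n, f i n = d i
  let χ : L.Formula ((Fin p ⊕ Fin q) ⊕ Fin q) := ψ.relabel (Sum.elim (fun i => Sum.inl (Sum.inl i)) (fun i => if c i then Sum.inr i else Sum.inl (Sum.inr i)))
  -- default elements
  obtain ⟨z, hz⟩ := h.ne
  let f' : Fin q → ULift.{w} ℕ → D := fun i n => if c i then z else f i n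
  have hf' : ∀ i n, f' i n ∈ N n.down := by
    intro i n
    by_cases hi : c i
    · simp only [f', if_pos hi]; exact h.mono' (Nat.zero_le _) hz
    · simp only [f', if_neg hi]
      exact (hfd i).resolve_left hi n
  have hχ : ∀ (x : Fin p → D) (n), χ.Realize (Sum.elim (Sum.elim x fun i => f' i n) d) ↔ ψ.Realize (Sum.elim x fun i => f i n) := by
    intro x n
    rw [Formula.realize_relabel]
    apply iff_of_eq; congr 1
    funext i
    rcases i with i | i
    · rfl
    · by_cases hi : c i
      · simp only [Function.comp, Sum.elim_inr, if_pos hi]; exact (hi n).symm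
      · simp [f', hi]
  obtain ⟨K, S, _, δ, hδ⟩ := st.defset' χ
  let X : Set (Fin p ⊕ Fin q → D) := {y | ∀ i, ∃ n, y i ∈ N n}
  obtain ⟨s, x, hx, hxy⟩ := hδ D D.mod X ⟨fun _ => z, fun _ => ⟨0, hz⟩⟩ d
  choose nn hnn using hx
  obtain ⟨n0, hn0⟩ : ∃ n0, ∀ i j, nn i j ≤ n0 := by
    obtain ⟨B, hB⟩ := (Set.finite_range (fun z : Fin K × (Fin p ⊕ Fin q) => nn z.1 z.2)).bddAbove
    exact ⟨B, fun i j => hB ⟨(i, j), rfl⟩⟩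
  have hx0 : ∀ i j, x i j ∈ N n0 := fun i j => h.mono' (hn0 i j) (hnn i j)
  rw [D.los'] at hψ
  have key : ∀ n : ULift.{w} ℕ, ∃ a' : Fin p → D, (∀ i, a' i ∈ N n.down) ∧ (n0 ≤ n.down ∧ ψ.Realize (Sum.elim (fun i => b1 i n) (fun i => f i n)) → 
    ψ.Realize (Sum.elim a' (fun i => f i n))) := by
    intro n
    by_cases hh : n0 ≤ n.down ∧ ψ.Realize (Sum.elim (fun i => b1 i n) (fun i => f i n))
    · obtain ⟨hh1, hh2⟩ := hh
      have h1 := (hxy (Sum.elim (fun i => b1 i n) fun i => f' i n) (by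
        rintro (i | i)
        · exact ⟨_, hb1 i n⟩
        · exact ⟨_, hf' i n⟩)).1 ((hχ _ _).2 hh2)
      have hfs : FS L (N (n.down+1)) (N n.down) (N n.down) := by
        intro p q ψ b m hb hm hψ
        rw [Set.union_self] at hm
        let ψ1 : (LPlus L).Formula (Fin (p + ny) ⊕ Fin q) := ((LHom.sumInl : L →ᴸ LPlus L).onFormula ψ).relabel (Sum.map (Fin.castAdd ny) id)
        have hψ1 : ∀ b : Fin (p+ny) → D, ψ1.Realize (Sum.elim b m) ↔ ψ.Realize (Sum.elim (fun i => b (Fin.castAdd ny i)) m) := by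
          intro b
          rw [Formula.realize_relabel, LHom.realize_onFormula]
          apply iff_of_eq; congr 1; funext i; rcases i with i | i <;> rfl
        obtain ⟨b', h1, h2, h3⟩ := h.lev n.down (p+ny) q ψ1 (Fin.append b (a n.down)) m (Fin.natAdd p) (by
          intro i
          refine Fin.addCases (fun i => ?_) (fun i => ?_) i
          · rw [Fin.append_left]; exact hb i
          · rw [Fin.append_right]; exact h.ha _ i) hm (fun i => Fin.append_right _ _ i) (by
            rw [hψ1]; simpa [Fin.append_left] using hψ)
        exact ⟨_, fun i => h1 _, (hψ1 _).1 h3⟩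
      let δ' : L.Formula (Fin p ⊕ (Fin q ⊕ (Fin K × (Fin p ⊕ Fin q)))) := (δ s).relabel (Sum.elim (Sum.elim (fun i => Sum.inl i) (fun i => Sum.inr (Sum.inl i))) (fun i => Sum.inr (Sum.inr i)))
      have hδ' : ∀ x1 : Fin p → D, δ'.Realize (Sum.elim x1 (Sum.elim (fun i => f' i n) (fun i => x i.1 i.2))) ↔ (δ s).Realize (Sum.elim (Sum.elim x1 fun i => f' i n) (fun i => x i.1 i.2)) := by
        intro x1
        rw [Formula.realize_relabel]
        apply iff_of_eq; congr 1; funext i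
        rcases i with (i | i) | i <;> rfl
      obtain ⟨a', h2, h3⟩ := hfs.formula (h.ne' _) δ' (fun i => b1 i n) (Sum.elim (fun i => f' i n) (fun i => x i.1 i.2)) (fun i => hb1 i n) (by
        rintro (i | i)
        · exact Or.inl (hf' i n)
        · exact Or.inl (h.mono' hh1 (hx0 _ _))) ((hδ' _).2 h1)
      refine ⟨a', h2, fun _ => (hχ _ _).1 ((hxy _ ?_).2 ((hδ' _).1 h3))⟩
      rintro (i | i)
      · exact ⟨_, h2 i⟩
      · exact ⟨_, hf' i n⟩
    · exact ⟨fun _ => z, fun _ => h.mono' (Nat.zero_le _) hz, fun h => absurd h hh⟩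
  choose a' h1 h2 using key
  refine ⟨fun i => D.mk' V fun n => a' n i, fun i => ⟨_, fun n => h1 n i, rfl⟩, ?_⟩
  rw [D.los']
  filter_upwards [hψ, hV n0] with n hn1 hn2
  exact h2 n ⟨hn2, hn1⟩

theorem Chain.lim {D : AM.{u, v, w} T} {nx ny : ℕ} {φ : (LPlus L).Formula (Fin nx ⊕ Fin ny)} {k : ℕ}
    {N : ℕ → Set D} {a : ℕ → Fin ny → D} {R : ℕ → Set (Fin ny → D)} (h : Chain D φ k N a R) (st : Stab.{u, v, w} T)
    (c : Fin nx → D) (hc : ∀ n, φ.Realize (Sum.elim c (a n)))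
    (V : Ultrafilter (ULift.{w} ℕ)) (hV : ∀ n, ∀ᶠ m in (V : Filter (ULift.{w} ℕ)), n ≤ m.down) :
    Lim (D.up V) φ k (prodSet D V fun n => N n.down) (prodSet D V fun n => N (n.down + 1)) 
      (fun i => D.mk' V fun n => a n.down i) 
      {r | ∃ ρ : ULift.{w} ℕ → Fin ny → D, (∀ n, ρ n ∈ R n.down) ∧ r = fun i => D.mk' V fun n => ρ n i} 
      (fun i => D.diag V (c i)) where
  mono := by
    rintro _ ⟨x, hx, rfl⟩
    exact ⟨x, fun n => h.mono _ (hx n), rfl⟩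
  el := prodSet.el _ _ _ (fun n => h.el _) (fun n => h.ne' _)
  el1 := prodSet.el _ _ _ (fun n => h.el _) (fun n => h.ne' _)
  ne := by
    obtain ⟨z, hz⟩ := h.ne
    exact ⟨_, fun _ => z, fun n => h.mono' (Nat.zero_le _) hz, rfl⟩
  ha := fun i => ⟨_, fun n => h.ha _ i, rfl⟩
  hR := by
    rintro _ ⟨ρ, hρ, rfl⟩ i
    exact ⟨_, fun n => h.hR _ _ (hρ n) i, rfl⟩
  inc := by
    intro r hr hr1 x
    choose ρ hρ hρ2 using hr1
    obtain rfl : (fun j => fun i => D.mk' V fun n => ρ j n i) = r := funext fun j => (hρ2 j).symm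
    choose x1 hx1 using fun i => D.up_surj V (x i)
    obtain rfl : (fun i => D.mk' V (x1 i)) = x := funext hx1
    by_contra hcon
    push Not at hcon
    simp only [D.los_plus'] at hcon
    rw [← Filter.eventually_all] at hcon
    have h2 : ∀ᶠ n in (V : Filter (ULift.{w} ℕ)), ∀ i j, i ≠ j → ρ i n ≠ ρ j n := by
      rw [Filter.eventually_all]; intro i
      rw [Filter.eventually_all]; intro j
      by_cases hij : i = j
      · simp [hij]
      simp only [ne_eq, hij, not_false_eq_true, true_imp_iff]
      rw [Ultrafilter.eventually_not]
      intro h3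
      apply hij
      apply hr
      funext l
      show D.mk' V _ = D.mk' V _
      rw [AM.mk'_eq]
      filter_upwards [h3] with n hn
      rw [hn]
    obtain ⟨n, hn1, hn2⟩ := (hcon.and h2).exists
    obtain ⟨i, hi⟩ := h.inc n.down (fun i => ρ i n) (fun i j hij => by
      by_contra hne
      exact hn2 i j hne hij) (fun i => hρ i n) (fun i => x1 i n)
    exact hi (hn1 i)
  nin := by
    rintro ⟨ρ, hρ, h1⟩
    have h2 : ∀ i, ∀ᶠ n in (V : Filter (ULift.{w} ℕ)), a n.down i = ρ n i := by
      intro i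
      rw [← AM.mk'_eq]
      exact congrFun h1 i
    rw [← Filter.eventually_all] at h2
    obtain ⟨n, hn⟩ := h2.exists
    apply h.nin n.down
    rw [funext hn]
    exact hρ n
  lev := by
    intro p q ψ b m e hb hm he hψ
    choose b1 hb1 hb2 using hb
    choose m1 hm1 hm2 using hm
    obtain rfl : (fun i => D.mk' V (b1 i)) = b := funext hb2
    obtain rfl : (fun i => D.mk' V (m1 i)) = m := funext hm2
    rw [D.los_plus'] at hψ
    have he' : ∀ i, ∀ᶠ n in (V : Filter (ULift.{w} ℕ)), b1 (e i) n = a n.down i := by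
      intro i
      rw [← AM.mk'_eq]
      exact he i
    rw [← Filter.eventually_all] at he'
    have key : ∀ n : ULift.{w} ℕ, ∃ (b' : Fin p → D) (r : Fin ny → D), (∀ i, b' i ∈ N n.down) ∧ r ∈ R n.down ∧ 
      ((∀ i, b1 (e i) n = a n.down i) ∧ ψ.Realize (Sum.elim (fun i => b1 i n) (fun i => m1 i n)) → (fun i => b' (e i)) = r ∧ 
       ψ.Realize (Sum.elim b' (fun i => m1 i n))) := by
      intro n
      by_cases hh : (∀ i, b1 (e i) n = a n.down i) ∧ ψ.Realize (Sum.elim (fun i => b1 i n) (fun i => m1 i n))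
      · obtain ⟨b', h1, h2, h3⟩ := h.lev n.down p q ψ _ _ e (fun i => hb1 i n) (fun i => hm1 i n) hh.1 hh.2
        exact ⟨b', _, h1, h2, fun _ => ⟨rfl, h3⟩⟩
      · obtain ⟨z, hz⟩ := h.ne' n.down
        obtain ⟨r, hr⟩ := h.Rne n.down
        exact ⟨fun _ => z, r, fun _ => hz, hr, fun h => absurd h hh⟩
    choose b' r h1 h2 h3 using key
    refine ⟨fun i => D.mk' V fun n => b' n i, fun i => ⟨_, fun n => h1 n i, rfl⟩, ⟨r, h2, ?_⟩, ?_⟩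
    · funext i
      rw [AM.mk'_eq]
      filter_upwards [hψ, he'] with n hn1 hn2
      exact congrFun (h3 n ⟨hn2, hn1⟩).1 i
    · rw [D.los_plus']
      filter_upwards [hψ, he'] with n hn1 hn2
      exact (h3 n ⟨hn2, hn1⟩).2
  hc := by
    have := (D.los_plus' V φ (fun i _ => c i) (fun i n => a n.down i)).2 (Filter.Eventually.of_forall fun n => hc n.down)
    exact this
  fs := by
    have h1 := h.fs st V hV
    intro p q ψ b m hb hm hψ
    refine h1 p q ψ b m hb (fun i => ?_) hψ
    rcases hm i with (h2 | ⟨n, j, h2⟩) | h2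
    · exact Or.inr h2
    · left
      rw [h2, D.up_iter]
      exact ⟨_, rfl⟩
    · exact Or.inr h2

end ShelahE34
end FirstOrder

namespace FirstOrder
set_option linter.all false
open Language Structure
universe u v w u' v' w'
namespace ShelahE34
variable {L : Language.{u, v}} {T : L.Theory} {Tmc : (LPlus L).Theory}

theorem Lim.gmap {D : AM.{u, v, w} T} {nx ny : ℕ} {φ : (LPlus L).Formula (Fin nx ⊕ Fin ny)} {k : ℕ}
    {N N1 : Set D} {a : Fin ny → D} {R : Set (Fin ny → D)} {c : Fin nx → D} (h : Lim D φ k N N1 a R c)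
    {A0 A1 : AM.{u, v, w} T} {ι0 : A0 → D} {ι1 : A1 → D} (h0 : IsElem (LPlus L) ι0) (h1 : IsElem (LPlus L) ι1)
    (r0 : Set.range ι0 = N) (r1 : Set.range ι1 = N1) {i1 : A0 → A1} (hi : ∀ x, ι1 (i1 x) = ι0 x)
    {a' : Fin ny → A1} (ha' : ∀ i, ι1 (a' i) = a i) (θ : (LPlus L).Formula (A1 ⊕ A0))
    (hθ : θ.Realize (Sum.elim (fun x => x) i1)) : 
    ∃ g : A1 → A0, θ.Realize (Sum.elim g fun x => x) ∧ (fun i => ι0 (g (a' i))) ∈ R := by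
  classical
  obtain ⟨p, q, f, gg, ψ, hf, hgg, hψ⟩ := finvars.{u, v, w} θ
  let B : Set A1 := Set.range f ∪ Set.range a'
  haveI : Finite B := ((Set.finite_range f).union (Set.finite_range a')).to_subtype
  obtain ⟨P, ⟨eB⟩⟩ := Finite.exists_equiv_fin B
  let ψ' : (LPlus L).Formula (Fin P ⊕ Fin q) := ψ.relabel (Sum.map (fun i => eB ⟨f i, Or.inl ⟨i, rfl⟩⟩) id)
  have hψ' : ∀ (E : Type w) [(LPlus L).Structure E] (b : Fin P → E) (m : Fin q → E), ψ'.Realize (Sum.elim b m) ↔ ψ.Realize (Sum.elim (fun i => b (eB ⟨f i, Or.inl ⟨i, rfl⟩⟩)) m) := by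
    intro E _ b m
    rw [Formula.realize_relabel]
    apply iff_of_eq; congr 1; funext i; rcases i with i | i <;> rfl
  obtain ⟨b', hb1, hb2, hb3⟩ := h.lev P q ψ' (fun i => ι1 (eB.symm i)) (fun i => ι0 (gg i)) (fun i => eB ⟨a' i, Or.inr ⟨i, rfl⟩⟩)
    (fun i => r1 ▸ ⟨_, rfl⟩) (fun i => r0 ▸ ⟨_, rfl⟩) (fun i => by simp [ha']) (by
      rw [hψ']
      have h2 := (hψ A1 _ _).1 hθ
      rw [← h1.formula'] at h2
      refine (iff_of_eq ?_).1 h2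
      congr 1
      funext i; rcases i with i | i
      · simp
      · simp [hi])
  have hb1' : ∀ i, ∃ x, ι0 x = b' i := by
    intro i
    have := hb1 i
    rw [← r0] at this
    exact this
  choose b2 hb4 using hb1'
  obtain rfl : (fun i => ι0 (b2 i)) = b' := funext hb4
  let g : A1 → A0 := fun x => if hx : x ∈ B then b2 (eB ⟨x, hx⟩) else Classical.choice A0.ne
  have hg : ∀ x (hx : x ∈ B), g x = b2 (eB ⟨x, hx⟩) := fun x hx => dif_pos hx
  refine ⟨g, ?_, ?_⟩
  · rw [hψ]
    have h3 := (hψ' A0 _ _).1 ((realize_elim h0 ψ' b2 gg).1 hb3)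
    refine (iff_of_eq ?_).1 h3
    congr 1
    funext i; rcases i with i | i
    · exact (hg _ (Or.inl ⟨i, rfl⟩)).symm
    · rfl
  · convert hb2 using 1
    funext i
    rw [hg _ (Or.inr ⟨i, rfl⟩)]

theorem Lim.contra {D : AM.{u, v, w} T} {nx ny : ℕ} {φ : (LPlus L).Formula (Fin nx ⊕ Fin ny)} {k : ℕ}
    {N N1 : Set D} {a : Fin ny → D} {R : Set (Fin ny → D)} {c : Fin nx → D} (h : Lim D φ k N N1 a R c)
    (hmc : MC.{u, v, w} T Tmc) (st : Stab.{u, v, w} T) (hs : IsSimpleTheory.{u, v, w} T) (hD : D ⊨ Tmc) : False := by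
  obtain ⟨A0, ι0, h0, r0⟩ := D.sub_plus N h.el h.ne
  obtain ⟨A1, ι1, h1, r1⟩ := D.sub_plus N1 h.el1 (h.ne.mono h.mono)
  have H0 := IsHom.of_elem h0
  have H1 := IsHom.of_elem h1
  have sc0 : SC D N := r0 ▸ SC.range H0
  have sc1 : SC D N1 := r1 ▸ SC.range H1
  obtain ⟨i1, hi1, hi⟩ := H0.factor H1 (by rw [r0, r1]; exact h.mono)
  have ha : ∀ i, ∃ x, ι1 x = a i := by
    intro i
    have := h.ha i
    rw [← r1] at this
    exact this
  choose a' ha' using ha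
  let S : Set D := N ∪ {y | ∃ n i, y = D.σ^[n] (c i)}
  have hS : ∀ x ∈ S, D.σ x ∈ S := by
    rintro x (hx | ⟨n, i, rfl⟩)
    · exact Or.inl ((sc0 x).2 hx)
    · exact Or.inr ⟨n+1, i, (Function.iterate_succ_apply' _ _ _).symm⟩
  obtain ⟨scY, fsY⟩ := orb_close D hS sc1 sc0 h.fs
  obtain ⟨E, j, C, hj, scC, elC, hYC, fsC⟩ := CS.closed hs st ⟨D, N, N1, {y | ∃ n, D.σ^[n] y ∈ S}, fun x hx => ⟨0, Or.inl hx⟩, sc0, sc1, scY,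
    r0 ▸ ElS.range H0.elem, h.ne, fsY⟩
  dsimp only at j hj hYC fsC
  obtain ⟨z, hz⟩ := h.ne
  have hNC : ∀ x ∈ N, j x ∈ C := fun x hx => hYC ⟨x, ⟨0, Or.inl hx⟩, rfl⟩
  obtain ⟨AC, ιC, hC, rC⟩ := E.sub_sc C elC ⟨_, hNC z hz⟩ scC
  obtain ⟨iC, hiC, hic⟩ := (hj.comp H0).factor hC (by
    rw [rC]
    rintro _ ⟨x, rfl⟩
    exact hNC _ (r0 ▸ ⟨x, rfl⟩))
  have hc : ∀ i, ∃ x, ιC x = j (c i) := by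
    intro i
    have : j (c i) ∈ C := hYC ⟨_, ⟨0, Or.inr ⟨0, i, rfl⟩⟩, rfl⟩
    rw [← rC] at this
    exact this
  choose c' hc' using hc
  let X : Cfg.{u, v, w} T := ⟨A0, A1, AC, E, i1, iC, j ∘ ι1, ιC, hi1, hiC, hj.comp H1, hC, fun n => by
    rw [hic]; simp [hi], by
    have e : (Set.range fun n => (j ∘ ι1) (i1 n)) = j '' N := by
      rw [← r0, ← Set.range_comp]
      congr 1; funext n; simp [hi]
    rw [e, Set.range_comp, r1, rC]
    exact fsC⟩
  obtain ⟨W, hW⟩ := exists_uf_formula (L := LPlus L) (Sum.elim (fun x : A1 => x) i1) (I := A1 → A0)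
    (fun g θ => θ.Realize (Sum.elim g fun x => x) ∧ (fun i => ι0 (g (a' i))) ∈ R) (by
      rintro g θ1 θ2 ⟨h1, h2⟩
      rw [Formula.realize_inf] at h1
      exact ⟨⟨h1.1, h2⟩, h1.2, h2⟩) (fun θ hθ => h.gmap h0 h1 r0 r1 hi ha' θ hθ)
  have hG : Gen X W := by
    refine ⟨fun θ hθ => ?_, fun n => ?_⟩
    · refine (hW (θ.relabel Sum.inl) (Formula.realize_relabel.2 hθ)).mono fun g hg => ?_
      have h2 := Formula.realize_relabel.1 hg.1
      exact h2
    · refine (hW (Term.equal (Term.var (Sum.inl (i1 n))) (Term.var (Sum.inr n))) ((realize_eq_of_vars _ _ _).2 rfl)).mono fun g hg => ?_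
      exact (realize_eq_of_vars _ _ _).1 hg.1
  obtain ⟨K, f, hK, hf⟩ := hmc.ext E
  have hjf : IsElem (LPlus L) (f ∘ j) := hmc.elem (hf.comp hj) hD hK
  obtain ⟨r, hr1, hr2, x, hx⟩ := amalgamation hmc st X hG ((h0.model Tmc).2 hD) φ a' {r | (fun i => ι0 (r i)) ∈ R}
    ((hW ⊤ (by simp [Formula.Realize])).mono fun g hg => hg.2) (by
      intro r hr h2
      apply h.nin
      have : a = fun i => ι0 (r i) := by
        funext i
        rw [← ha', ← hi]
        exact congrArg ι1 (congrFun h2.symm i)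
      rw [this]; exact hr) c' K f hf hK (by
      have h2 := (realize_elim hjf φ _ _).2 h.hc
      refine (iff_of_eq ?_).1 h2
      congr 1
      funext i
      rcases i with i | i
      · show f (j (c i)) = f (ιC (c' i))
        rw [hc']
      · show f (j (a i)) = f (j (ι1 (a' i)))
        rw [ha']) k
  obtain ⟨i, hi⟩ := h.inc (fun i j => ι0 (r i j)) (fun i j hij => by
    apply hr1
    funext l
    exact h0.inj (congrFun hij l)) hr2 (fun l => ι0 (x l))
  exact hi ((realize_elim h0 φ _ _).2 (hx i))

end ShelahE34
end FirstOrder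

namespace FirstOrder
set_option linter.all false
open Language Structure
universe u v w u' v' w'
namespace ShelahE34
variable {L : Language.{u, v}} {T : L.Theory} {Tmc : (LPlus L).Theory}

/-- initial segments -/
def pre (ρ : ℕ → ℕ) (n : ℕ) : List ℕ := (List.range n).map ρ

theorem pre_succ (ρ : ℕ → ℕ) (n : ℕ) : pre ρ (n+1) = pre ρ n ++ [ρ n] := by
  simp [pre, List.range_succ]

theorem pre_len (ρ : ℕ → ℕ) (n : ℕ) : (pre ρ n).length = n := by simp [pre]

theorem pre_exists (s : List ℕ) (j : ℕ) : ∃ ρ, pre ρ s.length = s ∧ ρ s.length = j := by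
  refine ⟨fun i => (s ++ [j]).getD i 0, ?_, ?_⟩
  · apply List.ext_getElem
    · simp [pre]
    · intro i h1 h2
      simp [pre, List.getElem?_append, h2]
  · simp

/-- branches with prescribed choices -/
theorem branch_exists (pick : List ℕ → ℕ) : ∃ ρ : ℕ → ℕ, ∀ n, ρ n = pick (pre ρ n) := by
  let l : ℕ → List ℕ := fun n => Nat.rec [] (fun _ s => s ++ [pick s]) n
  have hl : ∀ n, l (n+1) = l n ++ [pick (l n)] := fun n => rfl
  refine ⟨fun n => pick (l n), ?_⟩
  have : ∀ n, pre (fun n => pick (l n)) n = l n := by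
    intro n
    induction n with
    | zero => rfl
    | succ n ih => rw [pre_succ, ih, hl]
  intro n
  rw [this]

/-- the tree property inside an `AM` -/
structure Tree (A : AM.{u, v, w} T) {nx ny : ℕ} (φ : (LPlus L).Formula (Fin nx ⊕ Fin ny)) (k : ℕ) (a : List ℕ → Fin ny → A) : Prop where
  br : ∀ (ρ : ℕ → ℕ) (n : ℕ), ∃ c : Fin nx → A, ∀ m ≤ n, φ.Realize (Sum.elim c (a (pre ρ m)))
  inc : ∀ (η : List ℕ) (c : Fin nx → A) (s : Finset ℕ), s.card = k → ∃ i ∈ s, ¬ φ.Realize (Sum.elim c (a (η ++ [i])))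

theorem Tree.fin {A : AM.{u, v, w} T} {nx ny : ℕ} {φ : (LPlus L).Formula (Fin nx ⊕ Fin ny)} {k : ℕ} {a : List ℕ → Fin ny → A}
    (h : Tree A φ k a) (s : List ℕ) (j : ℕ) : {i | a (s ++ [i]) = a (s ++ [j])}.Finite := by
  by_contra hinf
  obtain ⟨t, ht, htk⟩ := Set.Infinite.exists_subset_card_eq hinf k
  obtain ⟨ρ, h1, h2⟩ := pre_exists s j
  obtain ⟨c, hc⟩ := h.br ρ (s.length + 1)
  have h3 := hc _ le_rfl
  rw [pre_succ, h1, h2] at h3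
  obtain ⟨i, hi, h4⟩ := h.inc s c t htk
  apply h4
  have : a (s ++ [i]) = a (s ++ [j]) := ht hi
  rw [this]; exact h3

theorem Tree.uf {A : AM.{u, v, w} T} {nx ny : ℕ} {φ : (LPlus L).Formula (Fin nx ⊕ Fin ny)} {k : ℕ} {a : List ℕ → Fin ny → A}
    (h : Tree A φ k a) : ∃ U : Ultrafilter (ULift.{w} (ℕ → ℕ)), ∀ (g : List ℕ → ℕ) (n : ℕ), 
      ∀ᶠ ι : ULift.{w} (ℕ → ℕ) in (U : Filter (ULift.{w} (ℕ → ℕ))), a (pre ι.down (n+1)) ≠ a (pre ι.down n ++ [g (pre ι.down n)]) := by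
  classical
  let AH : (List ℕ → Finset ℕ) → Set (ULift.{w} (ℕ → ℕ)) := fun H => {ι | ∀ n, ∀ i ∈ H (pre ι.down n), a (pre ι.down (n+1)) ≠ a (pre ι.down n ++ [i])}
  obtain ⟨U, hU⟩ := exists_uf (Set.range AH) ⟨_, fun _ => ∅, rfl⟩ (by
    rintro _ ⟨H1, rfl⟩ _ ⟨H2, rfl⟩
    refine ⟨_, ⟨fun s => H1 s ∪ H2 s, rfl⟩, fun ι hι => ⟨fun n i hi => hι n i (Finset.mem_union_left _ hi), fun n i hi => hι n i (Finset.mem_union_right _ hi)⟩⟩) (by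
    rintro _ ⟨H, rfl⟩
    have : ∀ s : List ℕ, ∃ i, ∀ j ∈ H s, a (s ++ [i]) ≠ a (s ++ [j]) := by
      intro s
      have hfin : (⋃ j ∈ H s, {i | a (s ++ [i]) = a (s ++ [j])}).Finite := 
        Set.Finite.biUnion (H s).finite_toSet (fun j _ => h.fin s j)
      obtain ⟨i, hi⟩ := hfin.exists_notMem
      refine ⟨i, fun j hj he => hi ?_⟩
      simp only [Set.mem_iUnion]
      exact ⟨j, hj, he⟩
    choose pick hp using this
    obtain ⟨ρ, hρ⟩ := branch_exists pick
    refine ⟨⟨ρ⟩, fun n i hi => ?_⟩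
    show a (pre ρ (n+1)) ≠ a (pre ρ n ++ [i])
    rw [pre_succ, hρ]
    exact hp _ i hi)
  refine ⟨U, fun g n => ?_⟩
  refine Filter.mem_of_superset (hU _ ⟨fun s => {g s}, rfl⟩) fun ι hι => ?_
  exact hι n _ (by simp)

theorem Tree.chain {A : AM.{u, v, w} T} {nx ny : ℕ} {φ : (LPlus L).Formula (Fin nx ⊕ Fin ny)} {k : ℕ} {a : List ℕ → Fin ny → A}
    (h : Tree A φ k a) : ∃ (D : AM.{u, v, w} T) (f : A → D) (N : ℕ → Set D) (b : ℕ → Fin ny → D) (R : ℕ → Set (Fin ny → D)),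
      IsElem (LPlus L) f ∧ Chain D φ k N b R ∧ ∀ n, ∃ c : Fin nx → D, ∀ m ≤ n, φ.Realize (Sum.elim c (b m)) := by
  classical
  obtain ⟨U, hU⟩ := h.uf
  refine ⟨A.up U, A.diag U, fun n => {y | ∃ F : List ℕ → A, A.mk' U (fun ι => F (pre ι.down n)) = y},
    fun n i => A.mk' U fun ι => a (pre ι.down (n+1)) i, 
    fun n => {r | ∃ g : List ℕ → ℕ, r = fun i => A.mk' U fun ι => a (pre ι.down n ++ [g (pre ι.down n)]) i}, A.diag_elem U, ?_, ?_⟩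
  · refine ⟨?_, ?_, ?_, ?_, ?_, ?_, ?_, ?_⟩
    · rintro n _ ⟨F, rfl⟩
      refine ⟨fun s => F s.dropLast, ?_⟩
      simp [pre_succ]
    · intro n p q ψ b m hm hψ
      choose F hF using hm
      choose b1 hb1 using fun i => A.up_surj U (b i)
      obtain rfl : (fun i => A.mk' U (b1 i)) = b := funext hb1
      obtain rfl : (fun i => A.mk' U fun ι => F i (pre ι.down n)) = m := funext hF
      rw [A.los_plus'] at hψ
      have : ∀ s : List ℕ, ∃ x : Fin p → A, (∃ x : Fin p → A, ψ.Realize (Sum.elim x (fun i => F i s))) → ψ.Realize (Sum.elim x (fun i => F i s)) := by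
        intro s
        by_cases hh : ∃ x : Fin p → A, ψ.Realize (Sum.elim x (fun i => F i s))
        · obtain ⟨x, hx⟩ := hh
          exact ⟨x, fun _ => hx⟩
        · exact ⟨fun _ => Classical.choice A.ne, fun h => absurd h hh⟩
      choose G hG using this
      refine ⟨fun i => A.mk' U fun ι => G (pre ι.down n) i, fun i => ⟨fun s => G s i, rfl⟩, ?_⟩
      rw [A.los_plus']
      filter_upwards [hψ] with ι hι
      exact hG _ ⟨_, hι⟩
    · exact ⟨_, fun _ => Classical.choice A.ne, rfl⟩
    · intro n i
      exact ⟨fun s => a s i, rfl⟩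
    · rintro n _ ⟨g, rfl⟩ i
      exact ⟨fun s => a (s ++ [g s]) i, rfl⟩
    · intro n r hr hr1 x
      choose g hg using hr1
      obtain rfl : (fun j => fun i => A.mk' U fun ι => a (pre ι.down n ++ [g j (pre ι.down n)]) i) = r := funext fun j => (hg j).symm
      choose x1 hx1 using fun i => A.up_surj U (x i)
      obtain rfl : (fun i => A.mk' U (x1 i)) = x := funext hx1
      by_contra hcon
      push Not at hcon
      simp only [A.los_plus'] at hcon
      rw [← Filter.eventually_all] at hcon
      have h2 : ∀ᶠ ι in (U : Filter (ULift.{w} (ℕ → ℕ))), ∀ i j, i ≠ j → g i (pre ι.down n) ≠ g j (pre ι.down n) := by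
        rw [Filter.eventually_all]; intro i
        rw [Filter.eventually_all]; intro j
        by_cases hij : i = j
        · simp [hij]
        simp only [ne_eq, hij, not_false_eq_true, true_imp_iff]
        rw [Ultrafilter.eventually_not]
        intro h3
        apply hij
        apply hr
        funext l
        show A.mk' U _ = A.mk' U _
        rw [AM.mk'_eq]
        filter_upwards [h3] with n hn
        rw [hn]
      obtain ⟨ι, hn1, hn2⟩ := (hcon.and h2).exists
      have hinj : Function.Injective fun i => g i (pre ι.down n) := fun i j hij => by
        by_contra hne
        exact hn2 i j hne hij
      obtain ⟨i, hi, h3⟩ := h.inc (pre ι.down n) (fun i => x1 i ι) (Finset.univ.image fun i => g i (pre ι.down n)) (by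
        rw [Finset.card_image_of_injective _ hinj]; simp)
      obtain ⟨i, -, rfl⟩ := Finset.mem_image.1 hi
      exact h3 (hn1 i)
    · rintro n ⟨g, h1⟩
      have h2 : ∀ i, ∀ᶠ ι : ULift.{w} (ℕ → ℕ) in (U : Filter (ULift.{w} (ℕ → ℕ))), a (pre ι.down (n+1)) i = a (pre ι.down n ++ [g (pre ι.down n)]) i := by
        intro i
        rw [← AM.mk'_eq]
        exact congrFun h1 i
      rw [← Filter.eventually_all] at h2
      obtain ⟨ι, h3, h4⟩ := (h2.and (hU g n)).exists
      exact h4 (funext h3)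
    · intro n p q ψ b m e hb hm he hψ
      choose F hF using hb
      choose G hG using hm
      obtain rfl : (fun i => A.mk' U fun ι => F i (pre ι.down (n+1))) = b := funext hF
      obtain rfl : (fun i => A.mk' U fun ι => G i (pre ι.down n)) = m := funext hG
      rw [A.los_plus'] at hψ
      have he' : ∀ i, ∀ᶠ ι : ULift.{w} (ℕ → ℕ) in (U : Filter (ULift.{w} (ℕ → ℕ))), F (e i) (pre ι.down (n+1)) = a (pre ι.down (n+1)) i := by
        intro i
        rw [← AM.mk'_eq]
        exact he i
      rw [← Filter.eventually_all] at he'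
      let P : List ℕ → ℕ → Prop := fun s i => (∀ l, F (e l) (s ++ [i]) = a (s ++ [i]) l) ∧ ψ.Realize (Sum.elim (fun l => F l (s ++ [i])) (fun l => G l s))
      have : ∀ s, ∃ i, (∃ i, P s i) → P s i := by
        intro s
        by_cases hh : ∃ i, P s i
        · obtain ⟨i, hi⟩ := hh
          exact ⟨i, fun _ => hi⟩
        · exact ⟨0, fun h => absurd h hh⟩
      choose g hg using this
      have hev : ∀ᶠ ι : ULift.{w} (ℕ → ℕ) in (U : Filter (ULift.{w} (ℕ → ℕ))), P (pre ι.down n) (g (pre ι.down n)) := by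
        filter_upwards [hψ, he'] with ι h1 h2
        apply hg
        rw [pre_succ] at h1 h2
        exact ⟨_, h2, h1⟩
      refine ⟨fun i => A.mk' U fun ι => F i (pre ι.down n ++ [g (pre ι.down n)]), fun i => ⟨fun s => F i (s ++ [g s]), rfl⟩, ⟨g, ?_⟩, ?_⟩
      · funext i
        rw [AM.mk'_eq]
        filter_upwards [hev] with ι hι
        exact hι.1 i
      · rw [A.los_plus']
        filter_upwards [hev] with ι hι
        exact hι.2
  · intro n
    choose c hc using fun ι : ULift.{w} (ℕ → ℕ) => h.br ι.down (n+1)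
    refine ⟨fun i => A.mk' U fun ι => c ι i, fun m hm => ?_⟩
    rw [A.los_plus']
    exact Filter.Eventually.of_forall fun ι => hc ι (m+1) (by omega)

theorem exists_V : ∃ V : Ultrafilter (ULift.{w} ℕ), ∀ n, ∀ᶠ m : ULift.{w} ℕ in (V : Filter (ULift.{w} ℕ)), n ≤ m.down := by
  obtain ⟨V, hV⟩ := exists_uf (Set.range fun n : ℕ => {m : ULift.{w} ℕ | n ≤ m.down}) ⟨_, 0, rfl⟩ (by
    rintro _ ⟨m, rfl⟩ _ ⟨n, rfl⟩
    refine ⟨_, ⟨max m n, rfl⟩, fun x hx => ?_⟩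
    have : max m n ≤ x.down := hx
    exact ⟨(le_max_left _ _).trans this, (le_max_right _ _).trans this⟩) (by
    rintro _ ⟨m, rfl⟩
    exact ⟨⟨m⟩, le_refl m⟩)
  exact ⟨V, fun n => hV _ ⟨n, rfl⟩⟩

theorem Tree.contra {A : AM.{u, v, w} T} {nx ny : ℕ} {φ : (LPlus L).Formula (Fin nx ⊕ Fin ny)} {k : ℕ} {a : List ℕ → Fin ny → A}
    (h : Tree A φ k a) (hmc : MC.{u, v, w} T Tmc) (st : Stab.{u, v, w} T) (hs : IsSimpleTheory.{u, v, w} T) (hA : A ⊨ Tmc) : False := by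
  obtain ⟨D, f, N, b, R, hf, hch, hc⟩ := h.chain
  obtain ⟨V, hV⟩ := exists_V.{w}
  have hch1 := hch.image (D.diag_elem V)
  choose c hc using hc
  have hl := hch1.lim st (fun i => D.mk' V fun n => c n.down i) (by
    intro n
    refine (D.los_plus' V φ (fun i m => c m.down i) (fun i _ => b n i)).2 ?_
    filter_upwards [hV n] with m hm
    exact hc m.down n hm) V hV
  refine hl.contra hmc st hs ?_
  rw [← ((D.up V).diag_elem V).model Tmc, ← (D.diag_elem V).model Tmc, ← hf.model Tmc]
  exact hA

theorem tp_contra (hmc : MC.{u, v, w} T Tmc) (st : Stab.{u, v, w} T) (hs : IsSimpleTheory.{u, v, w} T)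
    {M : Type w} [(LPlus L).Structure M] [Nonempty M] (hM : M ⊨ Tmc) (hT : Taut T ⊆ Tmc) {nx ny : ℕ} (φ : (LPlus L).Formula (Fin nx ⊕ Fin ny)) (k : ℕ)
    (a : List ℕ → Fin ny → M)
    (h1 : ∀ (ρ : ℕ → ℕ) (n : ℕ),
        ∃ (N' : Type w) (_ : (LPlus L).Structure N') (g : M ↪ₑ[LPlus L] N') (c : Fin nx → N'),
          ∀ m : ℕ, m ≤ n → φ.Realize (Sum.elim c fun i => g (a ((List.range m).map ρ) i)))
    (h2 : ∀ (η : List ℕ) (N' : Type w) (_ : (LPlus L).Structure N') (g : M ↪ₑ[LPlus L] N')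
        (c : Fin nx → N') (s : Finset ℕ), s.card = k →
          ¬ ∀ i ∈ s, φ.Realize (Sum.elim c fun j => g (a (η ++ [i]) j))) : False := by
  obtain ⟨A, e, -⟩ := AM.of_model (T := T) M (Theory.Model.mono hM hT)
  have he : IsElem (LPlus L) e := IsElem.of_equiv e
  have hes : ∀ x, e (e.symm x) = x := fun x => by simp
  have tree : Tree A φ k (fun s i => e.symm (a s i)) := by
    constructor
    · intro ρ n
      obtain ⟨N', _, g, c, hc⟩ := h1 ρ n
      have hg : IsElem (LPlus L) (g ∘ e) := (IsElem.of_emb g).comp he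
      obtain ⟨x', hx'⟩ := transfer (L := LPlus L) (M := N') (M' := A) (X := Fin nx) (Y := Fin (n+1) × Fin ny)
        (y := fun z => (g ∘ e) (e.symm (a (pre ρ z.1) z.2))) (y' := fun z => e.symm (a (pre ρ z.1) z.2)) (fun ψ hψ => (hg.formula' ψ _).1 hψ) 
        (BoundedFormula.iInf (fun i : Fin (n+1) => φ.relabel (Sum.map id (fun j => (i, j))))) c (by
          simp only [Formula.Realize, BoundedFormula.realize_iInf]
          intro i
          refine Formula.realize_relabel.2 ?_
          refine (iff_of_eq ?_).1 (hc i.1 (by omega))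
          congr 1
          funext z; rcases z with z | z
          · rfl
          · simp [pre])
      simp only [Formula.Realize, BoundedFormula.realize_iInf] at hx'
      refine ⟨x', fun m hm => ?_⟩
      have := Formula.realize_relabel.1 (hx' ⟨m, by omega⟩)
      refine (iff_of_eq ?_).1 this
      congr 1
      funext z; rcases z with z | z <;> rfl
    · intro η c s hs
      have := h2 η M inferInstance (ElementaryEmbedding.refl _ M) (fun i => e (c i)) s hs
      push Not at this
      obtain ⟨i, hi, h3⟩ := this
      refine ⟨i, hi, fun h4 => h3 ?_⟩
      have h5 := (realize_elim he φ _ _).2 h4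
      refine (iff_of_eq ?_).1 h5
      congr 1
      funext z; rcases z with z | z
      · rfl
      · simp
  exact tree.contra hmc st hs ((he.model Tmc).2 hM)

theorem final
    (L : Language.{u, v}) (T : L.Theory) (hT : SemComplete T)
    (hsimple : IsSimpleTheory.{u, v, w} T)
    (Tmc : (LPlus L).Theory)
    (hmc : IsModelCompletion.{u, v, w} (Taut T) Tmc)
    (Tstar : (LPlus L).Theory) (hc : IsCompletionOf Tmc Tstar) :
    IsSimpleTheory.{u, v, w} Tstar := by
  rintro ⟨nx, ny, φ, k, hk, M, a, h1, h2⟩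
  have hM : M ⊨ Tmc := Theory.Model.mono M.is_model hc.1
  have hMC : MC.{u, v, w} T Tmc := MC.of_hyp hT hmc M hM
  have st : Stab.{u, v, w} T := ⟨hMC.noLadder, hMC.eqv⟩
  exact tp_contra hMC st hsimple hM hmc.1 φ k a h1 h2

end ShelahE34
end FirstOrder

namespace FirstOrder

open Language Structure

universe u v w

namespace ShelahE34

theorem completion_of_modelCompletion_simple
    (L : Language.{u, v}) (T : L.Theory) (hT : SemComplete T)
    (hsimple : IsSimpleTheory.{u, v, w} T)
    (Tmc : (LPlus L).Theory)
    (hmc : IsModelCompletion.{u, v, w} (Taut T) Tmc)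
    (Tstar : (LPlus L).Theory) (hc : IsCompletionOf Tmc Tstar) :
    IsSimpleTheory.{u, v, w} Tstar := by
  exact final L T hT hsimple Tmc hmc Tstar hc

end ShelahE34

end FirstOrder
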